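/- Let g be a complex simple Lie algebra. The Chevalley involution ψ of g is an inner automorphism if and only if g has type B_n (n ≥ 1), C_n (n ≥ 3), D_{2n} (n ≥ 2), E₇, E₈, F₄, or G₂. -/

import Mathlib

noncomputable section

/-- A function `V → ℂ` is a polynomial function if it lies in the subalgebra of
functions generated by the linear functionals, i.e. it is given by a polynomial
in linear coordinates. -/
def IsPolyFun {V : Type*} [AddCommGroup V] [Module ℂ V] (f : V → ℂ) : Prop :=
  f ∈ Algebra.adjoin ℂ (Set.range fun l : V →ₗ[ℂ] ℂ => (l : V → ℂ))

/-- Given a subgroup `G` of `GL(V)`, the group `G'` of all linear automorphisms of `V`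
preserving every `G`-invariant polynomial function on `V`. -/
def primeGroup {V : Type*} [AddCommGroup V] [Module ℂ V]
    (G : Subgroup (V ≃ₗ[ℂ] V)) : Subgroup (V ≃ₗ[ℂ] V) where
  carrier := {φ | ∀ f : V → ℂ, IsPolyFun f →
      (∀ g ∈ G, ∀ v : V, f (g v) = f v) → ∀ v : V, f (φ v) = f v}
  one_mem' := by intro f _ _ v; rfl
  mul_mem' := by
    intro a b ha hb f hf hinv v
    have h2 : f (a (b v)) = f (b v) := ha f hf hinv (b v)
    exact h2.trans (hb f hf hinv v)
  inv_mem' := by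
    intro a ha f hf hinv v
    have h := ha f hf hinv (a⁻¹ v)
    have : a (a⁻¹ v) = v := a.apply_symm_apply v
    rw [this] at h
    exact h.symm

/-- The algebraic exponential of an endomorphism of a finite-dimensional space
(intended for nilpotent endomorphisms, where the series is a finite sum). -/
def endExp {g : Type*} [AddCommGroup g] [Module ℂ g] [FiniteDimensional ℂ g]
    (A : Module.End ℂ g) : Module.End ℂ g :=
  ∑ k ∈ Finset.range (Module.finrank ℂ g + 1), (k.factorial : ℂ)⁻¹ • A ^ k

/-- The adjoint group `G = Aut(g)⁰` of a semisimple Lie algebra `g`: the subgroup of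
`GL(g)` generated by the exponentials of nilpotent inner derivations `ad x`. -/
def adjointGroup (g : Type*) [LieRing g] [LieAlgebra ℂ g] [FiniteDimensional ℂ g] :
    Subgroup (g ≃ₗ[ℂ] g) :=
  Subgroup.closure {u : g ≃ₗ[ℂ] g | ∃ x : g,
    IsNilpotent (LieAlgebra.ad ℂ g x) ∧ (u : g →ₗ[ℂ] g) = endExp (LieAlgebra.ad ℂ g x)}

/-- The subgroup of `GL(g)` fixing a subalgebra `t` pointwise. -/
def pointwiseStab {g : Type*} [LieRing g] [LieAlgebra ℂ g]
    (t : LieSubalgebra ℂ g) : Subgroup (g ≃ₗ[ℂ] g) where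
  carrier := {u | ∀ x ∈ t, u x = x}
  one_mem' := by intro x _; rfl
  mul_mem' := by
    intro a b ha hb x hx
    have : a (b x) = a x := by rw [hb x hx]
    exact this.trans (ha x hx)
  inv_mem' := by
    intro a ha x hx
    conv_lhs => rw [← ha x hx]
    exact a.symm_apply_apply x

/-- The maximal torus of the adjoint group corresponding to a Cartan subalgebra `t`:
the elements of the adjoint group acting trivially on `t`. -/
def maximalTorus (g : Type*) [LieRing g] [LieAlgebra ℂ g] [FiniteDimensional ℂ g]
    (t : LieSubalgebra ℂ g) : Subgroup (g ≃ₗ[ℂ] g) :=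
  adjointGroup g ⊓ pointwiseStab t


namespace S5

/-! ## Serre presentations -/

section Serre

variable {ι : Type} [DecidableEq ι] {L : Type*} [LieRing L] [LieAlgebra ℂ L]

/-- Elements satisfying the Serre relations. -/
structure SRel (CM : Matrix ι ι ℤ) (h e f : ι → L) : Prop where
  hh : ∀ i j, ⁅h i, h j⁆ = 0
  ef : ∀ i, ⁅e i, f i⁆ = h i
  ef_ne : ∀ i j, i ≠ j → ⁅e i, f j⁆ = 0
  he : ∀ i j, ⁅h i, e j⁆ = CM i j • e j
  hf : ∀ i j, ⁅h i, f j⁆ = - (CM i j • f j)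
  ade : ∀ i j, (LieAlgebra.ad ℂ L (e i) ^ (-CM i j).toNat) ⁅e i, e j⁆ = 0
  adf : ∀ i j, (LieAlgebra.ad ℂ L (f i) ^ (-CM i j).toNat) ⁅f i, f j⁆ = 0

variable (CM : Matrix ι ι ℤ)

/-- Quotient map to the Serre algebra. -/
def sMk : FreeLieAlgebra ℂ (CartanMatrix.Generators ι) →ₗ⁅ℂ⁆ Matrix.ToLieAlgebra ℂ CM where
  toLinearMap := (CartanMatrix.Relations.toIdeal ℂ CM).toSubmodule.mkQ
  map_lie' := by intro x y; rfl

lemma sMk_surj : Function.Surjective (sMk CM) := Submodule.mkQ_surjective _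

lemma sMk_eq_zero {x} : sMk CM x = 0 ↔ x ∈ CartanMatrix.Relations.toIdeal ℂ CM :=
  Submodule.Quotient.mk_eq_zero _

def sH (i : ι) : Matrix.ToLieAlgebra ℂ CM := sMk CM (FreeLieAlgebra.of ℂ (.H i))
def sE (i : ι) : Matrix.ToLieAlgebra ℂ CM := sMk CM (FreeLieAlgebra.of ℂ (.E i))
def sF (i : ι) : Matrix.ToLieAlgebra ℂ CM := sMk CM (FreeLieAlgebra.of ℂ (.F i))

lemma hom_ad_pow {L₁ L₂ : Type*} [LieRing L₁] [LieAlgebra ℂ L₁] [LieRing L₂] [LieAlgebra ℂ L₂]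
    (φ : L₁ →ₗ⁅ℂ⁆ L₂) (x y : L₁) (n : ℕ) :
    φ ((LieAlgebra.ad ℂ L₁ x ^ n) y) = (LieAlgebra.ad ℂ L₂ (φ x) ^ n) (φ y) := by
  induction n with
  | zero => simp
  | succ n ih => rw [pow_succ', pow_succ', Module.End.mul_apply, Module.End.mul_apply, ← ih]; simp

lemma sRel : SRel CM (sH CM) (sE CM) (sF CM) := by
  have key : ∀ x ∈ CartanMatrix.Relations.toSet ℂ CM, sMk CM x = 0 := fun x hx =>
    (sMk_eq_zero CM).2 (LieSubmodule.subset_lieSpan hx)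
  refine ⟨fun i j => ?_, fun i => ?_, fun i j hij => ?_, fun i j => ?_, fun i j => ?_, fun i j => ?_,
    fun i j => ?_⟩
  · have := key (CartanMatrix.Relations.HH ℂ (i, j)) (by simp [CartanMatrix.Relations.toSet])
    simpa [CartanMatrix.Relations.HH, sH] using this
  · have := key (CartanMatrix.Relations.EF ℂ (i, i)) (by
      unfold CartanMatrix.Relations.toSet
      have : CartanMatrix.Relations.EF ℂ (i, i) ∈ Set.range (CartanMatrix.Relations.EF ℂ (B := ι)) :=
        ⟨_, rfl⟩
      simp only [Set.mem_union, this]; tauto)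
    simpa [CartanMatrix.Relations.EF, sH, sE, sF, sub_eq_zero] using this
  · have := key (CartanMatrix.Relations.EF ℂ (i, j)) (by
      unfold CartanMatrix.Relations.toSet
      have : CartanMatrix.Relations.EF ℂ (i, j) ∈ Set.range (CartanMatrix.Relations.EF ℂ (B := ι)) :=
        ⟨_, rfl⟩
      simp only [Set.mem_union, this]; tauto)
    simpa [CartanMatrix.Relations.EF, sH, sE, sF, hij] using this
  · have := key (CartanMatrix.Relations.HE ℂ CM (i, j)) (by
      unfold CartanMatrix.Relations.toSet
      have : CartanMatrix.Relations.HE ℂ CM (i, j) ∈ Set.range (CartanMatrix.Relations.HE ℂ CM) :=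
        ⟨_, rfl⟩
      simp only [Set.mem_union, this]; tauto)
    simpa [CartanMatrix.Relations.HE, sH, sE, sF, sub_eq_zero] using this
  · have := key (CartanMatrix.Relations.HF ℂ CM (i, j)) (by
      unfold CartanMatrix.Relations.toSet
      have : CartanMatrix.Relations.HF ℂ CM (i, j) ∈ Set.range (CartanMatrix.Relations.HF ℂ CM) :=
        ⟨_, rfl⟩
      simp only [Set.mem_union, this]; tauto)
    simpa [CartanMatrix.Relations.HF, sH, sE, sF, add_eq_zero_iff_eq_neg] using this
  · have := key (CartanMatrix.Relations.adE ℂ CM (i, j)) (by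
      unfold CartanMatrix.Relations.toSet
      have : CartanMatrix.Relations.adE ℂ CM (i, j) ∈ Set.range (CartanMatrix.Relations.adE ℂ CM) :=
        ⟨_, rfl⟩
      simp only [Set.mem_union, this]; tauto)
    simpa [CartanMatrix.Relations.adE, sH, sE, sF, hom_ad_pow] using this
  · have := key (CartanMatrix.Relations.adF ℂ CM (i, j)) (by
      unfold CartanMatrix.Relations.toSet
      have : CartanMatrix.Relations.adF ℂ CM (i, j) ∈ Set.range (CartanMatrix.Relations.adF ℂ CM) :=
        ⟨_, rfl⟩
      simp only [Set.mem_union, this]; tauto)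
    simpa [CartanMatrix.Relations.adF, sH, sE, sF, hom_ad_pow] using this

lemma SRel.map {L' : Type*} [LieRing L'] [LieAlgebra ℂ L'] {CM : Matrix ι ι ℤ} {h e f : ι → L}
    (hr : SRel CM h e f) (φ : L →ₗ⁅ℂ⁆ L') : SRel CM (φ ∘ h) (φ ∘ e) (φ ∘ f) where
  hh i j := by simp [← LieHom.map_lie, hr.hh]
  ef i := by simp [← LieHom.map_lie, hr.ef]
  ef_ne i j hij := by simp [← LieHom.map_lie, hr.ef_ne i j hij]
  he i j := by simp [← LieHom.map_lie, hr.he]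
  hf i j := by simp [← LieHom.map_lie, hr.hf]
  ade i j := by simp [← LieHom.map_lie, ← hom_ad_pow, hr.ade]
  adf i j := by simp [← LieHom.map_lie, ← hom_ad_pow, hr.adf]

/-- generator images -/
def genFun (h e f : ι → L) : CartanMatrix.Generators ι → L
  | .H i => h i
  | .E i => e i
  | .F i => f i

variable {CM}

lemma exists_sLift {h e f : ι → L} (hr : SRel CM h e f) :
    ∃ φ : Matrix.ToLieAlgebra ℂ CM →ₗ⁅ℂ⁆ L, (∀ i, φ (sH CM i) = h i) ∧ (∀ i, φ (sE CM i) = e i) ∧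
      (∀ i, φ (sF CM i) = f i) := by
  let g := FreeLieAlgebra.lift ℂ (genFun h e f)
  have hH : ∀ i, g (FreeLieAlgebra.of ℂ (.H i)) = h i := fun i => by simp [g, genFun]
  have hE : ∀ i, g (FreeLieAlgebra.of ℂ (.E i)) = e i := fun i => by simp [g, genFun]
  have hF : ∀ i, g (FreeLieAlgebra.of ℂ (.F i)) = f i := fun i => by simp [g, genFun]
  have hle : CartanMatrix.Relations.toIdeal ℂ CM ≤ g.ker := by
    unfold CartanMatrix.Relations.toIdeal
    rw [LieSubmodule.lieSpan_le]
    rintro x (((((⟨⟨i, j⟩, rfl⟩ | ⟨⟨i, j⟩, rfl⟩) | ⟨⟨i, j⟩, rfl⟩) | ⟨⟨i, j⟩, rfl⟩) | ⟨⟨i, j⟩, rfl⟩) |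
      ⟨⟨i, j⟩, rfl⟩)
    · simp [CartanMatrix.Relations.HH, hH, hr.hh]
    · by_cases hij : i = j
      · subst hij; simp [CartanMatrix.Relations.EF, hH, hE, hF, hr.ef]
      · simp [CartanMatrix.Relations.EF, hij, hE, hF, hr.ef_ne i j hij]
    · simp [CartanMatrix.Relations.HE, hH, hE, hr.he]
    · simp [CartanMatrix.Relations.HF, hH, hF, hr.hf]
    · simp [CartanMatrix.Relations.adE, hE, hr.ade, hom_ad_pow]
    · simp [CartanMatrix.Relations.adF, hF, hr.adf, hom_ad_pow]
  let φ : Matrix.ToLieAlgebra ℂ CM →ₗ⁅ℂ⁆ L :=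
    { toLinearMap := (CartanMatrix.Relations.toIdeal ℂ CM).toSubmodule.liftQ g.toLinearMap
        (fun x hx => by have := hle hx; simpa using this)
      map_lie' := by
        intro x y
        obtain ⟨x, rfl⟩ := sMk_surj CM x
        obtain ⟨y, rfl⟩ := sMk_surj CM y
        rw [← LieHom.map_lie]
        change g ⁅x, y⁆ = ⁅g x, g y⁆
        simp }
  exact ⟨φ, hH, hE, hF⟩

lemma s_span : LieSubalgebra.lieSpan ℂ (Matrix.ToLieAlgebra ℂ CM)
    (Set.range (sE CM) ∪ Set.range (sF CM)) = ⊤ := by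
  set K := LieSubalgebra.lieSpan ℂ (Matrix.ToLieAlgebra ℂ CM) (Set.range (sE CM) ∪ Set.range (sF CM))
  have hE : ∀ i, sE CM i ∈ K := fun i => LieSubalgebra.subset_lieSpan (Or.inl ⟨i, rfl⟩)
  have hF : ∀ i, sF CM i ∈ K := fun i => LieSubalgebra.subset_lieSpan (Or.inr ⟨i, rfl⟩)
  have hH : ∀ i, sH CM i ∈ K := fun i => by
    rw [← (sRel CM).ef i]; exact K.lie_mem (hE i) (hF i)
  -- lift to K
  let g : FreeLieAlgebra ℂ (CartanMatrix.Generators ι) →ₗ⁅ℂ⁆ K :=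
    FreeLieAlgebra.lift ℂ (genFun (fun i => ⟨_, hH i⟩) (fun i => ⟨_, hE i⟩) (fun i => ⟨_, hF i⟩))
  have : K.incl.comp g = sMk CM := by
    apply FreeLieAlgebra.hom_ext
    intro x
    rcases x with i | i | i <;> simp [g, genFun, sE, sF, sH]
  rw [eq_top_iff]
  rintro x -
  obtain ⟨x, rfl⟩ := sMk_surj CM x
  rw [← this]
  exact (g x).2

end Serre
end S5

namespace S5

section Inj
open LieAlgebra LieSubalgebra

variable {ι : Type} [Fintype ι] [DecidableEq ι]

/-- Positivity of a generalized Cartan matrix (finite type). -/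
def PosM (A : Matrix ι ι ℤ) : Prop :=
  ∀ x : ι → ℤ, (∀ i, 0 ≤ x i) → x ≠ 0 → ∃ j, 0 < x j ∧ 0 < ∑ i, x i * A i j

variable {L : Type*} [LieRing L] [LieAlgebra ℂ L] {H : LieSubalgebra ℂ L} (b : LieAlgebra.Basis ι H)

/-- weight spaces -/
def W (lam : ι → ℤ) : Submodule ℂ L where
  carrier := {x | ∀ j, ⁅b.h j, x⁆ = ((∑ i, lam i * b.A i j : ℤ) : ℂ) • x}
  add_mem' := by
    intro x y hx hy j
    rw [lie_add, hx j, hy j, smul_add]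
  zero_mem' := by intro j; simp
  smul_mem' := by
    intro c x hx j
    rw [lie_smul, hx j, smul_comm]

lemma mem_W {lam : ι → ℤ} {x : L} :
    x ∈ W b lam ↔ ∀ j, ⁅b.h j, x⁆ = ((∑ i, lam i * b.A i j : ℤ) : ℂ) • x := Iff.rfl

lemma lie_mem_W {l m : ι → ℤ} {x y : L} (hx : x ∈ W b l) (hy : y ∈ W b m) : ⁅x, y⁆ ∈ W b (l + m) := by
  intro j
  rw [leibniz_lie, hx j, hy j, lie_smul, smul_lie, ← add_smul]
  congr 1
  push_cast
  simp [add_mul, Finset.sum_add_distrib]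

lemma e_mem_W (i : ι) : b.e i ∈ W b (Pi.single i 1) := by
  intro j
  rw [b.lie_h_e]
  simp [Pi.single_apply, Int.cast_smul_eq_zsmul]

lemma f_mem_W (i : ι) : b.f i ∈ W b (-Pi.single i 1) := by
  intro j
  rw [b.lie_h_f]
  simp [Pi.single_apply, Int.cast_smul_eq_zsmul]

lemma h_mem_W (i : ι) : b.h i ∈ W b 0 := by
  intro j
  rw [b.lie_h_h]
  simp

lemma H_le_W : H.toSubmodule ≤ W b 0 := by
  rw [b.coe_cartan_eq_span, Submodule.span_le]
  rintro _ ⟨i, rfl⟩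
  exact h_mem_W b i

/-- components in an ideal -/
lemma extract (I : LieIdeal ℂ L) (S : Finset (ι → ℤ)) : ∀ (x : (ι → ℤ) → L)
    (_ : ∀ l ∈ S, x l ∈ W b l) (_ : ∑ l ∈ S, x l ∈ I), ∀ l ∈ S, x l ∈ I := by
  induction S using Finset.induction_on with
  | empty => intro x _ _ l hl; simp at hl
  | insert l0 S hl0 ih =>
    intro x hx hsum
    have hS : ∀ l ∈ S, x l ∈ I := by
      intro m hm
      have hne : m ≠ l0 := fun h => hl0 (h ▸ hm)
      obtain ⟨j, hj⟩ : ∃ j, (∑ i, m i * b.A i j) ≠ ∑ i, l0 i * b.A i j := by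
        by_contra hcon
        push Not at hcon
        apply hne
        have hd : Matrix.vecMul (m - l0) b.A = 0 := by
          ext j
          have := hcon j
          simp [Matrix.vecMul, dotProduct, sub_mul, this]
        have := Matrix.eq_zero_of_vecMul_eq_zero b.nondegen.det_ne_zero hd
        exact sub_eq_zero.1 this
      have h1 := ih (fun l => (((∑ i, l i * b.A i j : ℤ) : ℂ) - ((∑ i, l0 i * b.A i j : ℤ) : ℂ)) • x l)
        (fun l hl => Submodule.smul_mem _ _ (hx l (Finset.mem_insert_of_mem hl))) ?_ m hm
      · have hc : (((∑ i, m i * b.A i j : ℤ) : ℂ) - ((∑ i, l0 i * b.A i j : ℤ) : ℂ)) ≠ 0 := by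
          rw [sub_ne_zero]; exact_mod_cast hj
        have := I.smul_mem (((∑ i, m i * b.A i j : ℤ) : ℂ) - ((∑ i, l0 i * b.A i j : ℤ) : ℂ))⁻¹ h1
        rwa [smul_smul, inv_mul_cancel₀ hc, one_smul] at this
      · have h2 : ⁅b.h j, ∑ l ∈ insert l0 S, x l⁆ -
            ((∑ i, l0 i * b.A i j : ℤ) : ℂ) • ∑ l ∈ insert l0 S, x l ∈ I :=
          sub_mem (I.lie_mem hsum) (I.smul_mem _ hsum)
        convert h2 using 1
        rw [lie_sum, Finset.smul_sum, ← Finset.sum_sub_distrib, Finset.sum_insert hl0,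
          hx l0 (Finset.mem_insert_self _ _) j, sub_self, zero_add]
        refine Finset.sum_congr rfl fun l hl => ?_
        rw [hx l (Finset.mem_insert_of_mem hl) j, sub_smul]
    intro l hl
    rcases Finset.mem_insert.1 hl with rfl | hl
    · rw [Finset.sum_insert hl0] at hsum
      have : ∑ l ∈ S, x l ∈ I := sum_mem hS
      have := sub_mem hsum this
      simpa using this
    · exact hS l hl

/-- The allowed pieces. -/
def V (lam : ι → ℤ) : Submodule ℂ L :=
  if lam = 0 then H.toSubmodule else
  if (∀ i, 0 ≤ lam i) ∨ (∀ i, lam i ≤ 0) then W b lam else ⊥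

lemma V_le_W (l : ι → ℤ) : V b l ≤ W b l := by
  unfold V
  split_ifs with h1 h2
  · subst h1; exact H_le_W b
  · exact le_rfl
  · exact bot_le

lemma lieSpan_e_le : ∀ x ∈ lieSpan ℂ L (Set.range b.e),
    x ∈ ⨆ l : {l : ι → ℤ // l ≠ 0 ∧ ∀ i, 0 ≤ l i}, W b l.1 := by
  intro x hx
  induction hx using lieSpan_induction with
  | mem x hx =>
    obtain ⟨i, rfl⟩ := hx
    refine Submodule.mem_iSup_of_mem ⟨Pi.single i 1, by simp, fun j => ?_⟩ (e_mem_W b i)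
    by_cases h : j = i
    · subst h; simp
    · simp [h]
  | zero => exact zero_mem _
  | add x y _ _ hx hy => exact add_mem hx hy
  | smul c x _ hx => exact Submodule.smul_mem _ _ hx
  | lie x y h1 h2 hx hy =>
    clear h1 h2
    induction hx using Submodule.iSup_induction' with
    | mem l x hx =>
      induction hy using Submodule.iSup_induction' with
      | mem m y hy =>
        refine Submodule.mem_iSup_of_mem ⟨l.1 + m.1, fun h => ?_, fun i => add_nonneg (l.2.2 i) (m.2.2 i)⟩
          (lie_mem_W b hx hy)
        apply l.2.1
        ext i
        have h1 := congrFun h i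
        have h2 := l.2.2 i
        have h3 := m.2.2 i
        simp at h1 ⊢
        omega
      | zero => simp
      | add y z _ _ hy hz => rw [lie_add]; exact add_mem hy hz
    | zero => simp
    | add y z _ _ hy hz => rw [add_lie]; exact add_mem hy hz

lemma W_symm (l : ι → ℤ) : W b.symm l = W b (-l) := by
  ext x
  simp only [mem_W, LieAlgebra.Basis.symm_h, LieAlgebra.Basis.symm_A, Pi.neg_apply, neg_lie]
  refine forall_congr' fun j => ?_
  rw [neg_eq_iff_eq_neg, ← neg_smul]
  simp

lemma iSup_V : ⨆ l, V b l = ⊤ := by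
  have h := b.iSup_cartan_borelLower_borelUpper_eq_top
  have h' : H.toLieSubmodule ⊔ b.borelLower ⊔ b.borelUpper = ⊤ := by simpa using h
  rw [eq_top_iff]
  rintro x -
  have hx : x ∈ H.toLieSubmodule ⊔ b.borelLower ⊔ b.borelUpper := by rw [h']; trivial
  obtain ⟨yc, hyc, yl, hyl, yu, hyu, rfl⟩ :
        ∃ᵉ (yc ∈ H) (yl ∈ lieSpan ℂ L (Set.range b.f)) (yu ∈ lieSpan ℂ L (Set.range b.e)),
        yc + yl + yu = x := by simpa [LieSubmodule.mem_sup] using! hx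
  refine add_mem (add_mem ?_ ?_) ?_
  · refine Submodule.mem_iSup_of_mem 0 ?_
    simpa [V] using hyc
  · have := lieSpan_e_le b.symm yl hyl
    refine (iSup_le ?_ : (⨆ l : {l : ι → ℤ // l ≠ 0 ∧ ∀ i, 0 ≤ l i}, W b.symm l.1) ≤ _) this
    rintro ⟨l, hl0, hl⟩
    refine le_trans ?_ (le_iSup (V b) (-l))
    simp only [V, W_symm]
    rw [if_neg (by simpa using hl0), if_pos (Or.inr fun i => by simpa using hl i)]
  · have := lieSpan_e_le b yu hyu
    refine (iSup_le ?_ : (⨆ l : {l : ι → ℤ // l ≠ 0 ∧ ∀ i, 0 ≤ l i}, W b l.1) ≤ _) this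
    rintro ⟨l, hl0, hl⟩
    refine le_trans ?_ (le_iSup (V b) l)
    simp only [V]
    rw [if_neg hl0, if_pos (Or.inl hl)]

lemma exists_decomp (x : L) : ∃ (S : Finset (ι → ℤ)) (y : (ι → ℤ) → L), (∀ l, y l ∈ V b l) ∧
    x = ∑ l ∈ S, y l := by
  have hx : x ∈ ⨆ l, V b l := by rw [iSup_V]; trivial
  obtain ⟨f, hf, rfl⟩ := (Submodule.mem_iSup_iff_exists_finsupp _ _).1 hx
  exact ⟨f.support, f, hf, rfl⟩

lemma W_le_V (l : ι → ℤ) : W b l ≤ V b l := by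
  intro x hx
  obtain ⟨S, y, hy, hxy⟩ := exists_decomp b x
  classical
  -- use extraction in the zero ideal
  let z : (ι → ℤ) → L := fun m => (if m ∈ S then y m else 0) - if m = l then x else 0
  have hz : ∀ m ∈ insert l S, z m ∈ (⊥ : LieIdeal ℂ L) := by
    apply extract b ⊥ (insert l S) z
    · intro m _
      refine sub_mem ?_ ?_
      · split_ifs
        · exact V_le_W b m (hy m)
        · exact zero_mem _
      · split_ifs with h
        · subst h; exact hx
        · exact zero_mem _
    · have h1 : ∑ m ∈ insert l S, z m = 0 := by
        simp only [z, Finset.sum_sub_distrib]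
        rw [Finset.sum_ite_eq' (insert l S) l, if_pos (Finset.mem_insert_self _ _)]
        rw [Finset.sum_ite, Finset.sum_const_zero, add_zero, sub_eq_zero, hxy]
        apply Finset.sum_congr _ (fun _ _ => rfl)
        ext m; simp
      rw [h1]; exact zero_mem _
  have h2 := hz l (Finset.mem_insert_self _ _)
  simp only [LieSubmodule.mem_bot, z, if_true, sub_eq_zero] at h2
  rw [← h2]
  split_ifs
  · exact hy l
  · exact zero_mem _

lemma ideal_pos (hP : PosM b.A) (he : ∀ i, engel ℂ (b.e i) = ⊤)
    (I : LieIdeal ℂ L) (hI : ∀ x ∈ H, x ∈ I → x = 0) (n : ℕ) :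
    ∀ l : ι → ℤ, (∀ i, 0 ≤ l i) → (∑ i, l i = n) → ∀ x ∈ W b l, x ∈ I → x = 0 := by
  induction n with
  | zero =>
    intro l hl hs x hx hxI
    have hl0 : l = 0 := by
      ext i
      exact (Finset.sum_eq_zero_iff_of_nonneg (fun i _ => hl i)).1 (by simpa using hs) i (Finset.mem_univ _)
    subst hl0
    have := W_le_V b _ hx
    simp only [V, if_true] at this
    exact hI x this hxI
  | succ n ih =>
    intro l hl hs x hx hxI
    have hl0 : l ≠ 0 := by
      rintro rfl
      simp at hs
      omega
    have hf : ∀ i, ⁅b.f i, x⁆ = 0 := by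
      intro i
      have h1 : ⁅b.f i, x⁆ ∈ W b (-Pi.single i 1 + l) := lie_mem_W b (f_mem_W b i) hx
      have h2 : ⁅b.f i, x⁆ ∈ I := I.lie_mem hxI
      by_cases hli : 0 < l i
      · refine ih (-Pi.single i 1 + l) (fun j => ?_) ?_ _ h1 h2
        · by_cases hj : j = i
          · subst hj; simp; omega
          · simp [hj, hl j]
        · simp only [Pi.add_apply, Pi.neg_apply, Finset.sum_add_distrib, hs, Finset.sum_neg_distrib,
            Finset.sum_pi_single', Finset.mem_univ, if_true]
          push_cast; ring
      · have h3 := W_le_V b _ h1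
        have hli0 : l i = 0 := le_antisymm (not_lt.1 hli) (hl i)
        have hne : -Pi.single i 1 + l ≠ 0 := by
          intro h
          have := congrFun h i
          simp [hli0] at this
        obtain ⟨j, hj⟩ : ∃ j, l j ≠ 0 := by
          by_contra hcon
          push Not at hcon
          exact hl0 (funext hcon)
        have hji : j ≠ i := by rintro rfl; exact hj hli0
        have hlj := hl j
        rw [V, if_neg hne, if_neg] at h3
        · simpa using h3
        · rintro (h | h)
          · have := h i; simp [hli0] at this
          · have := h j; simp [hji] at this; omega
    obtain ⟨j, _, hj⟩ := hP l hl hl0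
    by_contra hx0
    have P : IsSl2Triple.HasPrimitiveVectorWith (b.sl2 j).symm x (-((∑ i, l i * b.A i j : ℤ) : ℂ)) :=
      { ne_zero := hx0
        lie_h := by rw [neg_lie, hx j, neg_smul]
        lie_e := hf j }
    have hmem : x ∈ engel ℂ (b.e j) := by rw [he j]; trivial
    obtain ⟨k, hk⟩ := (mem_engel_iff ℂ _ _).1 hmem
    have hne : ∀ k : ℕ, (ad ℂ L (b.e j) ^ k) x ≠ 0 := by
      intro k
      induction k with
      | zero => simpa using hx0
      | succ k ihk =>
        intro h0
        have := P.lie_e_pow_succ_toEnd_f k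
        have h0' : ((LieModule.toEnd ℂ L L (b.e j)) ^ (k + 1)) x = 0 := h0
        rw [h0', lie_zero, eq_comm, smul_eq_zero] at this
        rcases this with h | h
        · rw [mul_eq_zero] at h
          rcases h with h | h
          · exact (Nat.cast_add_one_ne_zero k) h
          · have h4 : (-((∑ i, l i * b.A i j : ℤ)) - (k : ℤ) : ℤ) = 0 := by
              exact_mod_cast h
            omega
        · exact ihk h
    exact hne k hk

lemma ideal_eq_bot (hP : PosM b.A) (he : ∀ i, engel ℂ (b.e i) = ⊤) (hf : ∀ i, engel ℂ (b.f i) = ⊤)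
    (I : LieIdeal ℂ L) (hI : ∀ x ∈ H, x ∈ I → x = 0) : I = ⊥ := by
  rw [_root_.eq_bot_iff]
  intro x hx
  obtain ⟨S, y, hy, hxy⟩ := exists_decomp b x
  have h1 := extract b I S y (fun l _ => V_le_W b l (hy l)) (hxy ▸ hx)
  have h2 : ∀ l ∈ S, y l = 0 := by
    intro l hl
    have hyI := h1 l hl
    have hyV := hy l
    by_cases hl0 : l = 0
    · subst hl0
      simp only [V, if_true] at hyV
      exact hI _ hyV hyI
    · rw [V, if_neg hl0] at hyV
      split_ifs at hyV with h
      · rcases h with h | h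
        · obtain ⟨n, hn⟩ := Int.eq_ofNat_of_zero_le (Finset.sum_nonneg fun i (_ : i ∈ Finset.univ) => h i)
          exact ideal_pos b hP he I hI n l h hn _ hyV hyI
        · have h' : ∀ i, 0 ≤ (-l) i := fun i => by simpa using h i
          obtain ⟨n, hn⟩ := Int.eq_ofNat_of_zero_le (Finset.sum_nonneg fun i (_ : i ∈ Finset.univ) => h' i)
          refine ideal_pos b.symm hP hf I hI n (-l) h' hn _ ?_ hyI
          rw [W_symm, neg_neg]
          exact hyV
      · simpa using hyV
  rw [hxy, Finset.sum_eq_zero h2]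
  simp

end Inj
end S5

namespace S5

section BasisTools
open LieAlgebra LieSubalgebra

variable {ι : Type} [Fintype ι] [DecidableEq ι]
variable {L : Type*} [LieRing L] [LieAlgebra ℂ L] {H : LieSubalgebra ℂ L} (b : LieAlgebra.Basis ι H)

lemma basis_sl2_nonpos [FiniteDimensional ℂ L] (i j : ι) (hij : i ≠ j) :
    ∃ n : ℕ, b.A j i = -n ∧ (ad ℂ L (b.e i) ^ (n + 1)) (b.e j) = 0 := by
  have P : IsSl2Triple.HasPrimitiveVectorWith (b.sl2 i).symm (b.e j) (-(b.A j i : ℂ)) :=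
    { ne_zero := (b.sl2 j).e_ne_zero
      lie_h := by rw [neg_lie, b.lie_h_e, neg_smul, Int.cast_smul_eq_zsmul]
      lie_e := by rw [← lie_skew, b.lie_e_f_ne j i hij.symm, neg_zero] }
  obtain ⟨n, hn⟩ := P.exists_nat
  refine ⟨n, ?_, P.pow_toEnd_f_eq_zero_of_eq_nat hn⟩
  have : -(b.A j i) = n := by exact_mod_cast hn
  omega

lemma basis_ad_pow [FiniteDimensional ℂ L] (i j : ι) :
    (ad ℂ L (b.e i) ^ (-b.A j i).toNat) ⁅b.e i, b.e j⁆ = 0 := by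
  by_cases hij : i = j
  · subst hij; simp
  · obtain ⟨n, h1, h2⟩ := basis_sl2_nonpos b i j hij
    rw [h1]
    rw [pow_succ] at h2
    simpa using h2

lemma basis_srel [FiniteDimensional ℂ L] : SRel b.A.transpose b.h b.e b.f where
  hh := b.lie_h_h
  ef i := (b.sl2 i).lie_e_f
  ef_ne := b.lie_e_f_ne
  he i j := b.lie_h_e j i
  hf i j := by rw [b.lie_h_f j i, neg_smul]; rfl
  ade i j := basis_ad_pow b i j
  adf i j := basis_ad_pow b.symm i j

/-- Build a basis from Serre relations. -/
def basisOf {CM : Matrix ι ι ℤ} {h e f : ι → L} (hr : SRel CM h e f) (h2 : ∀ i, CM i i = 2)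
    (hspan : lieSpan ℂ L (Set.range e ∪ Set.range f) = ⊤) (hlin : LinearIndependent ℂ h)
    (hdet : CM.det ≠ 0) : LieAlgebra.Basis ι (lieSpan ℂ L (Set.range h)) where
  A := CM.transpose
  h := h
  e := e
  f := f
  cartan_eq_lieSpan := rfl
  span_ef := hspan
  linInd := hlin
  nondegen := Matrix.nondegenerate_of_det_ne_zero (by rwa [Matrix.det_transpose])
  sl2 i := ⟨hlin.ne_zero i, hr.ef i, by rw [hr.he, h2]; simp [two_smul],
    by rw [hr.hf, h2]; simp [two_smul]⟩
  lie_h_h := hr.hh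
  lie_h_e i j := hr.he j i
  lie_h_f i j := by rw [hr.hf j i, neg_smul]; rfl
  lie_e_f_ne := hr.ef_ne

lemma engel_eq_top_of {CM : Matrix ι ι ℤ} {h e f : ι → L} (hr : SRel CM h e f)
    (h2 : ∀ i, CM i i = 2)
    (hspan : lieSpan ℂ L (Set.range e ∪ Set.range f) = ⊤) (i : ι) : engel ℂ (e i) = ⊤ := by
  rw [_root_.eq_top_iff, ← hspan, lieSpan_le]
  rintro _ (⟨j, rfl⟩ | ⟨j, rfl⟩)
  · exact (mem_engel_iff ℂ _ _).2 ⟨(-CM i j).toNat + 1, by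
      rw [pow_succ, Module.End.mul_apply]; exact hr.ade i j⟩
  · by_cases hij : i = j
    · subst hij
      refine (mem_engel_iff ℂ _ _).2 ⟨3, ?_⟩
      have h3 : ⁅e i, h i⁆ = -((2 : ℤ) • e i) := by rw [← lie_skew, hr.he, h2]
      simp [pow_succ, hr.ef, h3]
    · exact (mem_engel_iff ℂ _ _).2 ⟨1, by simpa using hr.ef_ne i j hij⟩

lemma SRel.symm {CM : Matrix ι ι ℤ} {h e f : ι → L} (hr : SRel CM h e f) : SRel CM (-h) f e where
  hh i j := by simp [hr.hh]
  ef i := by rw [← lie_skew, hr.ef]; rfl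
  ef_ne i j hij := by rw [← lie_skew, hr.ef_ne j i hij.symm, neg_zero]
  he i j := by simp [hr.hf]
  hf i j := by simp [hr.he]
  ade := hr.adf
  adf := hr.ade

/-- Uniqueness: a finite-dimensional Lie algebra with a basis is the Serre algebra. -/
theorem serre_equiv [FiniteDimensional ℂ L] (hP : PosM b.A) :
    ∃ φ : Matrix.ToLieAlgebra ℂ b.A.transpose ≃ₗ⁅ℂ⁆ L, (∀ i, φ (sH _ i) = b.h i) ∧
      (∀ i, φ (sE _ i) = b.e i) ∧ (∀ i, φ (sF _ i) = b.f i) := by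
  set CM := b.A.transpose with hCM
  obtain ⟨φ, hH, hE, hF⟩ := exists_sLift (basis_srel b)
  have hdet : CM.det ≠ 0 := by rw [hCM, Matrix.det_transpose]; exact b.nondegen.det_ne_zero
  have h2 : ∀ i, CM i i = 2 := fun i => by
    have : IsAddTorsionFree L := IsAddTorsionFree.of_isTorsionFree ℂ L
    exact b.A_diag_eq_two i
  have hlin' : LinearIndependent ℂ (φ.toLinearMap ∘ sH CM) := by
    have : (φ.toLinearMap ∘ sH CM) = b.h := funext hH
    rw [this]; exact b.linInd
  have hlin : LinearIndependent ℂ (sH CM) := hlin'.of_comp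
  let bS := basisOf (sRel CM) h2 s_span hlin hdet
  have hker : φ.ker = ⊥ := by
    refine ideal_eq_bot bS ?_ ?_ ?_ φ.ker ?_
    · exact hP
    · exact fun i => engel_eq_top_of (sRel CM) h2 s_span i
    · exact fun i => engel_eq_top_of (sRel CM).symm h2 (by rw [Set.union_comm]; exact s_span) i
    · intro x hx hx0
      have hx' : x ∈ (lieSpan ℂ (Matrix.ToLieAlgebra ℂ CM) (Set.range (sH CM))).toSubmodule := hx
      rw [bS.coe_cartan_eq_span] at hx'
      obtain ⟨c, rfl⟩ := (Submodule.mem_span_range_iff_exists_fun ℂ).1 hx'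
      have hx1 : φ (∑ i, c i • sH CM i) = 0 := by simpa using! hx0
      have h3 : ∑ i, c i • (φ.toLinearMap ∘ sH CM) i = 0 := by
        rw [← hx1]; exact (map_sum φ.toLinearMap _ _).symm ▸ by simp
      have := Fintype.linearIndependent_iff.1 hlin' c h3
      simp [this]
  have hinj : Function.Injective φ := (LieHom.ker_eq_bot φ).1 hker
  have hsurj : Function.Surjective φ := by
    rw [← LieHom.range_eq_top, _root_.eq_top_iff, ← b.span_ef, lieSpan_le]
    rintro _ (⟨i, rfl⟩ | ⟨i, rfl⟩)
    · exact ⟨_, hE i⟩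
    · exact ⟨_, hF i⟩
  exact ⟨LieEquiv.ofBijective φ ⟨hinj, hsurj⟩, hH, hE, hF⟩

/-- Reindexing. -/
def bReindex {κ : Type} [Fintype κ] [DecidableEq κ] (e : ι ≃ κ) : LieAlgebra.Basis κ H where
  A := b.A.reindex e e
  h := b.h ∘ e.symm
  e := b.e ∘ e.symm
  f := b.f ∘ e.symm
  cartan_eq_lieSpan := by
    rw [e.symm.surjective.range_comp]; exact b.cartan_eq_lieSpan
  span_ef := by
    rw [e.symm.surjective.range_comp, e.symm.surjective.range_comp]; exact b.span_ef
  linInd := b.linInd.comp _ e.symm.injective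
  nondegen := Matrix.nondegenerate_of_det_ne_zero (by
    rw [Matrix.det_reindex_self]; exact b.nondegen.det_ne_zero)
  sl2 i := b.sl2 _
  lie_h_h i j := b.lie_h_h _ _
  lie_h_e i j := b.lie_h_e _ _
  lie_h_f i j := b.lie_h_f _ _
  lie_e_f_ne i j hij := b.lie_e_f_ne _ _ (by simpa using hij)

lemma map_lieSpan {L' : Type*} [LieRing L'] [LieAlgebra ℂ L'] (φ : L →ₗ⁅ℂ⁆ L') (s : Set L) :
    (lieSpan ℂ L s).map φ = lieSpan ℂ L' (φ '' s) := by
  apply le_antisymm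
  · rw [LieSubalgebra.map_le_iff_le_comap, lieSpan_le]
    intro x hx
    exact subset_lieSpan ⟨x, hx, rfl⟩
  · rw [lieSpan_le]
    rintro _ ⟨x, hx, rfl⟩
    exact ⟨x, subset_lieSpan hx, rfl⟩

/-- Transport along an isomorphism. -/
def bMap {L' : Type*} [LieRing L'] [LieAlgebra ℂ L'] (φ : L ≃ₗ⁅ℂ⁆ L') :
    LieAlgebra.Basis ι (H.map φ.toLieHom) where
  A := b.A
  h := φ ∘ b.h
  e := φ ∘ b.e
  f := φ ∘ b.f
  cartan_eq_lieSpan := by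
    conv_lhs => rw [b.cartan_eq_lieSpan]
    rw [map_lieSpan, Set.range_comp]; rfl
  span_ef := by
    rw [Set.range_comp, Set.range_comp, ← Set.image_union]
    have := map_lieSpan φ.toLieHom (Set.range b.e ∪ Set.range b.f)
    rw [b.span_ef] at this
    refine Eq.trans this.symm ?_
    rw [_root_.eq_top_iff]
    rintro x -
    exact ⟨φ.symm x, trivial, by simp⟩
  linInd := b.linInd.map' φ.toLinearEquiv.toLinearMap (LinearEquiv.ker _)
  nondegen := b.nondegen
  sl2 i := ⟨by simpa using (b.sl2 i).h_ne_zero,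
    by simp [← LieEquiv.map_lie, (b.sl2 i).lie_e_f],
    by simp [← LieEquiv.map_lie, (b.sl2 i).lie_h_e_nsmul],
    by simp [← LieEquiv.map_lie, (b.sl2 i).lie_h_f_nsmul]⟩
  lie_h_h i j := by simp [← LieEquiv.map_lie, b.lie_h_h]
  lie_h_e i j := by simp [← LieEquiv.map_lie, b.lie_h_e]
  lie_h_f i j := by simp [← LieEquiv.map_lie, b.lie_h_f]
  lie_e_f_ne i j hij := by simp [← LieEquiv.map_lie, b.lie_e_f_ne i j hij]

/-- Two algebras with bases with the same matrix are isomorphic, compatibly. -/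
theorem basis_equiv [FiniteDimensional ℂ L] (hP : PosM b.A) {L' : Type*} [LieRing L']
    [LieAlgebra ℂ L'] [FiniteDimensional ℂ L'] {H' : LieSubalgebra ℂ L'}
    (b' : LieAlgebra.Basis ι H') (hA : b'.A = b.A) : Nonempty (L ≃ₗ⁅ℂ⁆ L') := by
  obtain ⟨φ, -⟩ := serre_equiv b hP
  obtain ⟨φ', -⟩ := serre_equiv b' (hA ▸ hP)
  rw [hA] at φ'
  exact ⟨φ.symm.trans φ'⟩

lemma posM_reindex {κ : Type} [Fintype κ] [DecidableEq κ] (e : ι ≃ κ) {A : Matrix ι ι ℤ} (hP : PosM A) :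
    PosM (A.reindex e e) := by
  intro x hx hx0
  obtain ⟨j, hj, hj2⟩ := hP (x ∘ e) (fun i => hx _) (by
    intro h; apply hx0; ext i; have := congrFun h (e.symm i); simpa using this)
  refine ⟨e j, hj, ?_⟩
  rw [← e.sum_comp]
  simpa using hj2

/-- A simple (nontrivial) algebra with Serre generators for a connected nondegenerate
matrix has a basis. -/
theorem basis_of_serre (CM : Matrix ι ι ℤ) (h2 : ∀ i, CM i i = 2) (hdet : CM.det ≠ 0)
    (hconn : ∀ S : Set ι, S.Nonempty → (∀ i ∈ S, ∀ j, CM i j ≠ 0 → j ∈ S) → S = Set.univ)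
    [Nontrivial L] (φ : Matrix.ToLieAlgebra ℂ CM ≃ₗ⁅ℂ⁆ L) :
    ∃ (H : LieSubalgebra ℂ L) (b : LieAlgebra.Basis ι H), b.A = CM.transpose := by
  have hr := (sRel CM).map φ.toLieHom
  set h : ι → L := φ.toLieHom ∘ sH CM
  set e : ι → L := φ.toLieHom ∘ sE CM
  set f : ι → L := φ.toLieHom ∘ sF CM
  have hspan : lieSpan ℂ L (Set.range e ∪ Set.range f) = ⊤ := by
    have := map_lieSpan φ.toLieHom (Set.range (sE CM) ∪ Set.range (sF CM))
    rw [s_span, Set.image_union, ← Set.range_comp, ← Set.range_comp] at this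
    refine Eq.trans this.symm ?_
    rw [_root_.eq_top_iff]
    rintro x -
    exact ⟨φ.symm x, trivial, by simp⟩
  have htf : IsAddTorsionFree L := IsAddTorsionFree.of_isTorsionFree ℂ L
  have he0 : ∀ i, h i = 0 → e i = 0 ∧ f i = 0 := by
    intro i hi
    have h1 := hr.he i i
    have h3 := hr.hf i i
    rw [hi, zero_lie, h2, eq_comm] at h1
    rw [hi, zero_lie, h2, eq_comm, neg_eq_zero] at h3
    exact ⟨by simpa using h1, by simpa using h3⟩
  have hh : ∀ i, h i ≠ 0 := by
    intro i hi
    have huniv := hconn {i | h i = 0} ⟨i, hi⟩ (by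
      intro i hi j hij
      have h1 := hr.he i j
      rw [show h i = 0 from hi, zero_lie, eq_comm, smul_eq_zero] at h1
      have hej : e j = 0 := by tauto
      have := hr.ef j
      rw [hej, zero_lie] at this
      exact this.symm)
    have hall : ∀ i, h i = 0 := fun i => by
      have : i ∈ {i | h i = 0} := by rw [huniv]; trivial
      exact this
    have hE : e = 0 := funext fun i => (he0 i (hall i)).1
    have hF : f = 0 := funext fun i => (he0 i (hall i)).2
    have hle : lieSpan ℂ L (Set.range e ∪ Set.range f) ≤ ⊥ := by
      rw [lieSpan_le]
      rintro _ (⟨j, rfl⟩ | ⟨j, rfl⟩)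
      · simp [hE]
      · simp [hF]
    rw [hspan] at hle
    obtain ⟨x, hx⟩ := exists_ne (0 : L)
    exact hx (by simpa using hle (trivial : x ∈ (⊤ : LieSubalgebra ℂ L)))
  have he : ∀ i, e i ≠ 0 := by
    intro i hi
    have := hr.ef i
    rw [hi, zero_lie] at this
    exact hh i this.symm
  have hlin : LinearIndependent ℂ h := by
    rw [Fintype.linearIndependent_iff]
    intro c hc
    have h1 : Matrix.vecMul c (CM.map (Int.cast : ℤ → ℂ)) = 0 := by
      ext j
      have h3 : ⁅∑ i, c i • h i, e j⁆ = 0 := by rw [hc, zero_lie]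
      rw [sum_lie] at h3
      have h4 : ∀ i, ⁅c i • h i, e j⁆ = (c i * (CM i j : ℂ)) • e j := by
        intro i
        rw [smul_lie, hr.he, ← Int.cast_smul_eq_zsmul ℂ, smul_smul]
      simp only [h4, ← Finset.sum_smul] at h3
      have := (smul_eq_zero.1 h3).resolve_right (he j)
      simpa [Matrix.vecMul, dotProduct] using this
    have hd : (CM.map (Int.cast : ℤ → ℂ)).det ≠ 0 := by
      have : (CM.map (Int.cast : ℤ → ℂ)).det = ((CM.det : ℤ) : ℂ) := by
        exact ((Int.castRingHom ℂ).map_det CM).symm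
      rw [this]; exact_mod_cast hdet
    exact congrFun (Matrix.eq_zero_of_vecMul_eq_zero hd h1)
  exact ⟨_, basisOf hr h2 hspan hlin hdet, rfl⟩

end BasisTools
end S5

namespace S5

section Gen
open LieAlgebra LieAlgebra.IsKilling LieModule Module

variable {g : Type} [LieRing g] [LieAlgebra ℂ g] [FiniteDimensional ℂ g] [IsKilling ℂ g]
  {t : LieSubalgebra ℂ g} [t.IsCartanSubalgebra]

lemma rootSpace_eq_smul (α : Weight ℂ t g) (hα : α.IsNonZero) {x y : g}
    (hx : x ∈ rootSpace t α) (hx0 : x ≠ 0) (hy : y ∈ rootSpace t α) : ∃ c : ℂ, c • x = y := by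
  simpa using (finrank_eq_one_iff_of_nonzero' ⟨x, hx⟩ (by simpa using hx0)).mp
      (finrank_rootSpace_eq_one α hα) ⟨_, hy⟩

lemma lie_ne_zero_of_add (α β : Weight ℂ t g) (hα : α.IsNonZero) (hβ : β.IsNonZero)
    (hs : rootSpace t (α + β : t → ℂ) ≠ ⊥)
    {h e f : g} (isSl2 : IsSl2Triple h e f) (he : e ∈ rootSpace t α) (hf : f ∈ rootSpace t (-α : t → ℂ))
    {x : g} (hx : x ∈ rootSpace t β) (hx0 : x ≠ 0) : ⁅e, x⁆ ≠ 0 := by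
  obtain rfl := isSl2.h_eq_coroot hα he hf
  have h1 := (rootSpace_zsmul_add_ne_bot_iff α β hα 1).1 (by simpa using hs)
  obtain ⟨v, hv, v_ne0⟩ := (chainTop α β).exists_ne_zero
  have prim : isSl2.HasPrimitiveVectorWith v (chainLength α β : ℂ) :=
    have := lie_mem_genWeightSpace_of_mem_genWeightSpace he hv
    ⟨v_ne0, (chainLength_smul _ _ hv).symm, by rwa [genWeightSpace_add_chainTop _ _ hα] at this⟩
  have hle := chainTopCoeff_le_chainLength α β
  obtain ⟨p, hp⟩ : ∃ p : ℕ, chainTopCoeff α β = p + 1 := by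
    obtain ⟨h1, -⟩ := h1
    exact ⟨chainTopCoeff α β - 1, by omega⟩
  have hm := toEnd_pow_apply_mem hf hv (p + 1)
  have hw : ((p + 1) • (-α : t → ℂ) + chainTop α β : t → ℂ) = β := by
    rw [coe_chainTop', hp]; module
  rw [hw] at hm
  obtain ⟨c, hc⟩ := rootSpace_eq_smul β hβ hm
    (prim.pow_toEnd_f_ne_zero_of_eq_nat rfl (by omega)) hx
  have hc0 : c ≠ 0 := by rintro rfl; simp at hc; exact hx0 hc.symm
  rw [← hc, lie_smul, prim.lie_e_pow_succ_toEnd_f]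
  refine smul_ne_zero hc0 (smul_ne_zero (mul_ne_zero (by exact_mod_cast p.succ_ne_zero) ?_) ?_)
  · rw [sub_ne_zero]
    have : chainLength α β ≠ p := by omega
    exact_mod_cast this
  · exact prim.pow_toEnd_f_ne_zero_of_eq_nat rfl (by omega)

lemma exists_raw_basis [IsSimple ℂ g] :
    ∃ (b0 : (rootSystem t).Base) (_ : Fintype b0.support) (_ : DecidableEq b0.support)
      (b : LieAlgebra.Basis b0.support t), b.A = b0.cartanMatrix := by
  classical
  obtain ⟨b0⟩ := RootPairing.nonempty_base (rootSystem t)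
  have hnz : ∀ γ : t.root, γ.1.IsNonZero := fun γ => (Finset.mem_filter.1 γ.2).2
  choose h e f hsl he hf using fun γ : t.root => exists_isSl2Triple_of_weight_isNonZero (hnz γ)
  have hh : ∀ γ, h γ = (coroot γ.1 : g) := fun γ => (hsl γ).h_eq_coroot (hnz γ) (he γ) (hf γ)
  let S : LieSubalgebra ℂ g := LieSubalgebra.lieSpan ℂ g
    (Set.range (fun i : b0.support => e i) ∪ Set.range (fun i : b0.support => f i))
  have heS : ∀ i ∈ b0.support, e i ∈ S := fun i hi =>
    LieSubalgebra.subset_lieSpan (Or.inl ⟨⟨i, hi⟩, rfl⟩)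
  have hfS : ∀ i ∈ b0.support, f i ∈ S := fun i hi =>
    LieSubalgebra.subset_lieSpan (Or.inr ⟨⟨i, hi⟩, rfl⟩)
  have one : ∀ (γ : Weight ℂ t g), γ.IsNonZero → ∀ x ∈ rootSpace t γ, x ≠ 0 → x ∈ S →
      ∀ y ∈ rootSpace t γ, y ∈ S := by
    intro γ hγ x hx hx0 hxS y hy
    obtain ⟨c, rfl⟩ := rootSpace_eq_smul γ hγ hx hx0 hy
    exact S.smul_mem c hxS
  have key : ∀ γ : t.root, (∀ x ∈ rootSpace t γ.1, x ∈ S) ∧ (∀ x ∈ rootSpace t (-γ.1), x ∈ S) := by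
    intro γ
    induction γ using b0.induction_add with
    | h₀ i hi =>
      have : ((rootSystem t).reflectionPerm i i).1 = -i.1 := by
        have := (rootSystem t).root_reflectionPerm i i
        rw [RootPairing.reflection_apply_self, rootSystem_root_apply, rootSystem_root_apply] at this
        ext x
        have := congrArg (fun u => u x) this
        simpa only [Weight.coe_neg, Pi.neg_apply] using! this
      rw [this, Weight.coe_neg, neg_neg]; exact ⟨hi.2, hi.1⟩
    | h₁ i hi =>
      exact ⟨one i.1 (hnz i) _ (he i) (hsl i).e_ne_zero (heS i hi),
        one (-i.1) (hnz i).neg _ (by simpa using hf i) (hsl i).f_ne_zero (hfS i hi)⟩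
    | h₂ i j k hk hi hj =>
      have hk' : (k.1 : t → ℂ) = j.1 + i.1 := by
        ext x
        have := congrArg (fun u => u x) hk
        simpa [add_comm] using this
      constructor
      · obtain ⟨x, hx, hx0⟩ := i.1.exists_ne_zero
        have hs : rootSpace t (j.1 + i.1 : t → ℂ) ≠ ⊥ := by rw [← hk']; exact k.1.2
        have := lie_ne_zero_of_add j.1 i.1 (hnz j) (hnz i) hs (hsl j) (he j) (hf j) hx hx0
        refine one k.1 (hnz k) _ ?_ this (S.lie_mem (heS j hj) (hi.1 x hx))
        rw [hk']
        exact lie_mem_genWeightSpace_of_mem_genWeightSpace (he j) hx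
      · obtain ⟨x, hx, hx0⟩ := (-i.1).exists_ne_zero
        have hk'' : ((-k.1 : Weight ℂ t g) : t → ℂ) = (-j.1 : Weight ℂ t g) + (-i.1 : Weight ℂ t g) := by
          rw [Weight.coe_neg, Weight.coe_neg, Weight.coe_neg, hk']; abel
        have hs : rootSpace t ((-j.1 : Weight ℂ t g) + (-i.1 : Weight ℂ t g) : t → ℂ) ≠ ⊥ := by
          rw [← hk'']; exact (-k.1).2
        have hf' : f j ∈ rootSpace t (-j.1 : Weight ℂ t g) := by simpa using hf j
        have := lie_ne_zero_of_add (-j.1) (-i.1) (hnz j).neg (hnz i).neg hs (hsl j).symm hf'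
          (by simpa using he j) hx hx0
        refine one (-k.1) (hnz k).neg _ ?_ this (S.lie_mem (hfS j hj) (hi.2 x hx))
        rw [hk'']
        exact lie_mem_genWeightSpace_of_mem_genWeightSpace hf' hx
  have hcs : ∀ γ : t.root, (coroot γ.1 : g) ∈ S := by
    intro γ
    rw [← hh, ← (hsl γ).lie_e_f]
    exact S.lie_mem ((key γ).1 _ (he γ)) ((key γ).2 _ (by simpa using hf γ))
  have htspan : Submodule.span ℂ (Set.range (fun i : b0.support => (coroot i.1.1 : t))) = ⊤ := by
    have := b0.span_coroot_support
    have h2 : (rootSystem t).corootSpan ℂ = ⊤ := RootPairing.IsRootSystem.span_coroot_eq_top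
    rw [h2] at this
    rw [← this]; congr 1
    ext x; simp [Set.mem_image]
  have htS : ∀ x ∈ t, x ∈ S := by
    intro x hx
    have h1 : (⟨x, hx⟩ : t) ∈ Submodule.span ℂ (Set.range (fun i : b0.support => (coroot i.1.1 : t))) := by
      rw [htspan]; trivial
    have h2 : Submodule.span ℂ (Set.range (fun i : b0.support => (coroot i.1.1 : t))) ≤
        S.toSubmodule.comap t.toSubmodule.subtype := by
      rw [Submodule.span_le]; rintro _ ⟨i, rfl⟩; exact hcs i.1
    exact h2 h1
  have hS : S = ⊤ := by
    have h1 := iSup_genWeightSpace_eq_top' ℂ t g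
    rw [_root_.eq_top_iff]
    intro x _
    have h2 : x ∈ (⨆ χ : Weight ℂ t g, genWeightSpace g χ : LieSubmodule ℂ t g).toSubmodule := by
      rw [h1]; trivial
    rw [LieSubmodule.iSup_toSubmodule] at h2
    have h3 : (⨆ χ : Weight ℂ t g, (genWeightSpace g χ).toSubmodule) ≤ S.toSubmodule := by
      refine iSup_le fun χ => ?_
      intro y hy
      by_cases hχ : χ.IsZero
      · have : y ∈ rootSpace t (0 : t → ℂ) := by rw [← hχ.eq]; exact hy
        refine htS y ?_
        have : y ∈ zeroRootSubalgebra ℂ g t := this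
        rwa [zeroRootSubalgebra_eq_of_is_cartan] at this
      · exact (key ⟨χ, by simpa using hχ⟩).1 y hy
    exact h3 h2
  have hAe : ∀ i j : t.root, ((rootSystem t).pairingIn ℤ i j : ℂ) = i.1 (coroot j.1) := by
    intro i j
    have := (rootSystem t).algebraMap_pairingIn ℤ i j
    simpa using this
  refine ⟨b0, inferInstance, inferInstance, ⟨b0.cartanMatrix, fun i => h i, fun i => e i, fun i => f i, ?_, hS, ?_,
    b0.cartanMatrix_nondegenerate, fun i => hsl i, ?_, ?_, ?_, ?_⟩, rfl⟩
  · apply le_antisymm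
    · intro x hx
      have h1 : (⟨x, hx⟩ : t) ∈ Submodule.span ℂ (Set.range (fun i : b0.support => (coroot i.1.1 : t))) := by
        rw [htspan]; trivial
      have h2 : Submodule.span ℂ (Set.range (fun i : b0.support => (coroot i.1.1 : t))) ≤
          (LieSubalgebra.lieSpan ℂ g (Set.range (fun i : b0.support => h i))).toSubmodule.comap t.toSubmodule.subtype := by
        rw [Submodule.span_le]; rintro _ ⟨i, rfl⟩
        refine LieSubalgebra.subset_lieSpan ⟨i, hh i⟩
      exact h2 h1
    · rw [LieSubalgebra.lieSpan_le]; rintro _ ⟨i, rfl⟩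
      simp only [hh]; exact (coroot i.1.1).2
  · have := b0.linearIndepOn_coroot.linearIndependent
    have h2 := this.map' t.toSubmodule.subtype (Submodule.ker_subtype _)
    have h3 : (fun i : b0.support => h i) = t.toSubmodule.subtype ∘ fun i : b0.support => (rootSystem t).coroot i := by
      funext i; exact hh i
    rw [h3]; exact h2
  · intro i j
    rw [hh, hh]
    have := trivial_lie_zero t t (coroot i.1.1) (coroot j.1.1)
    exact congrArg Subtype.val this
  · intro i j
    rw [← Int.cast_smul_eq_zsmul ℂ]
    show _ = ((rootSystem t).pairingIn ℤ i j : ℂ) • _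
    rw [hAe, hh]
    exact lie_eq_smul_of_mem_rootSpace (he i) _
  · intro i j
    rw [← Int.cast_smul_eq_zsmul ℂ, Int.cast_neg]
    show _ = (-((rootSystem t).pairingIn ℤ i j : ℂ)) • _
    rw [hAe, hh]
    exact lie_eq_smul_of_mem_rootSpace (hf i) _
  · intro i j hij
    have h1 := lie_mem_genWeightSpace_of_mem_genWeightSpace (he i) (hf j)
    by_contra hne
    have h2 : rootSpace t ((i.1.1 : t → ℂ) + -(j.1.1 : t → ℂ)) ≠ ⊥ := by
      intro hb; have h1' : _ ∈ rootSpace t ((i.1.1 : t → ℂ) + -(j.1.1 : t → ℂ)) := h1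
      rw [hb] at h1'; exact hne h1'
    let W : Weight ℂ t g := ⟨_, h2⟩
    have hlin := b0.linearIndepOn_root
    by_cases hW : W.IsZero
    · have : (i.1.1 : t → ℂ) + -(j.1.1 : t → ℂ) = 0 := hW
      have : i.1.1 = j.1.1 := by
        ext x
        have := congrFun this x
        simp at this
        linear_combination this
      exact hij (Subtype.ext (Subtype.ext this))
    · apply b0.sub_notMem_range_root i.2 j.2
      refine ⟨⟨W, by simpa using hW⟩, ?_⟩
      ext x
      show W x = _
      simp [W, sub_eq_add_neg]

end Gen

/-- The combinatorial properties of a connected Cartan matrix of finite type. -/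
structure GCM {ι : Type} [Fintype ι] (A : Matrix ι ι ℤ) : Prop where
  d2 : ∀ i, A i i = 2
  off : ∀ i j, i ≠ j → A i j ≤ 0
  zs : ∀ i j, A i j = 0 → A j i = 0
  conn : ∀ S : Set ι, S.Nonempty → (∀ i ∈ S, ∀ j, A i j ≠ 0 → j ∈ S) → S = Set.univ
  pos : PosM A
  posT : PosM A.transpose
  ne : Nonempty ι

theorem exists_good_basis {g : Type} [LieRing g] [LieAlgebra ℂ g] [FiniteDimensional ℂ g]
    [LieAlgebra.IsSimple ℂ g] (t : LieSubalgebra ℂ g) [t.IsCartanSubalgebra] :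
    ∃ (ι : Type) (_ : Fintype ι) (_ : DecidableEq ι) (b : LieAlgebra.Basis ι t), GCM b.A := by
  classical
  obtain ⟨b0, _, _, b, hb⟩ := exists_raw_basis (t := t)
  refine ⟨b0.support, inferInstance, inferInstance, b, ?_⟩
  rw [hb]
  have aux : ∀ (d x : b0.support → ℤ) (y : b0.support → ℤ), (∀ i, 0 < d i) → (∀ i, 0 ≤ x i) →
      0 < ∑ j, x j * (d j * y j) → ∃ j, 0 < x j ∧ 0 < y j := by
    intro d x y hd hx hs
    by_contra! hc
    refine absurd hs (not_lt.2 (Finset.sum_nonpos fun j _ => ?_))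
    rcases (hx j).eq_or_lt with h | h
    · simp [← h]
    · have := hc j h
      have h2 : d j * y j ≤ 0 := mul_nonpos_of_nonneg_of_nonpos (hd j).le this
      exact mul_nonpos_of_nonneg_of_nonpos h.le h2
  constructor
  · exact b0.cartanMatrix_apply_same
  · exact b0.cartanMatrix_le_zero_of_ne
  · exact fun i j h => b0.cartanMatrix_apply_eq_zero_iff_symm.1 h
  · rintro S ⟨i, hi⟩ hS
    ext j
    simp only [Set.mem_univ, iff_true]
    refine b0.induction_on_cartanMatrix (fun k => k ∈ S) hi fun k l hk hl => hS k hk l ?_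
    rwa [ne_eq, b0.cartanMatrix_apply_eq_zero_iff_symm]
  · intro x hx hx0
    obtain ⟨d, hd, hp⟩ := b0.exists_cartanMatrix_mul_diagaonal_posDef
    have := hp.dotProduct_mulVec_pos hx0
    apply aux d x _ hd hx
    refine lt_of_lt_of_eq this ?_
    symm
    simp only [dotProduct, Matrix.mulVec, Matrix.mul_diagonal, Finset.mul_sum]
    rw [Finset.sum_comm]
    refine Finset.sum_congr rfl fun i _ => Finset.sum_congr rfl fun j _ => ?_
    simp; ring
  · intro x hx hx0
    obtain ⟨d, hd, hp⟩ := b0.exists_cartanMatrix_diagaonal_mul_posDef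
    have := hp.dotProduct_mulVec_pos hx0
    apply aux d x _ hd hx
    refine lt_of_lt_of_eq this ?_
    symm
    simp only [dotProduct, Matrix.mulVec, Matrix.diagonal_mul, Finset.mul_sum]
    refine Finset.sum_congr rfl fun i _ => Finset.sum_congr rfl fun j _ => ?_
    simp only [Pi.star_apply, star_trivial, Matrix.transpose_apply]; ring
  · by_contra hne
    rw [not_nonempty_iff] at hne
    have h1 := b.span_ef
    rw [Set.range_eq_empty, Set.range_eq_empty] at h1; simp at h1
    have h2 := LieAlgebra.IsSimple.non_abelian (R := ℂ) (L := g)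
    apply h2
    have h3 : ∀ x : g, x = 0 := fun x => by
      have : x ∈ (⊤ : LieSubalgebra ℂ g) := trivial
      rw [← h1] at this; simpa using this
    exact ⟨fun x y => by rw [h3 x]; simp⟩
end S5

namespace S5

section Classify
variable {ι : Type} [Fintype ι] [DecidableEq ι] {A : Matrix ι ι ℤ}

lemma GCM.adj (hA : GCM A) {i j : ι} (hij : i ≠ j) (h : A i j ≠ 0) : A i j ≤ -1 ∧ A j i ≤ -1 := by
  have h1 := hA.off i j hij
  have h2 := hA.off j i hij.symm
  have h3 : A j i ≠ 0 := fun h' => h (hA.zs _ _ h')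
  omega

lemma nosub (hA : GCM A) {κ : Type} [Fintype κ] [Nonempty κ] (s : κ → ι)
    (hs : Function.Injective s) (B : κ → κ → ℤ) (x : κ → ℤ) (hx : ∀ i, 0 < x i)
    (hB : ∀ j, ∑ i, x i * B i j ≤ 0) (hAB : ∀ i j, A (s i) (s j) ≤ B i j) : False := by
  classical
  let X : ι → ℤ := fun v => ∑ i, if s i = v then x i else 0
  have hX0 : ∀ v, 0 ≤ X v := fun v => Finset.sum_nonneg fun i _ => by
    split_ifs
    · exact (hx i).le
    · exact le_rfl
  have hXs : ∀ i, X (s i) = x i := by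
    intro i
    have : ∀ k, (if s k = s i then x k else 0) = if k = i then x k else 0 := fun k => by
      simp [hs.eq_iff]
    simp [X, this]
  obtain ⟨i0⟩ := ‹Nonempty κ›
  obtain ⟨v, hv, hv2⟩ := hA.pos X hX0 (fun h => by
    have := congrFun h (s i0)
    rw [hXs] at this
    exact absurd this (hx i0).ne')
  obtain ⟨j, rfl⟩ : ∃ j, s j = v := by
    by_contra! hc
    simp [X, hc] at hv
  have : ∑ v, X v * A v (s j) = ∑ i, x i * A (s i) (s j) := by
    simp only [X, Finset.sum_mul]
    rw [Finset.sum_comm]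
    refine Finset.sum_congr rfl fun i _ => ?_
    simp
  rw [this] at hv2
  have h3 : ∑ i, x i * A (s i) (s j) ≤ ∑ i, x i * B i j :=
    Finset.sum_le_sum fun i _ => mul_le_mul_of_nonneg_left (hAB i j) (hx i).le
  have := hB j
  omega

/-- An injective path with `m + 1` vertices in the diagram. -/
structure IsPath (A : Matrix ι ι ℤ) (p : ℕ → ι) (m : ℕ) : Prop where
  inj : ∀ i ≤ m, ∀ j ≤ m, p i = p j → i = j
  adj : ∀ i < m, A (p i) (p (i + 1)) ≤ -1
  adj' : ∀ i < m, A (p (i + 1)) (p i) ≤ -1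

lemma IsPath.shift {p : ℕ → ι} {m : ℕ} (h : IsPath A p m) (k m' : ℕ) (hk : k + m' ≤ m) :
    IsPath A (fun i => p (k + i)) m' where
  inj i hi j hj e := by
    have := h.inj _ (by omega) _ (by omega) e
    omega
  adj i hi := h.adj (k + i) (by omega)
  adj' i hi := h.adj' (k + i) (by omega)

lemma IsPath.rev {p : ℕ → ι} {m : ℕ} (h : IsPath A p m) : IsPath A (fun i => p (m - i)) m where
  inj i hi j hj e := by
    have := h.inj _ (by omega) _ (by omega) e
    omega
  adj i hi := by
    have := h.adj' (m - (i + 1)) (by omega)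
    rwa [show m - (i + 1) + 1 = m - i by omega] at this
  adj' i hi := by
    have := h.adj (m - (i + 1)) (by omega)
    rwa [show m - (i + 1) + 1 = m - i by omega] at this

lemma IsPath.cons (hA : GCM A) {p : ℕ → ι} {m : ℕ} (h : IsPath A p m) (q : ι) (hq : ∀ i ≤ m, p i ≠ q)
    (hadj : A q (p 0) ≠ 0) : IsPath A (fun i => Nat.casesOn i q p) (m + 1) where
  inj i hi j hj e := by
    rcases i with _ | i <;> rcases j with _ | j
    · rfl
    · exact absurd e.symm (hq j (by omega))
    · exact absurd e (hq i (by omega))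
    · have := h.inj i (by omega) j (by omega) e
      omega
  adj i hi := by
    rcases i with _ | i
    · exact (hA.adj (hq 0 (by omega)).symm hadj).1
    · exact h.adj i (by omega)
  adj' i hi := by
    rcases i with _ | i
    · exact (hA.adj (hq 0 (by omega)).symm hadj).2
    · exact h.adj' i (by omega)

lemma IsPath.lt_card {p : ℕ → ι} {m : ℕ} (h : IsPath A p m) : m < Fintype.card ι := by
  have : Function.Injective (fun i : Fin (m + 1) => p i) := fun i j e =>
    Fin.ext (h.inj _ (by omega) _ (by omega) e)
  have := Fintype.card_le_of_injective _ this
  simp at this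
  omega

lemma sum_le_subset {κ : Type*} [DecidableEq κ] (S T : Finset κ) (hT : T ⊆ S) (f : κ → ℤ)
    (hf : ∀ i ∈ S, i ∉ T → f i ≤ 0) : ∑ i ∈ S, f i ≤ ∑ i ∈ T, f i := by
  rw [← Finset.sum_sdiff hT]
  have : ∑ i ∈ S \ T, f i ≤ 0 := Finset.sum_nonpos fun i hi => by
    rw [Finset.mem_sdiff] at hi
    exact hf i hi.1 hi.2
  omega

lemma acyclic (hA : GCM A) {p : ℕ → ι} {m : ℕ} (hm : 2 ≤ m) (h : IsPath A p m)
    (hc : A (p 0) (p m) ≠ 0) : False := by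
  have hne : p 0 ≠ p m := fun e => by have := h.inj _ (by omega) _ le_rfl e; omega
  obtain ⟨c1, c2⟩ := hA.adj hne hc
  refine nosub hA (κ := Fin (m + 1)) (fun i => p i) (fun i j e =>
    Fin.ext (h.inj _ (by omega) _ (by omega) e)) (fun i j => A (p i) (p j)) (fun _ => 1)
    (fun _ => one_pos) (fun j => ?_) (fun _ _ => le_rfl)
  simp only [one_mul]
  have key : ∀ i i' : Fin (m + 1), i ≠ i' → i ≠ j → i' ≠ j → A (p i) (p j) ≤ -1 →
      A (p i') (p j) ≤ -1 → ∑ i : Fin (m + 1), A (p i) (p j) ≤ 0 := by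
    intro i i' h1 h2 h3 h4 h5
    refine (sum_le_subset Finset.univ {i, i', j} (Finset.subset_univ _) _ ?_).trans ?_
    · intro a _ ha
      apply hA.off
      intro e
      have := h.inj _ (by omega) _ (by omega) e
      have : a = j := Fin.ext this
      simp [this] at ha
    · rw [Finset.sum_insert (by simp [h1, h2]), Finset.sum_insert (by simp [h3]), Finset.sum_singleton,
        hA.d2]
      omega
  obtain ⟨j, hj⟩ := j
  simp only [ne_eq, Fin.mk.injEq, Fin.ext_iff] at key
  rcases Nat.eq_zero_or_pos j with rfl | hj0
  · exact key ⟨1, by omega⟩ ⟨m, by omega⟩ (by simp; omega) (by simp) (by simp; omega)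
      (h.adj' 0 (by omega)) c2
  · have e1 := h.adj (j - 1) (by omega)
    rw [Nat.sub_add_cancel hj0] at e1
    by_cases hjm : j = m
    · subst hjm
      exact key ⟨j - 1, by omega⟩ ⟨0, by omega⟩ (by simp; omega) (by simp; omega) (by simp; omega)
        e1 c1
    · exact key ⟨j - 1, by omega⟩ ⟨j + 1, by omega⟩ (by dsimp only; omega) (by dsimp only; omega) (by dsimp only; omega)
        e1 (h.adj' j (by omega))

/-- A vector that can terminate a segment of twos. -/
structure Tm (A : Matrix ι ι ℤ) (e : ι) (y : ι → ℤ) : Prop where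
  nn : ∀ u, 0 ≤ y u
  s : ∑ u, y u * A u e ≤ -2
  c : ∀ u, 0 < y u → y u + A e u ≤ 0

lemma Tm_branch (hA : GCM A) {e u v : ι} (hu : u ≠ e) (hv : v ≠ e) (huv : u ≠ v) (h1 : A u e ≠ 0)
    (h2 : A v e ≠ 0) : ∃ y, Tm A e y ∧ ∀ w, w ≠ u → w ≠ v → y w = 0 := by
  obtain ⟨a1, a2⟩ := hA.adj hu h1
  obtain ⟨b1, b2⟩ := hA.adj hv h2
  refine ⟨fun w => (if w = u then 1 else 0) + (if w = v then 1 else 0), ⟨?_, ?_, ?_⟩, ?_⟩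
  · intro w; split_ifs <;> norm_num
  · simp only [add_mul, ite_mul, one_mul, zero_mul, Finset.sum_add_distrib, Finset.sum_ite_eq',
      Finset.mem_univ, if_true]
    omega
  · intro w hw
    by_cases h : w = u
    · subst h; simp [huv]; omega
    · by_cases h' : w = v
      · subst h'; simp [h]; omega
      · simp [h, h'] at hw
  · intro w h h'; simp [h, h']

lemma Tm_multi (hA : GCM A) {e u : ι} (hu : u ≠ e) (h1 : A u e ≠ 0) (h2 : A u e * A e u ≠ 1) :
    ∃ y, Tm A e y ∧ ∀ w, w ≠ u → y w = 0 := by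
  obtain ⟨a1, a2⟩ := hA.adj hu h1
  by_cases hc : A u e ≤ -2
  · refine ⟨fun w => (if w = u then 1 else 0), ⟨?_, ?_, ?_⟩, ?_⟩
    · intro w; split_ifs <;> norm_num
    · simpa using hc
    · intro w hw
      by_cases h : w = u
      · subst h; simp; omega
      · simp [h] at hw
    · intro w h; simp [h]
  · have e1 : A u e = -1 := by omega
    have e2 : A e u ≤ -2 := by
      rw [e1] at h2; omega
    refine ⟨fun w => (if w = u then 2 else 0), ⟨?_, ?_, ?_⟩, ?_⟩
    · intro w; split_ifs <;> norm_num
    · simp [e1]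
    · intro w hw
      by_cases h : w = u
      · subst h; simp; omega
      · simp [h] at hw
    · intro w h; simp [h]

lemma Dtil (hA : GCM A) {p : ℕ → ι} {m : ℕ} (h : IsPath A p m) {k l : ℕ} (hkl : k ≤ l) (hl : l ≤ m)
    {y z : ι → ℤ} (hy : Tm A (p k) y) (hz : Tm A (p l) z) (hyz : ∀ w, y w = 0 ∨ z w = 0)
    (hyp : ∀ i, k ≤ i → i ≤ l → y (p i) = 0) (hzp : ∀ i, k ≤ i → i ≤ l → z (p i) = 0) : False := by
  let S : Finset ι := (Finset.Icc k l).image p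
  have hSm : ∀ i, k ≤ i → i ≤ l → p i ∈ S := fun i h1 h2 =>
    Finset.mem_image_of_mem _ (Finset.mem_Icc.2 ⟨h1, h2⟩)
  have hS : ∀ w ∈ S, ∃ i, k ≤ i ∧ i ≤ l ∧ p i = w := by
    intro w hw
    obtain ⟨i, hi, rfl⟩ := Finset.mem_image.1 hw
    rw [Finset.mem_Icc] at hi
    exact ⟨i, hi.1, hi.2, rfl⟩
  have hyS : ∀ w ∈ S, y w = 0 := fun w hw => by
    obtain ⟨i, h1, h2, rfl⟩ := hS w hw; exact hyp i h1 h2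
  have hzS : ∀ w ∈ S, z w = 0 := fun w hw => by
    obtain ⟨i, h1, h2, rfl⟩ := hS w hw; exact hzp i h1 h2
  let x : ι → ℤ := fun u => (if u ∈ S then 2 else 0) + y u + z u
  have hx : ∀ u, 0 ≤ x u := fun u => by
    have := hy.nn u
    have := hz.nn u
    dsimp only [x]
    split_ifs <;> omega
  have hsplit : ∀ j, ∑ u, x u * A u j = 2 * ∑ u ∈ S, A u j + ∑ u, y u * A u j + ∑ u, z u * A u j := by
    intro j
    simp only [x, add_mul, Finset.sum_add_distrib, ite_mul, zero_mul, Finset.mul_sum]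
    congr 2
    rw [← Finset.sum_filter]
    simp
  -- sums with zero value at j are nonpositive
  have hnp : ∀ (v : ι → ℤ) (j : ι), (∀ u, 0 ≤ v u) → v j = 0 → ∑ u, v u * A u j ≤ 0 := by
    intro v j hv hvj
    refine Finset.sum_nonpos fun u _ => ?_
    by_cases huj : u = j
    · rw [huj, hvj]; simp
    · exact mul_nonpos_of_nonneg_of_nonpos (hv u) (hA.off _ _ huj)
  have hone : ∀ (v : ι → ℤ) (j : ι), (∀ u, 0 ≤ v u) → ∑ u, v u * A u j ≤ 2 * v j := by
    intro v j hv
    refine (sum_le_subset Finset.univ {j} (Finset.subset_univ _) _ ?_).trans ?_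
    · intro a _ ha
      exact mul_nonpos_of_nonneg_of_nonpos (hv a) (hA.off _ _ (by simpa using ha))
    · simp [hA.d2, mul_comm]
  have houter : ∀ (e j : ι), e ∈ S → j ∉ S → ∑ u ∈ S, A u j ≤ A e j := by
    intro e j he hj
    refine (sum_le_subset S {e} (by simpa using he) _ ?_).trans (by simp)
    intro a ha _
    exact hA.off _ _ (fun e => hj (e ▸ ha))
  obtain ⟨j, hj, hj2⟩ := hA.pos x hx (fun h0 => by
    have := congrFun h0 (p k)
    have h3 := hSm k le_rfl hkl
    simp [x, h3, hyS _ h3, hzS _ h3] at this)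
  rw [hsplit] at hj2
  by_cases hjS : j ∈ S
  · obtain ⟨i, hki, hil, rfl⟩ := hS j hjS
    have hY := hnp y (p i) hy.nn (hyS _ hjS)
    have hZ := hnp z (p i) hz.nn (hzS _ hjS)
    have hin : ∀ T : Finset ℕ, T ⊆ Finset.Icc k l → i ∈ T →
        ∑ u ∈ S, A u (p i) ≤ ∑ a ∈ T, A (p a) (p i) := by
      intro T hT hiT
      have : ∑ u ∈ S, A u (p i) = ∑ a ∈ Finset.Icc k l, A (p a) (p i) := by
        refine Finset.sum_image ?_
        intro a ha b hb e
        simp only [Finset.coe_Icc, Set.mem_Icc] at ha hb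
        exact h.inj a (by omega) b (by omega) e
      rw [this]
      refine sum_le_subset _ _ hT _ ?_
      intro a ha haT
      rw [Finset.mem_Icc] at ha
      apply hA.off
      intro e
      have := h.inj a (by omega) i (by omega) e
      exact haT (this ▸ hiT)
    have hA2 := hA.d2 (p i)
    by_cases hik : i = k
    · have hY' : ∑ u, y u * A u (p i) ≤ -2 := by rw [hik]; exact hy.s
      by_cases hil' : i = l
      · have hZ' : ∑ u, z u * A u (p i) ≤ -2 := by rw [hil']; exact hz.s
        have := hin {i} (by simp; omega) (by simp)
        simp at this
        omega
      · have := hin {i, i + 1} (by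
          intro a; simp; omega) (by simp)
        rw [Finset.sum_pair (by omega)] at this
        have := h.adj' i (by omega)
        omega
    · have e1 := h.adj (i - 1) (by omega)
      rw [Nat.sub_add_cancel (by omega)] at e1
      by_cases hil' : i = l
      · have hZ' : ∑ u, z u * A u (p i) ≤ -2 := by rw [hil']; exact hz.s
        have := hin {i, i - 1} (by
          intro a; simp; omega) (by simp)
        rw [Finset.sum_pair (by omega)] at this
        omega
      · have := hin {i, i - 1, i + 1} (by
          intro a; simp; omega) (by simp)
        rw [Finset.sum_insert (by simp; omega), Finset.sum_pair (by omega)] at this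
        have := h.adj' i (by omega)
        omega
  · have hxj : x j = y j + z j := by simp [x, hjS]
    rw [hxj] at hj
    have hyj := hy.nn j
    have hzj := hz.nn j
    rcases hyz j with h0 | h0
    · have h1 := hnp y j hy.nn h0
      have h2 := hone z j hz.nn
      have h3 := houter (p l) j (hSm l hkl le_rfl) hjS
      have h4 := hz.c j (by omega)
      omega
    · have h1 := hnp z j hz.nn h0
      have h2 := hone y j hy.nn
      have h3 := houter (p k) j (hSm k le_rfl hkl) hjS
      have h4 := hy.c j (by omega)
      omega

end Classify
end S5

namespace S5

section Classify2
variable {ι : Type} [Fintype ι] [DecidableEq ι] {A : Matrix ι ι ℤ}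

lemma nosub_tree (hA : GCM A) {n : ℕ} (s : Fin (n + 1) → ι) (hs : Function.Injective s)
    (par : Fin (n + 1) → Fin (n + 1)) (hpar : ∀ i, i ≠ 0 → par i ≠ i)
    (hadj : ∀ i, i ≠ 0 → A (s i) (s (par i)) ≠ 0) (x : Fin (n + 1) → ℤ) (hx : ∀ i, 0 < x i)
    (hB : ∀ j, ∑ i, x i * (if i = j then 2 else if (i ≠ 0 ∧ par i = j) ∨ (j ≠ 0 ∧ par j = i) then -1 else 0)
      ≤ 0) : False := by
  refine nosub hA s hs _ x hx hB fun i j => ?_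
  by_cases hij : i = j
  · simp [hij, hA.d2]
  · have hsij : s i ≠ s j := fun e => hij (hs e)
    rw [if_neg hij]
    split_ifs with h
    · rcases h with ⟨h1, h2⟩ | ⟨h1, h2⟩
      · have := hadj i h1
        rw [h2] at this
        exact (hA.adj hsij this).1
      · have := hadj j h1
        rw [h2] at this
        exact (hA.adj hsij.symm this).2
    · exact hA.off _ _ hsij

lemma edge_le (hA : GCM A) {u v : ι} (huv : u ≠ v) : A u v * A v u ≤ 3 := by
  by_contra! hc
  have h1 := hA.off _ _ huv
  have h2 := hA.off _ _ huv.symm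
  have h3 : A v u ≠ 0 := fun h => by rw [h] at hc; simp at hc
  refine nosub hA ![u, v] ?_ (fun i j => A (![u, v] i) (![u, v] j)) ![-A v u, 2] ?_ ?_ (fun _ _ => le_rfl)
  · intro i j; fin_cases i <;> fin_cases j <;> simp [huv, huv.symm]
  · intro i; fin_cases i <;> simp; omega
  · intro i; fin_cases i <;> simp [Fin.sum_univ_two, hA.d2]
    · linarith
    · linarith

lemma no_triple (hA : GCM A) {u e v : ι} (hue : u ≠ e) (hve : v ≠ e) (huv : u ≠ v)
    (h3 : A u e * A e u = 3) (hv : A v e ≠ 0) : False := by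
  obtain ⟨v1, v2⟩ := hA.adj hve hv
  obtain ⟨u1, u2⟩ := hA.adj hue (fun h => by rw [h] at h3; simp at h3)
  have hvu := hA.off _ _ huv
  have hvu' := hA.off _ _ huv.symm
  have hinj : Function.Injective ![u, e, v] := by
    intro i j; fin_cases i <;> fin_cases j <;> simp [huv, huv.symm, hue, hue.symm, hve, hve.symm]
  have hcases : (A u e = -3 ∧ A e u = -1) ∨ (A u e = -1 ∧ A e u = -3) := by
    have : -3 ≤ A u e := by nlinarith
    interval_cases h : A u e <;> omega
  rcases hcases with ⟨a1, a2⟩ | ⟨a1, a2⟩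
  · refine nosub hA ![u, e, v] hinj (fun i j => A (![u, e, v] i) (![u, e, v] j)) ![1, 2, 1]
      (by decide) ?_ (fun _ _ => le_rfl)
    intro i; fin_cases i <;> simp [Fin.sum_univ_three, hA.d2] <;> omega
  · refine nosub hA ![u, e, v] hinj (fun i j => A (![u, e, v] i) (![u, e, v] j)) ![3, 2, 1]
      (by decide) ?_ (fun _ _ => le_rfl)
    intro i; fin_cases i <;> simp [Fin.sum_univ_three, hA.d2] <;> omega

lemma no_F (hA : GCM A) {p : ℕ → ι} (h : IsPath A p 4) (h2 : A (p 2) (p 3) * A (p 3) (p 2) ≠ 1) : False := by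
  have hinj : Function.Injective (fun i : Fin 5 => p i) := fun i j e =>
    Fin.ext (h.inj _ (by omega) _ (by omega) e)
  have a0 := h.adj 0 (by omega)
  have a0' := h.adj' 0 (by omega)
  have a1 := h.adj 1 (by omega)
  have a1' := h.adj' 1 (by omega)
  have a2 := h.adj 2 (by omega)
  have a2' := h.adj' 2 (by omega)
  have a3 := h.adj 3 (by omega)
  have a3' := h.adj' 3 (by omega)
  simp only [zero_add, Nat.reduceAdd] at a0 a0' a1 a1' a2 a2' a3 a3'
  have ho : ∀ i j : ℕ, i ≤ 4 → j ≤ 4 → i ≠ j → A (p i) (p j) ≤ 0 := fun i j hi hj hij =>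
    hA.off _ _ fun e => hij (h.inj i hi j hj e)
  by_cases hc : A (p 3) (p 2) ≤ -2
  · refine nosub hA _ hinj (fun i j => A (p i) (p j)) ![1, 2, 3, 2, 1]
      (by decide) ?_ (fun _ _ => le_rfl)
    intro j
    have h0 := ho 0 j
    have h1 := ho 1 j
    have h2 := ho 2 j
    have h3 := ho 3 j
    have h4 := ho 4 j
    fin_cases j <;> simp [Fin.sum_univ_five, hA.d2] at * <;> omega
  · have h3 : A (p 2) (p 3) ≤ -2 := by
      have : A (p 3) (p 2) = -1 := by omega
      rw [this] at h2; omega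
    refine nosub hA _ hinj (fun i j => A (p i) (p j)) ![1, 2, 3, 4, 2]
      (by decide) ?_ (fun _ _ => le_rfl)
    intro j
    have h0 := ho 0 j
    have h1 := ho 1 j
    have h2 := ho 2 j
    have h3 := ho 3 j
    have h4 := ho 4 j
    fin_cases j <;> simp [Fin.sum_univ_five, hA.d2] at * <;> omega

lemma fin_cls {P : ℕ → ι} {N n : ℕ} (hinj : ∀ i ≤ N, ∀ j ≤ N, P i = P j → i = j)
    (hsur : ∀ v, ∃ i ≤ N, P i = v) (hn : n = N + 1) (σ : Fin n → ℕ) (hσ : Function.Injective σ)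
    (hσN : ∀ i, σ i ≤ N) (M : Matrix (Fin n) (Fin n) ℤ) (hM : ∀ i j, A (P (σ i)) (P (σ j)) = M i j) :
    ∃ s : Fin n ≃ ι, A.submatrix s s = M := by
  subst hn
  have hcard : Fintype.card (Fin (N + 1)) = Fintype.card ι := by
    refine Fintype.card_of_bijective (f := fun i : Fin (N + 1) => P i) ⟨fun i j e =>
      Fin.ext (hinj _ (by omega) _ (by omega) e), fun v => ?_⟩
    obtain ⟨i, hi, rfl⟩ := hsur v
    exact ⟨⟨i, by omega⟩, rfl⟩
  have hi : Function.Injective (fun i => P (σ i)) := fun i j e =>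
    hσ (hinj _ (hσN i) _ (hσN j) e)
  have hb := (Fintype.bijective_iff_injective_and_card _).2 ⟨hi, hcard⟩
  refine ⟨Equiv.ofBijective _ hb, ?_⟩
  ext i j
  exact hM i j

/-- The list of connected Cartan matrices of finite type. -/
def Cls (A : Matrix ι ι ℤ) : Prop :=
  (∃ n, 1 ≤ n ∧ ∃ s : Fin n ≃ ι, A.submatrix s s = CartanMatrix.A n) ∨
  (∃ n, 2 ≤ n ∧ ∃ s : Fin n ≃ ι, A.submatrix s s = CartanMatrix.B n) ∨
  (∃ n, 3 ≤ n ∧ ∃ s : Fin n ≃ ι, A.submatrix s s = CartanMatrix.C n) ∨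
  (∃ n, 4 ≤ n ∧ ∃ s : Fin n ≃ ι, A.submatrix s s = CartanMatrix.D n) ∨
  (∃ s : Fin 6 ≃ ι, A.submatrix s s = CartanMatrix.E₆) ∨
  (∃ s : Fin 7 ≃ ι, A.submatrix s s = CartanMatrix.E₇) ∨
  (∃ s : Fin 8 ≃ ι, A.submatrix s s = CartanMatrix.E₈) ∨
  (∃ s : Fin 4 ≃ ι, A.submatrix s s = CartanMatrix.F₄) ∨
  (∃ s : Fin 2 ≃ ι, A.submatrix s s = CartanMatrix.G₂)

lemma chord (hA : GCM A) {p : ℕ → ι} {m : ℕ} (h : IsPath A p m) {i j : ℕ} (hi : i + 2 ≤ j) (hj : j ≤ m) :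
    A (p i) (p j) = 0 ∧ A (p j) (p i) = 0 := by
  have : A (p i) (p j) = 0 := by
    by_contra hc
    refine acyclic hA (m := j - i) (by omega) (h.shift i (j - i) (by omega)) ?_
    simpa [show i + (j - i) = j by omega] using hc
  exact ⟨this, hA.zs _ _ this⟩

lemma one_nb (hA : GCM A) {p : ℕ → ι} {m : ℕ} (h : IsPath A p m) {q : ι} (hq : ∀ i ≤ m, p i ≠ q)
    {i j : ℕ} (hi : i < j) (hj : j ≤ m) (h1 : A q (p i) ≠ 0) : A q (p j) = 0 := by
  by_contra hc
  refine acyclic hA (m := j - i + 1) (by omega) ((h.shift i (j - i) (by omega)).cons hA q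
    (fun a ha => hq _ (by omega)) h1) ?_
  simpa [show i + (j - i) = j by omega] using hc

lemma IsPath.ne {p : ℕ → ι} {m : ℕ} (h : IsPath A p m) {i j : ℕ} (hi : i ≤ m) (hj : j ≤ m)
    (hij : i ≠ j) : p i ≠ p j := fun e => hij (h.inj i hi j hj e)

lemma mul_eq_one_neg {a b : ℤ} (ha : a ≤ -1) (h : a * b = 1) : a = -1 ∧ b = -1 := by
  have := Int.mul_eq_one_iff_eq_one_or_neg_one.1 h
  omega

lemma mul_eq_two_neg {a b : ℤ} (ha : a ≤ -1) (hb : b ≤ -1) (h1 : a * b ≠ 1) (h3 : a * b ≤ 3) :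
    (a = -2 ∧ b = -1) ∨ (a = -1 ∧ b = -2) ∨ (a * b = 3 ∧ ((a = -3 ∧ b = -1) ∨ (a = -1 ∧ b = -3))) := by
  have : -3 ≤ a := by nlinarith
  interval_cases a <;> omega

lemma mm_path (hA : GCM A) {p : ℕ → ι} {m : ℕ} (h : IsPath A p m) {i j : ℕ} (hij : i < j) (hj : j < m)
    (h1 : A (p i) (p (i + 1)) * A (p (i + 1)) (p i) ≠ 1)
    (h2 : A (p j) (p (j + 1)) * A (p (j + 1)) (p j) ≠ 1) : False := by
  obtain ⟨y, hy, hy0⟩ := Tm_multi hA (e := p (i + 1)) (u := p i) (h.ne (by omega) (by omega) (by omega))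
    (by have := h.adj i (by omega); omega) h1
  obtain ⟨z, hz, hz0⟩ := Tm_multi hA (e := p j) (u := p (j + 1)) (h.ne (by omega) (by omega) (by omega))
    (by have := h.adj' j (by omega); omega) (by rwa [mul_comm])
  refine Dtil hA h (k := i + 1) (l := j) (by omega) (by omega) hy hz (fun w => ?_) (fun a h1 h2 => ?_)
    (fun a h1 h2 => ?_)
  · by_cases hw : w = p i
    · right; exact hz0 _ (hw ▸ h.ne (by omega) (by omega) (by omega))
    · left; exact hy0 _ hw
  · exact hy0 _ (h.ne (by omega) (by omega) (by omega))
  · exact hz0 _ (h.ne (by omega) (by omega) (by omega))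

lemma cls_path (hA : GCM A) {p : ℕ → ι} {m : ℕ} (h : IsPath A p m) (hsur : ∀ v, ∃ i ≤ m, p i = v) :
    Cls A := by
  have hid : Function.Injective (fun i : Fin (m + 1) => (i : ℕ)) := fun i j e => Fin.ext e
  have hid' : ∀ i : Fin (m + 1), (i : ℕ) ≤ m := fun i => by omega
  have hrv : Function.Injective (fun i : Fin (m + 1) => m - (i : ℕ)) := fun i j e => Fin.ext (by
    dsimp only at e; omega)
  have hrv' : ∀ i : Fin (m + 1), m - (i : ℕ) ≤ m := fun i => by omega
  have hgen : ∀ a b : ℕ, a ≤ m → b ≤ m → A (p a) (p b) = if a = b then 2 else if a + 1 = b then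
      A (p a) (p (a + 1)) else if b + 1 = a then A (p (b + 1)) (p b) else 0 := by
    intro a b ha hb
    split_ifs with h1 h2 h3
    · rw [h1, hA.d2]
    · rw [h2]
    · rw [h3]
    · rcases lt_or_gt_of_ne h1 with h4 | h4
      · exact (chord hA h (by omega) hb).1
      · exact (chord hA h (by omega) ha).2
  by_cases hall : ∀ i < m, A (p i) (p (i + 1)) * A (p (i + 1)) (p i) = 1
  · left
    refine ⟨m + 1, by omega, fin_cls h.inj hsur rfl _ hid hid' _ fun i j => ?_⟩
    rw [hgen _ _ (hid' i) (hid' j)]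
    simp only [CartanMatrix.A, Matrix.of_apply, Fin.ext_iff]
    split_ifs with h1 h2 h3 h4 h5
    all_goals first | rfl | omega | skip
    · exact (mul_eq_one_neg (h.adj _ (by omega)) (hall _ (by omega))).1
    · exact (mul_eq_one_neg (h.adj _ (by omega)) (hall _ (by omega))).2
  · push Not at hall
    obtain ⟨i, hi, hmul⟩ := hall
    have hoth : ∀ j < m, j ≠ i → A (p j) (p (j + 1)) = -1 ∧ A (p (j + 1)) (p j) = -1 := by
      intro j hj hji
      refine mul_eq_one_neg (h.adj _ hj) ?_
      by_contra hc
      rcases lt_or_gt_of_ne hji with h4 | h4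
      · exact mm_path hA h h4 hi hc hmul
      · exact mm_path hA h h4 hj hmul hc
    have hF : ∀ a b : ℕ, a ≤ m → b ≤ m → A (p a) (p b) = if a = b then 2 else if a + 1 = b then
      (if a = i then A (p i) (p (i + 1)) else -1) else if b + 1 = a then
      (if b = i then A (p (i + 1)) (p i) else -1) else 0 := by
      intro a b ha hb
      rw [hgen a b ha hb]
      split_ifs with h1 h2 h3 h4 h5
      · rfl
      · rw [h3]
      · exact (hoth a (by omega) h3).1
      · rw [h5]
      · exact (hoth b (by omega) h5).2
      · rfl
    have hle := edge_le hA (h.ne (i := i) (j := i + 1) (by omega) (by omega) (by omega))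
    have ha := h.adj i hi
    have hb := h.adj' i hi
    have h3 := mul_eq_two_neg ha hb hmul hle
    by_cases htri : A (p i) (p (i + 1)) * A (p (i + 1)) (p i) = 3
    · have hm1 : m = 1 ∧ i = 0 := by
        by_contra hc
        by_cases hi0 : i = 0
        · refine no_triple hA (u := p i) (e := p (i + 1)) (v := p (i + 2)) (h.ne (by omega) (by omega) (by omega))
            (h.ne (by omega) (by omega) (by omega)) (h.ne (by omega) (by omega) (by omega)) htri ?_
          have : A (p (i + 2)) (p (i + 1)) ≤ -1 := h.adj' (i + 1) (by omega)
          omega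
        · refine no_triple hA (u := p (i + 1)) (e := p i) (v := p (i - 1)) (h.ne (by omega) (by omega) (by omega))
            (h.ne (by omega) (by omega) (by omega)) (h.ne (by omega) (by omega) (by omega))
            (by rwa [mul_comm]) ?_
          have := h.adj (i - 1) (by omega)
          rw [Nat.sub_add_cancel (by omega)] at this
          omega
      obtain ⟨rfl, rfl⟩ := hm1
      iterate 8 right
      have h3' : ((A (p 0) (p 1) = -3 ∧ A (p 1) (p 0) = -1) ∨ (A (p 0) (p 1) = -1 ∧ A (p 1) (p 0) = -3)) := by
        rcases h3 with h3 | h3 | h3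
        all_goals
          first
          | exact Or.inl h3
          | exact Or.inr h3
          | (rw [h3.1, h3.2] at htri; norm_num at htri)
          | exact h3.2
      rcases h3' with ⟨e1, e2⟩ | ⟨e1, e2⟩
      · refine fin_cls h.inj hsur rfl _ hid hid' _ fun i j => ?_
        rw [hF _ _ (hid' i) (hid' j)]
        simp only [zero_add, e1, e2]
        fin_cases i <;> fin_cases j <;> rfl
      · refine fin_cls h.inj hsur rfl _ hrv hrv' _ fun i j => ?_
        rw [hF _ _ (hrv' i) (hrv' j)]
        simp only [zero_add, e1, e2]
        fin_cases i <;> fin_cases j <;> rfl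
    · have h2 : (A (p i) (p (i + 1)) = -2 ∧ A (p (i + 1)) (p i) = -1) ∨
          (A (p i) (p (i + 1)) = -1 ∧ A (p (i + 1)) (p i) = -2) := by omega
      by_cases him : i + 1 = m
      · rcases h2 with ⟨e1, e2⟩ | ⟨e1, e2⟩
        · right; left
          refine ⟨m + 1, by omega, fin_cls h.inj hsur rfl _ hid hid' _ fun a b => ?_⟩
          rw [hF _ _ (hid' a) (hid' b), e1, e2]
          simp only [CartanMatrix.B, Matrix.of_apply, Fin.ext_iff]
          split_ifs <;> omega
        · by_cases hm2 : m = 1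
          · right; left
            refine ⟨m + 1, by omega, fin_cls h.inj hsur rfl _ hrv hrv' _ fun a b => ?_⟩
            rw [hF _ _ (hrv' a) (hrv' b), e1, e2]
            simp only [CartanMatrix.B, Matrix.of_apply, Fin.ext_iff]
            split_ifs <;> omega
          · right; right; left
            refine ⟨m + 1, by omega, fin_cls h.inj hsur rfl _ hid hid' _ fun a b => ?_⟩
            rw [hF _ _ (hid' a) (hid' b), e1, e2]
            simp only [CartanMatrix.C, Matrix.of_apply, Fin.ext_iff]
            split_ifs <;> omega
      · by_cases hi0 : i = 0
        · rcases h2 with ⟨e1, e2⟩ | ⟨e1, e2⟩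
          · right; right; left
            refine ⟨m + 1, by omega, fin_cls h.inj hsur rfl _ hrv hrv' _ fun a b => ?_⟩
            rw [hF _ _ (hrv' a) (hrv' b), e1, e2]
            simp only [CartanMatrix.C, Matrix.of_apply, Fin.ext_iff]
            split_ifs <;> omega
          · right; left
            refine ⟨m + 1, by omega, fin_cls h.inj hsur rfl _ hrv hrv' _ fun a b => ?_⟩
            rw [hF _ _ (hrv' a) (hrv' b), e1, e2]
            simp only [CartanMatrix.B, Matrix.of_apply, Fin.ext_iff]
            split_ifs <;> omega
        · have hm3 : m = 3 ∧ i = 1 := by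
            by_contra hc
            by_cases hi2 : 2 ≤ i
            · refine no_F hA (h.shift (i - 2) 4 (by omega)) ?_
              simpa [show i - 2 + 2 = i by omega, show i - 2 + 3 = i + 1 by omega] using hmul
            · refine no_F hA (h.rev.shift (m - i - 3) 4 (by omega)) ?_
              simp only [show m - (m - i - 3 + 2) = i + 1 by omega, show m - (m - i - 3 + 3) = i by omega]
              rwa [mul_comm]
          obtain ⟨rfl, rfl⟩ := hm3
          iterate 7 right
          left
          rcases h2 with ⟨e1, e2⟩ | ⟨e1, e2⟩
          · refine fin_cls h.inj hsur rfl _ hid hid' _ fun i j => ?_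
            rw [hF _ _ (hid' i) (hid' j)]
            simp only [e1, e2]
            fin_cases i <;> fin_cases j <;> rfl
          · refine fin_cls h.inj hsur rfl _ hrv hrv' _ fun i j => ?_
            rw [hF _ _ (hrv' i) (hrv' j)]
            simp only [e1, e2]
            fin_cases i <;> fin_cases j <;> rfl

end Classify2
end S5

namespace S5

section Classify3
variable {ι : Type} [Fintype ι] [DecidableEq ι] {A : Matrix ι ι ℤ}

lemma br_mid (hA : GCM A) {p : ℕ → ι} {m : ℕ} (h : IsPath A p m) {q : ι} (hq : ∀ i ≤ m, p i ≠ q)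
    {k : ℕ} (hk : 1 ≤ k) (hkm : k + 1 ≤ m) (hadj : A q (p k) ≠ 0) : A q (p k) * A (p k) q = 1 := by
  by_contra hc
  obtain ⟨y, hy, hy0⟩ := Tm_multi hA (e := p k) (u := q) (hq k (by omega)).symm hadj hc
  obtain ⟨z, hz, hz0⟩ := Tm_branch hA (e := p k) (u := p (k - 1)) (v := p (k + 1))
    (h.ne (by omega) (by omega) (by omega)) (h.ne (by omega) (by omega) (by omega))
    (h.ne (by omega) (by omega) (by omega))
    (by have := h.adj (k - 1) (by omega); rw [Nat.sub_add_cancel hk] at this; omega)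
    (by have := h.adj' k (by omega); omega)
  refine Dtil hA h (k := k) (l := k) le_rfl (by omega) hy hz (fun w => ?_) (fun a h1 h2 => ?_)
    (fun a h1 h2 => ?_)
  · by_cases hw : w = q
    · right; exact hz0 _ (hw ▸ (hq _ (by omega)).symm) (hw ▸ (hq _ (by omega)).symm)
    · left; exact hy0 _ hw
  · exact hy0 _ (hq _ (by omega))
  · exact hz0 _ (h.ne (by omega) (by omega) (by omega)) (h.ne (by omega) (by omega) (by omega))

lemma br_side (hA : GCM A) {p : ℕ → ι} {m : ℕ} (h : IsPath A p m) {q : ι} (hq : ∀ i ≤ m, p i ≠ q)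
    {k : ℕ} (hkm : k + 1 ≤ m) (hadj : A q (p k) ≠ 0) {i : ℕ} (hi : i < k) :
    A (p i) (p (i + 1)) * A (p (i + 1)) (p i) = 1 := by
  by_contra hc
  obtain ⟨y, hy, hy0⟩ := Tm_multi hA (e := p (i + 1)) (u := p i) (h.ne (by omega) (by omega) (by omega))
    (by have := h.adj i (by omega); omega) hc
  obtain ⟨z, hz, hz0⟩ := Tm_branch hA (e := p k) (u := q) (v := p (k + 1))
    (hq _ (by omega)).symm (h.ne (by omega) (by omega) (by omega))
    (hq _ (by omega)).symm hadj
    (by have := h.adj' k (by omega); omega)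
  refine Dtil hA h (k := i + 1) (l := k) (by omega) (by omega) hy hz (fun w => ?_) (fun a h1 h2 => ?_)
    (fun a h1 h2 => ?_)
  · by_cases hw : w = p i
    · right; exact hz0 _ (hw ▸ (hq _ (by omega))) (hw ▸ h.ne (by omega) (by omega) (by omega))
    · left; exact hy0 _ hw
  · exact hy0 _ (h.ne (by omega) (by omega) (by omega))
  · exact hz0 _ (hq _ (by omega)) (h.ne (by omega) (by omega) (by omega))

lemma br_edge (hA : GCM A) {p : ℕ → ι} {m : ℕ} (h : IsPath A p m) {q : ι} (hq : ∀ i ≤ m, p i ≠ q)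
    {k : ℕ} (hk : 1 ≤ k) (hkm : k + 1 ≤ m) (hadj : A q (p k) ≠ 0) {i : ℕ} (hi : i < m) :
    A (p i) (p (i + 1)) = -1 ∧ A (p (i + 1)) (p i) = -1 := by
  refine mul_eq_one_neg (h.adj i hi) ?_
  by_cases hik : i < k
  · exact br_side hA h hq hkm hadj hik
  · have := br_side hA h.rev (q := q) (fun j hj => hq _ (by omega)) (k := m - k) (by omega)
      (by rwa [show m - (m - k) = k by omega]) (i := m - (i + 1)) (by omega)
    rw [show m - (m - (i + 1)) = i + 1 by omega, show m - (m - (i + 1) + 1) = i by omega, mul_comm] at this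
    exact this

lemma br_two (hA : GCM A) {p : ℕ → ι} {m : ℕ} (h : IsPath A p m) {q q' : ι} (hq : ∀ i ≤ m, p i ≠ q)
    (hq' : ∀ i ≤ m, p i ≠ q') (hqq : q ≠ q')
    {k l : ℕ} (hk : 1 ≤ k) (hkl : k ≤ l) (hlm : l + 1 ≤ m) (hadj : A q (p k) ≠ 0) (hadj' : A q' (p l) ≠ 0) :
    False := by
  obtain ⟨y, hy, hy0⟩ := Tm_branch hA (e := p k) (u := p (k - 1)) (v := q)
    (h.ne (by omega) (by omega) (by omega)) (hq _ (by omega)).symm (hq _ (by omega))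
    (by have := h.adj (k - 1) (by omega); rw [Nat.sub_add_cancel hk] at this; omega) hadj
  obtain ⟨z, hz, hz0⟩ := Tm_branch hA (e := p l) (u := q') (v := p (l + 1))
    (hq' _ (by omega)).symm (h.ne (by omega) (by omega) (by omega))
    (hq' _ (by omega)).symm hadj'
    (by have := h.adj' l (by omega); omega)
  refine Dtil hA h hkl (by omega) hy hz (fun w => ?_) (fun a h1 h2 => ?_)
    (fun a h1 h2 => ?_)
  · by_cases hw : w = q
    · right; exact hz0 _ (hw ▸ hqq) (hw ▸ (hq _ (by omega)).symm)
    · by_cases hw' : w = p (k - 1)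
      · right; exact hz0 _ (hw' ▸ (hq' _ (by omega))) (hw' ▸ h.ne (by omega) (by omega) (by omega))
      · left; exact hy0 _ hw' hw
  · exact hy0 _ (h.ne (by omega) (by omega) (by omega)) (hq _ (by omega))
  · exact hz0 _ (hq' _ (by omega)) (h.ne (by omega) (by omega) (by omega))

lemma no_E6t (hA : GCM A) {p : ℕ → ι} {m : ℕ} (h : IsPath A p m) {q q' : ι} (hq : ∀ i ≤ m, p i ≠ q)
    (hq' : ∀ i ≤ m, p i ≠ q') (hqq : q ≠ q')
    {k : ℕ} (hk : 2 ≤ k) (hkm : k + 2 ≤ m) (hadj : A q (p k) ≠ 0) (hadj' : A q' q ≠ 0) : False := by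
  have e1 := h.adj (k - 1) (by omega)
  have e2 := h.adj (k - 2) (by omega)
  have e3 := h.adj' k (by omega)
  have e4 := h.adj' (k + 1) (by omega)
  rw [show k - 1 + 1 = k by omega] at e1
  rw [show k - 2 + 1 = k - 1 by omega] at e2
  refine nosub_tree hA (n := 6) ![p k, p (k - 1), p (k - 2), p (k + 1), p (k + 1 + 1), q, q'] ?_
    ![0, 0, 1, 0, 3, 0, 5] (by decide) ?_ ![3, 2, 1, 2, 1, 2, 1] (by decide) (by decide)
  · have n1 : ∀ a b : ℕ, a ≤ m → b ≤ m → a ≠ b → ¬ p a = p b := fun a b ha hb => h.ne ha hb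
    have n2 : ∀ a, a ≤ m → ¬ p a = q := hq
    have n3 : ∀ a, a ≤ m → ¬ p a = q' := hq'
    have n2' : ∀ a, a ≤ m → ¬ q = p a := fun a ha e => hq a ha e.symm
    have n3' : ∀ a, a ≤ m → ¬ q' = p a := fun a ha e => hq' a ha e.symm
    intro i j hij
    by_contra hne
    revert hij
    fin_cases i <;> fin_cases j <;> first | (exact absurd rfl hne) | skip
    all_goals first
      | exact n1 _ _ (by omega) (by omega) (by omega)
      | exact n2 _ (by omega)
      | exact n3 _ (by omega)
      | exact n2' _ (by omega)
      | exact n3' _ (by omega)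
      | exact hqq
      | exact hqq.symm
  · intro i hi
    fin_cases i
    · exact absurd rfl hi
    · show A (p (k - 1)) (p k) ≠ 0; omega
    · show A (p (k - 2)) (p (k - 1)) ≠ 0; omega
    · show A (p (k + 1)) (p k) ≠ 0; omega
    · show A (p (k + 1 + 1)) (p (k + 1)) ≠ 0; omega
    · exact hadj
    · exact hadj'

lemma no_E7t (hA : GCM A) {p : ℕ → ι} {m : ℕ} (h : IsPath A p m) {q : ι} (hq : ∀ i ≤ m, p i ≠ q)
    {k : ℕ} (hk : 3 ≤ k) (hkm : k + 3 ≤ m) (hadj : A q (p k) ≠ 0) : False := by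
  have e1 := h.adj (k - 1) (by omega)
  have e2 := h.adj (k - 2) (by omega)
  have e5 := h.adj (k - 3) (by omega)
  have e3 := h.adj' k (by omega)
  have e4 := h.adj' (k + 1) (by omega)
  have e6 := h.adj' (k + 1 + 1) (by omega)
  rw [show k - 1 + 1 = k by omega] at e1
  rw [show k - 2 + 1 = k - 1 by omega] at e2
  rw [show k - 3 + 1 = k - 2 by omega] at e5
  refine nosub_tree hA (n := 7) ![p k, p (k - 1), p (k - 2), p (k - 3), p (k + 1), p (k + 1 + 1), p (k + 1 + 1 + 1), q] ?_
    ![0, 0, 1, 2, 0, 4, 5, 0] (by decide) ?_ ![4, 3, 2, 1, 3, 2, 1, 2] (by decide) (by decide)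
  · have n1 : ∀ a b : ℕ, a ≤ m → b ≤ m → a ≠ b → ¬ p a = p b := fun a b ha hb => h.ne ha hb
    have n2 : ∀ a, a ≤ m → ¬ p a = q := hq
    have n2' : ∀ a, a ≤ m → ¬ q = p a := fun a ha e => hq a ha e.symm
    intro i j hij
    by_contra hne
    revert hij
    fin_cases i <;> fin_cases j <;> first | (exact absurd rfl hne) | skip
    all_goals first
      | exact n1 _ _ (by omega) (by omega) (by omega)
      | exact n2 _ (by omega)
      | exact n2' _ (by omega)
  · intro i hi
    fin_cases i
    · exact absurd rfl hi
    · show A (p (k - 1)) (p k) ≠ 0; omega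
    · show A (p (k - 2)) (p (k - 1)) ≠ 0; omega
    · show A (p (k - 3)) (p (k - 2)) ≠ 0; omega
    · show A (p (k + 1)) (p k) ≠ 0; omega
    · show A (p (k + 1 + 1)) (p (k + 1)) ≠ 0; omega
    · show A (p (k + 1 + 1 + 1)) (p (k + 1 + 1)) ≠ 0; omega
    · exact hadj

lemma no_E8t (hA : GCM A) {p : ℕ → ι} {m : ℕ} (h : IsPath A p m) {q : ι} (hq : ∀ i ≤ m, p i ≠ q)
    (hkm : 7 ≤ m) (hadj : A q (p 2) ≠ 0) : False := by
  have e1 := h.adj 1 (by omega)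
  have e2 := h.adj 0 (by omega)
  have e3 := h.adj' 2 (by omega)
  have e4 := h.adj' 3 (by omega)
  have e5 := h.adj' 4 (by omega)
  have e6 := h.adj' 5 (by omega)
  have e7 := h.adj' 6 (by omega)
  refine nosub_tree hA (n := 8) ![p 2, p 1, p 0, q, p 3, p 4, p 5, p 6, p 7] ?_
    ![0, 0, 1, 0, 0, 4, 5, 6, 7] (by decide) ?_ ![6, 4, 2, 3, 5, 4, 3, 2, 1] (by decide) (by decide)
  · have n1 : ∀ a b : ℕ, a ≤ m → b ≤ m → a ≠ b → ¬ p a = p b := fun a b ha hb => h.ne ha hb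
    have n2 : ∀ a, a ≤ m → ¬ p a = q := hq
    have n2' : ∀ a, a ≤ m → ¬ q = p a := fun a ha e => hq a ha e.symm
    intro i j hij
    by_contra hne
    revert hij
    fin_cases i <;> fin_cases j <;> first | (exact absurd rfl hne) | skip
    all_goals first
      | exact n1 _ _ (by omega) (by omega) (by omega)
      | exact n2 _ (by omega)
      | exact n2' _ (by omega)
  · intro i hi
    fin_cases i
    · exact absurd rfl hi
    · exact (e1.trans_lt (by norm_num)).ne
    · exact (e2.trans_lt (by norm_num)).ne
    · exact hadj
    · exact (e3.trans_lt (by norm_num)).ne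
    · exact (e4.trans_lt (by norm_num)).ne
    · exact (e5.trans_lt (by norm_num)).ne
    · exact (e6.trans_lt (by norm_num)).ne
    · exact (e7.trans_lt (by norm_num)).ne

lemma D_apply {m : ℕ} (hm : 2 ≤ m) (i j : Fin (m + 2)) : CartanMatrix.D (m + 2) i j =
    if i.val = j.val then 2 else if (i.val + 1 = j.val ∧ j.val ≤ m) ∨ (j.val + 1 = i.val ∧ i.val ≤ m) ∨
      (i.val + 1 = m ∧ j.val = m + 1) ∨ (j.val + 1 = m ∧ i.val = m + 1) then -1 else 0 := by
  simp only [CartanMatrix.D, Matrix.of_apply, Fin.ext_iff]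
  have := i.2
  have := j.2
  split_ifs <;> first | rfl | omega

lemma cls_branch_le (hA : GCM A) {p : ℕ → ι} {m : ℕ} (h : IsPath A p m) {q : ι} (hq : ∀ i ≤ m, p i ≠ q)
    {k : ℕ} (hk : 1 ≤ k) (hkm : k ≤ m - k) (hkm1 : k + 1 ≤ m) (hadj : A q (p k) ≠ 0)
    (hsur : ∀ v, v ≠ q → ∃ i ≤ m, p i = v) : Cls A := by
  let P : ℕ → ι := fun i => if i ≤ m then p i else q
  have hP1 : ∀ i ≤ m, P i = p i := fun i hi => if_pos hi
  have hP2 : P (m + 1) = q := if_neg (by omega)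
  have hPinj : ∀ i ≤ m + 1, ∀ j ≤ m + 1, P i = P j → i = j := by
    intro i hi j hj e
    simp only [P] at e
    split_ifs at e with h1 h2 h2
    · exact h.inj _ h1 _ h2 e
    · exact absurd e (hq _ h1)
    · exact absurd e.symm (hq _ h2)
    · omega
  have hPsur : ∀ v, ∃ i ≤ m + 1, P i = v := by
    intro v
    by_cases hv : v = q
    · exact ⟨m + 1, le_rfl, hv ▸ hP2⟩
    · obtain ⟨i, hi, rfl⟩ := hsur v hv
      exact ⟨i, by omega, hP1 i hi⟩
  have hqk := hA.adj (hq k (by omega)).symm hadj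
  have hqk1 := mul_eq_one_neg hqk.1 (br_mid hA h hq hk hkm1 hadj)
  have hq0 : ∀ j ≤ m, j ≠ k → A q (p j) = 0 := by
    intro j hj hjk
    rcases lt_or_gt_of_ne hjk with h4 | h4
    · by_contra hc
      exact hadj (one_nb hA h hq h4 (by omega) hc)
    · exact one_nb hA h hq h4 hj hadj
  have hpp : ∀ a b : ℕ, a ≤ m → b ≤ m → A (p a) (p b) = if a = b then 2 else if a + 1 = b ∨ b + 1 = a then
      -1 else 0 := by
    intro a b ha hb
    split_ifs with h1 h2
    · rw [h1, hA.d2]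
    · rcases h2 with rfl | rfl
      · exact (br_edge hA h hq hk hkm1 hadj (by omega)).1
      · exact (br_edge hA h hq hk hkm1 hadj (by omega)).2
    · rcases lt_or_gt_of_ne h1 with h4 | h4
      · exact (chord hA h (by omega) hb).1
      · exact (chord hA h (by omega) ha).2
  have hgen : ∀ a b : ℕ, a ≤ m + 1 → b ≤ m + 1 → A (P a) (P b) = if a = b then 2 else if a ≤ m ∧ b ≤ m then
      (if a + 1 = b ∨ b + 1 = a then -1 else 0) else if a = k ∨ b = k then -1 else 0 := by
    intro a b ha hb
    by_cases ha' : a ≤ m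
    · rw [hP1 a ha']
      by_cases hb' : b ≤ m
      · rw [hP1 b hb', hpp a b ha' hb', if_pos (⟨ha', hb'⟩ : a ≤ m ∧ b ≤ m)]
      · rw [show b = m + 1 by omega, hP2, if_neg (by omega), if_neg (by omega)]
        split_ifs with h1
        · rw [show a = k by omega]; exact hqk1.2
        · exact hA.zs _ _ (hq0 a ha' (by omega))
    · rw [show a = m + 1 by omega, hP2]
      by_cases hb' : b ≤ m
      · rw [hP1 b hb', if_neg (by omega), if_neg (by omega)]
        split_ifs with h1
        · rw [show b = k by omega]; exact hqk1.1
        · exact hq0 b hb' (by omega)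
      · rw [show b = m + 1 by omega, hP2, if_pos rfl, hA.d2]
  by_cases k1 : k = 1
  · subst k1
    right; right; right; left
    have hσ : ∀ i : Fin (m + 2), (if i.val = m + 1 then m + 1 else m - i.val) ≤ m + 1 := fun i => by
      split_ifs <;> omega
    refine ⟨m + 2, by omega, fin_cls hPinj hPsur rfl (fun j => if j.val = m + 1 then m + 1 else m - j.val)
      (fun i j e => ?_) hσ _ fun i j => ?_⟩
    · dsimp only at e
      ext
      split_ifs at e <;> omega
    · rw [hgen _ _ (hσ i) (hσ j)]
      rw [D_apply (by omega)]
      have h1 := i.2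
      have h2 := j.2
      generalize i.val = a at *
      generalize j.val = b at *
      clear hgen hPinj hPsur hpp hq0 hqk hqk1 hsur
      by_cases hi : a = m + 1
      · by_cases hj : b = m + 1
        · simp [hi, hj]
        · rw [if_pos hi, if_neg hj]
          split_ifs <;> first | rfl | omega
      · by_cases hj : b = m + 1
        · rw [if_neg hi, if_pos hj]
          split_ifs <;> first | rfl | omega
        · rw [if_neg hi, if_neg hj]
          split_ifs <;> first | rfl | omega
  by_cases k2 : k = 2
  · subst k2
    by_cases hm7 : 7 ≤ m
    · exact absurd (no_E8t hA h hq hm7 hadj) id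
    iterate 4 right
    have hm : m = 4 ∨ m = 5 ∨ m = 6 := by omega
    rcases hm with rfl | rfl | rfl
    · left
      refine fin_cls (n := 6) hPinj hPsur rfl ![0, 5, 1, 2, 3, 4] (by decide) (by decide) _ fun i j => ?_
      rw [hgen _ _ (by revert i; decide) (by revert j; decide)]
      fin_cases i <;> fin_cases j <;> rfl
    · right; left
      refine fin_cls (n := 7) hPinj hPsur rfl ![0, 6, 1, 2, 3, 4, 5] (by decide) (by decide) _ fun i j => ?_
      rw [hgen _ _ (by revert i; decide) (by revert j; decide)]
      fin_cases i <;> fin_cases j <;> rfl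
    · right; right; left
      refine fin_cls (n := 8) hPinj hPsur rfl ![0, 7, 1, 2, 3, 4, 5, 6] (by decide) (by decide) _ fun i j => ?_
      rw [hgen _ _ (by revert i; decide) (by revert j; decide)]
      fin_cases i <;> fin_cases j <;> rfl
  · exact absurd (no_E7t hA h hq (k := k) (by omega) (by omega) hadj) id

lemma cls_branch (hA : GCM A) {p : ℕ → ι} {m : ℕ} (h : IsPath A p m) {q : ι} (hq : ∀ i ≤ m, p i ≠ q)
    {k : ℕ} (hk : 1 ≤ k) (hkm1 : k + 1 ≤ m) (hadj : A q (p k) ≠ 0)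
    (hsur : ∀ v, v ≠ q → ∃ i ≤ m, p i = v) : Cls A := by
  by_cases hkm : k ≤ m - k
  · exact cls_branch_le hA h hq hk hkm hkm1 hadj hsur
  · refine cls_branch_le hA h.rev (q := q) (k := m - k) (fun j hj => hq _ (by omega)) (by omega) (by omega)
      (by omega) (by rwa [show m - (m - k) = k by omega]) fun v hv => ?_
    obtain ⟨i, hi, rfl⟩ := hsur v hv
    exact ⟨m - i, by omega, by rw [show m - (m - i) = i by omega]⟩

theorem GCM.cls (hA : GCM A) : Cls A := by
  classical
  have hex : ∃ m, ∃ p, IsPath A p m := by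
    obtain ⟨v⟩ := hA.ne
    exact ⟨0, fun _ => v, fun i hi j hj _ => by omega, fun i hi => by omega, fun i hi => by omega⟩
  obtain ⟨m, ⟨p, h⟩, hmax⟩ : ∃ m, (∃ p, IsPath A p m) ∧ ∀ m' p', IsPath A p' m' → m' ≤ m := by
    have hne : {m | ∃ p, IsPath A p m}.Nonempty := hex
    have hbd : BddAbove {m | ∃ p, IsPath A p m} := ⟨Fintype.card ι, fun m ⟨p, hp⟩ => hp.lt_card.le⟩
    exact ⟨_, Nat.sSup_mem hne hbd, fun m' p' hp' => le_csSup hbd ⟨p', hp'⟩⟩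
  by_cases hsur : ∀ v, ∃ i ≤ m, p i = v
  · exact cls_path hA h hsur
  push Not at hsur
  have hmax0 : ∀ q, (∀ i ≤ m, p i ≠ q) → A q (p 0) = 0 := by
    intro q hq
    by_contra hc
    have := hmax _ _ (h.cons hA q hq hc)
    omega
  have hmaxm : ∀ q, (∀ i ≤ m, p i ≠ q) → A q (p m) = 0 := by
    intro q hq
    by_contra hc
    have := hmax _ _ (h.rev.cons hA q (fun i hi => hq _ (by omega)) (by simpa using hc))
    omega
  have hmid : ∀ q k, (∀ i ≤ m, p i ≠ q) → k ≤ m → A q (p k) ≠ 0 → 1 ≤ k ∧ k + 1 ≤ m := by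
    intro q k hq hk hadj
    have h1 : k ≠ 0 := fun e => by subst e; exact hadj (hmax0 q hq)
    have h2 : k ≠ m := fun e => by subst e; exact hadj (hmaxm q hq)
    omega
  -- a vertex outside the path adjacent to it
  obtain ⟨q, hq, k, hk, hadj⟩ : ∃ q, (∀ i ≤ m, p i ≠ q) ∧ ∃ k, k ≤ m ∧ A q (p k) ≠ 0 := by
    by_contra hc
    push Not at hc
    obtain ⟨v, hv⟩ := hsur
    have := hA.conn {w | ∃ i ≤ m, p i = w} ⟨p 0, 0, by omega, rfl⟩ ?_
    · have hv' : v ∈ {w | ∃ i ≤ m, p i = w} := this ▸ Set.mem_univ v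
      obtain ⟨i, hi, e⟩ := hv'
      exact hv i hi e
    · rintro _ ⟨i, hi, rfl⟩ j hj
      by_contra hn
      have hn' : ∀ i ≤ m, p i ≠ j := fun i hi e => hn ⟨i, hi, e⟩
      exact hj (hA.zs _ _ (hc j hn' i hi))
  obtain ⟨hk1, hk2⟩ := hmid q k hq hk hadj
  refine cls_branch hA h hq hk1 hk2 hadj ?_
  by_contra hc
  push Not at hc
  obtain ⟨v, hvq, hv⟩ := hc
  obtain ⟨q', hqq, hq', hadj'⟩ : ∃ q', q' ≠ q ∧ (∀ i ≤ m, p i ≠ q') ∧ (A q' q ≠ 0 ∨ ∃ l, l ≤ m ∧ A q' (p l) ≠ 0) := by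
    by_contra hc
    push Not at hc
    have := hA.conn {w | w = q ∨ ∃ i ≤ m, p i = w} ⟨q, Or.inl rfl⟩ ?_
    · have hv' : v ∈ {w | w = q ∨ ∃ i ≤ m, p i = w} := this ▸ Set.mem_univ v
      rcases hv' with e | ⟨i, hi, e⟩
      · exact hvq e
      · exact hv i hi e
    · rintro w hw j hj
      by_contra hn
      have hn1 : j ≠ q := fun e => hn (Or.inl e)
      have hn' : ∀ i ≤ m, p i ≠ j := fun i hi e => hn (Or.inr ⟨i, hi, e⟩)
      obtain ⟨c1, c2⟩ := hc j hn1 hn'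
      rcases hw with rfl | ⟨i, hi, rfl⟩
      · exact hj (hA.zs _ _ c1)
      · exact hj (hA.zs _ _ (c2 i hi))
  rcases hadj' with h1 | ⟨l, hl, h1⟩
  · -- the path q' q p_k ... p_m and its mirror image
    have c1 := (h.shift k (m - k) (by omega)).cons hA q (fun i hi => hq _ (by omega)) hadj
    have c2 := hmax _ _ (c1.cons hA q' (fun i hi => by
      rcases i with _ | i
      · exact hqq.symm
      · exact hq' _ (by omega)) h1)
    have d1 := (h.rev.shift (m - k) k (by omega)).cons hA q (fun i hi => hq _ (by omega))
      (by simpa [show m - (m - k) = k by omega] using hadj)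
    have d2 := hmax _ _ (d1.cons hA q' (fun i hi => by
      rcases i with _ | i
      · exact hqq.symm
      · exact hq' _ (by omega)) h1)
    exact no_E6t hA h hq hq' hqq.symm (k := k) (by omega) (by omega) hadj h1
  · obtain ⟨l1, l2⟩ := hmid q' l hq' hl h1
    rcases le_total k l with hkl | hkl
    · exact br_two hA h hq hq' hqq.symm hk1 hkl l2 hadj h1
    · exact br_two hA h hq' hq hqq l1 hkl hk2 h1 hadj

end Classify3
end S5

namespace S5
open LieAlgebra

section Grp
variable {g : Type} [LieRing g] [LieAlgebra ℂ g] [FiniteDimensional ℂ g]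

lemma isNilpotent_of_comm {V : Type} [AddCommGroup V] [Module ℂ V] [FiniteDimensional ℂ V]
    (A B : Module.End ℂ V) (c : ℂ) (hc : c ≠ 0) (h : A * B - B * A = c • B) : IsNilpotent B := by
  by_contra hn
  have hk : ∀ k : ℕ, A * B ^ k - B ^ k * A = ((k : ℂ) * c) • B ^ k := by
    intro k
    induction k with
    | zero => simp
    | succ k ih =>
      have e1 : A * B ^ (k + 1) - B ^ (k + 1) * A = (A * B ^ k - B ^ k * A) * B + B ^ k * (A * B - B * A) := by
        rw [pow_succ]; noncomm_ring
      rw [e1, ih, h]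
      rw [smul_mul_assoc, mul_smul_comm, ← pow_succ, ← add_smul]
      congr 1
      push_cast
      ring
  let T : Module.End ℂ (Module.End ℂ V) := LinearMap.mulLeft ℂ A - LinearMap.mulRight ℂ A
  have hfin := T.finite_hasEigenvalue
  have hinj : Function.Injective (fun k : ℕ => (k : ℂ) * c) := by
    intro a b hab
    exact_mod_cast mul_right_cancel₀ hc hab
  refine Set.infinite_range_of_injective hinj (hfin.subset ?_)
  rintro _ ⟨k, rfl⟩
  refine Module.End.hasEigenvalue_of_hasEigenvector (x := B ^ k) ⟨?_, fun h0 => hn ⟨k, h0⟩⟩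
  rw [Module.End.mem_eigenspace_iff]
  exact hk k

lemma ad_nil {h e : g} (c : ℂ) (hc : c ≠ 0) (he : ⁅h, e⁆ = c • e) : IsNilpotent (ad ℂ g e) := by
  refine isNilpotent_of_comm (ad ℂ g h) _ c hc ?_
  ext y
  have := congrArg (fun z => ⁅z, y⁆) he
  simp only [lie_lie, smul_lie] at this
  simpa using this

lemma endExp_apply {V : Type} [AddCommGroup V] [Module ℂ V] [FiniteDimensional ℂ V]
    {A : Module.End ℂ V} (hA : IsNilpotent A) {m : ℕ} {v : V} (hm : (A ^ m) v = 0) :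
    endExp A v = ∑ k ∈ Finset.range m, (k.factorial : ℂ)⁻¹ • (A ^ k) v := by
  have hN : A ^ (Module.finrank ℂ V) = 0 := by
    have h1 := hA.charpoly_eq_X_pow_finrank
    have h2 := LinearMap.aeval_self_charpoly A
    rw [h1] at h2
    simpa using h2
  have hN1 : (A ^ (Module.finrank ℂ V + 1)) v = 0 := by rw [pow_succ, hN]; simp
  have key : ∀ a b : ℕ, a ≤ b → (A ^ a) v = 0 → ∑ k ∈ Finset.range a, (k.factorial : ℂ)⁻¹ • (A ^ k) v =
      ∑ k ∈ Finset.range b, (k.factorial : ℂ)⁻¹ • (A ^ k) v := by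
    intro a b hab h0
    refine Finset.sum_subset (Finset.range_mono hab) fun k _ hk => ?_
    have : a ≤ k := by simpa using hk
    rw [← Nat.sub_add_cancel this, pow_add, Module.End.mul_apply, h0]
    simp
  simp only [endExp, LinearMap.sum_apply, LinearMap.smul_apply]
  rcases le_total m (Module.finrank ℂ V + 1) with h | h
  · exact (key _ _ h hm).symm
  · exact key _ _ h hN1

lemma exists_exp {x : g} (hx : IsNilpotent (ad ℂ g x)) :
    ∃ u : g ≃ₗ⁅ℂ⁆ g, u.toLinearEquiv ∈ adjointGroup g ∧ ∀ y, u y = endExp (ad ℂ g x) y := by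
  letI : Module ℚ g := Module.compHom g (algebraMap ℚ ℂ)
  letI : LieAlgebra ℚ g := { (inferInstance : Module ℚ g) with
    lie_smul := fun q x y => lie_smul (algebraMap ℚ ℂ q) x y }
  have hx0 : (LieDerivation.ad ℂ g x).toLinearMap = ad ℂ g x := by
    ext y; simp
  have hx' : IsNilpotent (LieDerivation.ad ℂ g x).toLinearMap := by rw [hx0]; exact hx
  have key : ∀ y, LieDerivation.exp _ hx' y = endExp (ad ℂ g x) y := by
    intro y
    obtain ⟨k, hk⟩ := hx
    rw [endExp_apply ⟨k, hk⟩ (m := k) (by rw [hk]; rfl), LieDerivation.exp_map_apply,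
      IsNilpotent.exp_eq_sum (k := k) (by rw [hx0]; exact hk), hx0]
    simp only [LinearMap.sum_apply]
    refine Finset.sum_congr rfl fun i _ => ?_
    change (algebraMap ℚ ℂ (i.factorial : ℚ)⁻¹) • (((ad ℂ g x) ^ i) y) = _
    rw [map_inv₀, map_natCast]
  refine ⟨LieDerivation.exp _ hx', Subgroup.subset_closure ⟨x, hx, ?_⟩, key⟩
  ext y
  exact key y

lemma G_lie {γ : g ≃ₗ[ℂ] g} (hγ : γ ∈ adjointGroup g) : ∀ x y, γ ⁅x, y⁆ = ⁅γ x, γ y⁆ := by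
  induction hγ using Subgroup.closure_induction with
  | mem u hu =>
    obtain ⟨x, hx, hu⟩ := hu
    obtain ⟨v, -, hv⟩ := exists_exp hx
    have : ∀ y, u y = v y := fun y => by
      rw [hv]; exact LinearMap.congr_fun hu y
    intro y z
    rw [this, this, this, LieEquiv.map_lie]
  | one => intro x y; rfl
  | mul a b _ _ ha hb => intro x y; simp only [LinearEquiv.mul_apply, ha, hb]
  | inv a _ ha =>
    intro x y
    apply a.injective
    rw [ha]
    have h : ∀ z, a (a⁻¹ z) = z := a.apply_symm_apply
    simp only [h]

lemma endExp_conj {V W : Type} [AddCommGroup V] [Module ℂ V] [FiniteDimensional ℂ V]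
    [AddCommGroup W] [Module ℂ W] [FiniteDimensional ℂ W] (φ : V ≃ₗ[ℂ] W) (A : Module.End ℂ V) (w : W) :
    endExp (φ.conj A) w = φ (endExp A (φ.symm w)) := by
  have hp : ∀ k : ℕ, (φ.conj A) ^ k = φ.conj (A ^ k) := by
    intro k
    induction k with
    | zero => ext; simp
    | succ k ih => rw [pow_succ, ih, pow_succ]; ext; simp [LinearEquiv.conj_apply]
  simp only [endExp, LinearMap.sum_apply, LinearMap.smul_apply, map_sum, map_smul, hp, φ.finrank_eq]
  rfl

lemma G_conj {L : Type} [LieRing L] [LieAlgebra ℂ L] [FiniteDimensional ℂ L] (φ : g ≃ₗ⁅ℂ⁆ L)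
    {γ : g ≃ₗ[ℂ] g} (hγ : γ ∈ adjointGroup g) :
    (φ.toLinearEquiv.symm.trans (γ.trans φ.toLinearEquiv)) ∈ adjointGroup L := by
  induction hγ using Subgroup.closure_induction with
  | mem u hu =>
    obtain ⟨x, hx, hu⟩ := hu
    have e : ad ℂ L (φ x) = φ.toLinearEquiv.conj (ad ℂ g x) := by
      ext y
      have hy : φ (φ.toLinearEquiv.symm y) = y := φ.toLinearEquiv.apply_symm_apply y
      simp only [ad_apply, LinearEquiv.conj_apply, LinearMap.comp_apply, LinearEquiv.coe_coe, LieEquiv.coe_toLinearEquiv,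
        LieEquiv.map_lie, hy]
    refine Subgroup.subset_closure ⟨φ x, ?_, ?_⟩
    · rw [e]
      exact hx.map φ.toLinearEquiv.conjRingEquiv
    · rw [e]
      ext y
      rw [endExp_conj, ← hu]
      rfl
  | one =>
    convert (adjointGroup L).one_mem
    ext y
    simp
  | mul a b _ _ ha hb =>
    convert (adjointGroup L).mul_mem ha hb
    ext y
    simp only [LinearEquiv.mul_apply, LinearEquiv.trans_apply, LinearEquiv.symm_apply_apply]
  | inv a _ ha =>
    exact (adjointGroup L).inv_mem ha

lemma exists_lieEquiv {γ : g ≃ₗ[ℂ] g} (hγ : γ ∈ adjointGroup g) :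
    ∃ u : g ≃ₗ⁅ℂ⁆ g, u.toLinearEquiv = γ :=
  ⟨{ γ with map_lie' := fun {x y} => G_lie hγ x y }, by ext; rfl⟩

lemma exists_Dexp (A : Module.End ℂ g) : ∃ D : Module.End ℂ g, ∀ (μ : ℂ) (v : g), A v = μ • v →
    D v = Complex.exp μ • v := by
  classical
  let S := A.finite_hasEigenvalue.toFinset
  let p := Lagrange.interpolate S id Complex.exp
  refine ⟨Polynomial.aeval A p, fun μ v hv => ?_⟩
  by_cases hv0 : v = 0
  · simp [hv0]
  have hvec : A.HasEigenvector μ v := ⟨Module.End.mem_eigenspace_iff.2 hv, hv0⟩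
  have hμ : μ ∈ S := by
    simp only [S, Set.Finite.mem_toFinset, Set.mem_setOf_eq]
    exact Module.End.hasEigenvalue_of_hasEigenvector hvec
  rw [Module.End.aeval_apply_of_hasEigenvector hvec]
  congr 1
  exact Lagrange.eval_interpolate_at_node _ (fun _ _ _ _ h => h) hμ

/-- `ad h` is diagonalizable. -/
def Diag (h : g) : Prop := ⨆ μ : ℂ, Module.End.eigenspace (ad ℂ g h) μ = ⊤

lemma Diag.ind {h : g} (hd : Diag h) {p : g → Prop} (h0 : p 0) (hadd : ∀ x y, p x → p y → p (x + y))
    (he : ∀ (μ : ℂ) v, ⁅h, v⁆ = μ • v → p v) (x : g) : p x := by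
  have hx : x ∈ ⨆ μ : ℂ, Module.End.eigenspace (ad ℂ g h) μ := by
    rw [show _ = _ from hd]; trivial
  exact Submodule.iSup_induction _ (motive := p) hx (fun μ v hv => he μ v (Module.End.mem_eigenspace_iff.1 hv)) h0 hadd

lemma exists_torus {h : g} (hd : Diag h) (s : ℂ) :
    ∃ u : g ≃ₗ⁅ℂ⁆ g, ∀ (μ : ℂ) (v : g), ⁅h, v⁆ = μ • v → u v = Complex.exp (s * μ) • v := by
  have key : ∀ s : ℂ, ∃ D : Module.End ℂ g, ∀ (μ : ℂ) (v : g), ⁅h, v⁆ = μ • v →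
      D v = Complex.exp (s * μ) • v := by
    intro s
    obtain ⟨D, hD⟩ := exists_Dexp (s • ad ℂ g h)
    exact ⟨D, fun μ v hv => hD _ v (by simp [hv, mul_smul])⟩
  obtain ⟨D, hD⟩ := key s
  obtain ⟨D', hD'⟩ := key (-s)
  refine ⟨{ D with
    invFun := D'
    left_inv := ?_
    right_inv := ?_
    map_lie' := ?_ }, ?_⟩
  · intro x y
    change D ⁅x, y⁆ = ⁅D x, D y⁆
    suffices H : ∀ y, D ⁅x, y⁆ = ⁅D x, D y⁆ from H y
    refine hd.ind (p := fun x => ∀ y, D ⁅x, y⁆ = ⁅D x, D y⁆) (by simp) (fun x y hx hy z => ?_) (fun μ v hv z => ?_) x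
    · rw [add_lie, map_add, hx, hy, map_add, add_lie]
    · refine hd.ind (p := fun z => D ⁅v, z⁆ = ⁅D v, D z⁆) (by simp) (fun x y hx hy => ?_) (fun ν w hw => ?_) z
      · rw [lie_add, map_add, hx, hy, map_add, lie_add]
      · have : ⁅h, ⁅v, w⁆⁆ = (μ + ν) • ⁅v, w⁆ := by
          rw [leibniz_lie, hv, hw, smul_lie, lie_smul, add_smul]
        rw [hD _ _ this, hD _ _ hv, hD _ _ hw, smul_lie, lie_smul, smul_smul, ← Complex.exp_add, mul_add]
  · intro x
    change D' (D x) = x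
    refine hd.ind (p := fun x => D' (D x) = x) (by simp) (fun x y hx hy => ?_) (fun μ v hv => ?_) x
    · rw [map_add, map_add, hx, hy]
    · rw [hD μ v hv, map_smul, hD' μ v hv, smul_smul, ← Complex.exp_add]
      simp
  · intro x
    change D (D' x) = x
    refine hd.ind (p := fun x => D (D' x) = x) (by simp) (fun x y hx hy => ?_) (fun μ v hv => ?_) x
    · rw [map_add, map_add, hx, hy]
    · rw [hD' μ v hv, map_smul, hD μ v hv, smul_smul, ← Complex.exp_add]
      simp
  · exact hD

/-- The reflection element. -/
lemma exists_refl {h e f : g} (ht : IsSl2Triple h e f) :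
    ∃ n ∈ adjointGroup g, ∀ (x : g) (a : ℂ), ⁅x, e⁆ = a • e → ⁅x, f⁆ = -(a • f) → n x = x - a • h := by
  have he : ⁅h, e⁆ = (2 : ℂ) • e := ht.lie_h_e_smul ℂ
  have hf : ⁅h, f⁆ = -((2 : ℂ) • f) := ht.lie_lie_smul_f ℂ
  have ne := ad_nil 2 two_ne_zero he
  have nf : IsNilpotent (ad ℂ g (-f)) := ad_nil (h := h) (-2) (by norm_num) (by rw [lie_neg, hf]; simp)
  obtain ⟨u, hu, hu'⟩ := exists_exp ne
  obtain ⟨v, hv, hv'⟩ := exists_exp nf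
  refine ⟨u.toLinearEquiv * v.toLinearEquiv * u.toLinearEquiv, mul_mem (mul_mem hu hv) hu, fun x a h1 h2 => ?_⟩
  have h1' : ⁅e, x⁆ = -(a • e) := by rw [← lie_skew, h1]
  have h2' : ⁅f, x⁆ = a • f := by rw [← lie_skew, h2, neg_neg]
  have he' : ⁅e, h⁆ = -((2 : ℂ) • e) := by rw [← lie_skew, he]
  have hfe : ⁅f, e⁆ = -h := by rw [← lie_skew, ht.lie_e_f]
  have hfh : ⁅f, h⁆ = (2 : ℂ) • f := by rw [← lie_skew, hf, neg_neg]
  have ux : u x = x - a • e := by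
    rw [hu', endExp_apply ne (m := 2) (by simp [pow_two, h1'])]
    simp [Finset.sum_range_succ, h1', sub_eq_add_neg]
  have ue : u e = e := by
    rw [hu', endExp_apply ne (m := 1) (by simp)]
    simp
  have uh : u h = h - (2 : ℂ) • e := by
    rw [hu', endExp_apply ne (m := 2) (by simp [pow_two, he'])]
    simp [Finset.sum_range_succ, he', sub_eq_add_neg]
  have vx : v x = x - a • f := by
    rw [hv', endExp_apply nf (m := 2) (by simp [pow_two, h2'])]
    simp [Finset.sum_range_succ, h2', sub_eq_add_neg]
  have ve : v e = e + h - f := by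
    rw [hv', endExp_apply nf (m := 3) (by simp [pow_succ, hfe, hfh])]
    simp [Finset.sum_range_succ, pow_two, hfe, hfh, sub_eq_add_neg, Nat.factorial]
  change u (v (u x)) = _
  have h3 : v (u x) = x - a • e - a • h := by
    rw [ux, map_sub, map_smul, vx, ve]; module
  rw [h3]
  simp only [map_sub, map_smul, ux, ue, uh]
  module

lemma torus_mem {h e f : g} (ht : IsSl2Triple h e f) (hd : Diag h) (s : ℂ) :
    ∃ u ∈ adjointGroup g, ∀ (μ : ℂ) (v : g), ⁅h, v⁆ = μ • v → u v = Complex.exp (s * μ) • v := by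
  obtain ⟨n, hn, hn'⟩ := exists_refl ht
  obtain ⟨D, hD⟩ := exists_torus hd (s / 2)
  have hnh : n h = -h := by
    rw [hn' h 2 (ht.lie_h_e_smul ℂ) (ht.lie_lie_smul_f ℂ)]; module
  refine ⟨_, mul_mem (G_conj D hn) (inv_mem hn), fun μ v hv => ?_⟩
  have hninv : ∀ z, n (n⁻¹ z) = z := n.apply_symm_apply
  have h1 : ⁅h, n⁻¹ v⁆ = (-μ) • n⁻¹ v := by
    apply n.injective
    rw [G_lie hn, hnh, map_smul, hninv, neg_lie, hv, neg_smul]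
  have h2 : D.symm (n⁻¹ v) = Complex.exp (s / 2 * μ) • n⁻¹ v := by
    apply D.toLinearEquiv.injective
    change D _ = D _
    rw [LieEquiv.apply_symm_apply, map_smul, hD _ _ h1, smul_smul, ← Complex.exp_add]
    simp
  change D (n (D.symm (n⁻¹ v))) = _
  rw [h2, map_smul, map_smul, hninv, hD _ _ hv, smul_smul, ← Complex.exp_add]
  congr 2
  ring

end Grp
end S5

namespace S5
open LieAlgebra LieModule

section Tor
variable {g : Type} [LieRing g] [LieAlgebra ℂ g] [FiniteDimensional ℂ g]
  {t : LieSubalgebra ℂ g}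

lemma diag_h {ι : Type} [Fintype ι] [DecidableEq ι] (b : LieAlgebra.Basis ι t) (j : ι) : Diag (b.h j) := by
  unfold Diag
  rw [_root_.eq_top_iff, ← iSup_V b]
  refine iSup_le fun l => ?_
  refine le_trans (V_le_W b l) ?_
  refine le_trans ?_ (le_iSup _ ((∑ i, l i * b.A i j : ℤ) : ℂ))
  intro x hx
  exact Module.End.mem_eigenspace_iff.2 (hx j)

lemma lieEquiv_ext_gen {S : Set g} (hS : LieSubalgebra.lieSpan ℂ g S = ⊤) {u T : g ≃ₗ[ℂ] g}
    (hu : ∀ x y, u ⁅x, y⁆ = ⁅u x, u y⁆) (hT : ∀ x y, T ⁅x, y⁆ = ⁅T x, T y⁆)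
    (h : ∀ x ∈ S, u x = T x) : u = T := by
  let E : LieSubalgebra ℂ g := { LinearMap.eqLocus (u : g →ₗ[ℂ] g) (T : g →ₗ[ℂ] g) with
    lie_mem' := by
      intro x y hx hy
      change u _ = T _ at hx hy
      change u _ = T _
      rw [hu, hT, hx, hy] }
  have hE : LieSubalgebra.lieSpan ℂ g S ≤ E := LieSubalgebra.lieSpan_le.2 fun x hx => h x hx
  rw [hS] at hE
  ext x
  exact hE (show x ∈ (⊤ : LieSubalgebra ℂ g) from trivial)

lemma basis_eigen {ι : Type} [Fintype ι] [DecidableEq ι] (b : LieAlgebra.Basis ι t) (i : ι) :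
    ∀ x : t, ∃ c : ℂ, ⁅(x : g), b.e i⁆ = c • b.e i := by
  rintro ⟨x, hx⟩
  have hx' : x ∈ Submodule.span ℂ (Set.range b.h) := by
    rw [← b.coe_cartan_eq_span]; exact hx
  induction hx' using Submodule.span_induction with
  | mem x h => obtain ⟨j, rfl⟩ := h; exact ⟨b.A i j, by rw [Int.cast_smul_eq_zsmul]; exact b.lie_h_e i j⟩
  | zero => exact ⟨0, by simp⟩
  | add x y hx' hy' h1 h2 =>
    rw [← b.coe_cartan_eq_span] at hx' hy'
    obtain ⟨c, hc⟩ := h1 hx'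
    obtain ⟨d, hd⟩ := h2 hy'
    exact ⟨c + d, by simp only at hc hd ⊢; rw [add_lie, hc, hd, add_smul]⟩
  | smul a x hx' h1 =>
    rw [← b.coe_cartan_eq_span] at hx'
    obtain ⟨c, hc⟩ := h1 hx'
    exact ⟨a * c, by simp only at hc ⊢; rw [smul_lie, hc, smul_smul]⟩

lemma e_line [IsKilling ℂ g] [t.IsCartanSubalgebra] {ι : Type} [Fintype ι] [DecidableEq ι] (b : LieAlgebra.Basis ι t) (i : ι) (y : g)
    (hy : ∀ (x : t) (c : ℂ), ⁅(x : g), b.e i⁆ = c • b.e i → ⁅(x : g), y⁆ = c • y) : ∃ c : ℂ, c • b.e i = y := by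
  choose χ hχ using basis_eigen b i
  have key : ∀ y : g, (∀ (x : t) (c : ℂ), ⁅(x : g), b.e i⁆ = c • b.e i → ⁅(x : g), y⁆ = c • y) →
      y ∈ rootSpace t χ := by
    intro y hy
    apply weightSpace_le_genWeightSpace g χ
    rw [mem_weightSpace]
    intro x
    exact hy x _ (hχ x)
  have he0 : b.e i ≠ 0 := (b.sl2 i).e_ne_zero
  have he := key (b.e i) (fun _ _ h => h)
  let α : Weight ℂ t g := ⟨χ, by
    intro h0
    unfold rootSpace at he
    rw [h0] at he
    exact he0 (by simpa using he)⟩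
  refine rootSpace_eq_smul α ?_ he he0 (key y hy)
  intro h0
  have h2 : b.h i ∈ t := by
    have : b.h i ∈ Submodule.span ℂ (Set.range b.h) := Submodule.subset_span ⟨i, rfl⟩
    rw [← b.coe_cartan_eq_span] at this
    exact this
  have h1 := hχ ⟨b.h i, h2⟩
  have h3 : χ ⟨b.h i, h2⟩ = 0 := congrFun h0 _
  rw [h3, (b.sl2 i).lie_h_e_smul ℂ, zero_smul] at h1
  simp [he0] at h1

theorem fix_mem [IsSimple ℂ g] [t.IsCartanSubalgebra] (T : g ≃ₗ[ℂ] g) (hT : ∀ x y, T ⁅x, y⁆ = ⁅T x, T y⁆)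
    (hfix : ∀ x ∈ t, T x = x) : T ∈ adjointGroup g := by
  obtain ⟨ι, _, _, b, hb⟩ := exists_good_basis t
  have hmem : ∀ i, b.h i ∈ t := by
    intro i
    have : b.h i ∈ Submodule.span ℂ (Set.range b.h) := Submodule.subset_span ⟨i, rfl⟩
    rw [← b.coe_cartan_eq_span] at this
    exact this
  have hTe : ∀ i, ∃ c : ℂ, c • b.e i = T (b.e i) := by
    intro i
    refine e_line b i _ fun x c hx => ?_
    rw [← hfix x x.2, ← hT, hx, map_smul]
  have hTf : ∀ i, ∃ c : ℂ, c • b.f i = T (b.f i) := by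
    intro i
    refine e_line b.symm i _ fun x c hx => ?_
    have hx : ⁅(x : g), b.f i⁆ = c • b.f i := hx
    rw [← hfix x x.2, ← hT, hx, map_smul]
  choose c hc using hTe
  choose d hd using hTf
  have hcd : ∀ i, c i * d i = 1 := by
    intro i
    have h1 := hT (b.e i) (b.f i)
    rw [(b.sl2 i).lie_e_f, hfix _ (hmem i), ← hc, ← hd, smul_lie, lie_smul, (b.sl2 i).lie_e_f, smul_smul] at h1
    have h0 := (b.sl2 i).h_ne_zero
    have h2 : (c i * d i - 1) • b.h i = 0 := by rw [sub_smul, ← h1, one_smul, sub_self]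
    exact sub_eq_zero.1 ((smul_eq_zero.1 h2).resolve_right h0)
  have hc0 : ∀ i, c i ≠ 0 := fun i h => by simpa [h] using hcd i
  -- solve
  obtain ⟨s, hs⟩ : ∃ s : ι → ℂ, ∀ i, ∑ j, s j * b.A i j = Complex.log (c i) := by
    have hdet : IsUnit (b.A.map (Int.cast : ℤ → ℂ)).det := by
      rw [isUnit_iff_ne_zero]
      have := b.nondegen.det_ne_zero
      rw [show b.A.map (Int.cast : ℤ → ℂ) = (Int.castRingHom ℂ).mapMatrix b.A from rfl, ← RingHom.map_det, eq_intCast]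
      exact_mod_cast this
    refine ⟨(b.A.map (Int.cast : ℤ → ℂ))⁻¹.mulVec (fun i => Complex.log (c i)), fun i => ?_⟩
    have h1 : (b.A.map (Int.cast : ℤ → ℂ)).mulVec ((b.A.map (Int.cast : ℤ → ℂ))⁻¹.mulVec (fun i => Complex.log (c i))) =
        fun i => Complex.log (c i) := by
      rw [Matrix.mulVec_mulVec, Matrix.mul_nonsing_inv _ hdet, Matrix.one_mulVec]
    have h2 := congrFun h1 i
    rw [← h2]
    conv_rhs => rw [Matrix.mulVec, dotProduct]
    refine Finset.sum_congr rfl fun j _ => ?_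
    rw [mul_comm]; rfl
  have hprod : ∀ S : Finset ι, ∃ u ∈ adjointGroup g, ∀ (m : ι → ℂ) (v : g), (∀ j, ⁅b.h j, v⁆ = m j • v) →
      u v = Complex.exp (∑ j ∈ S, s j * m j) • v := by
    intro S
    induction S using Finset.induction_on with
    | empty => exact ⟨1, one_mem _, fun m v _ => by simp⟩
    | insert a S ha ih =>
      obtain ⟨u, hu, hu'⟩ := ih
      obtain ⟨w, hw, hw'⟩ := torus_mem (b.sl2 a) (diag_h b a) (s a)
      refine ⟨w * u, mul_mem hw hu, fun m v hv => ?_⟩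
      rw [LinearEquiv.mul_apply, hu' m v hv, map_smul, hw' _ _ (hv a), smul_smul, ← Complex.exp_add,
        Finset.sum_insert ha, add_comm]
  obtain ⟨u, hu, hu'⟩ := hprod Finset.univ
  convert hu
  symm
  refine lieEquiv_ext_gen b.span_ef (G_lie hu) hT ?_
  rintro _ (⟨i, rfl⟩ | ⟨i, rfl⟩)
  · rw [hu' (fun j => (b.A i j : ℂ)) _ (fun j => by rw [b.lie_h_e, Int.cast_smul_eq_zsmul]), hs, Complex.exp_log (hc0 i), hc]
  · rw [hu' (fun j => -(b.A i j : ℂ)) _ (fun j => by rw [b.lie_h_f, neg_smul, neg_smul, Int.cast_smul_eq_zsmul])]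
    simp only [mul_neg, Finset.sum_neg_distrib]
    rw [hs, Complex.exp_neg, Complex.exp_log (hc0 i), ← hd]
    congr 1
    exact inv_eq_of_mul_eq_one_right (hcd i)

end Tor
end S5

namespace S5
open LieAlgebra LieModule

section Core
open Topology

/-- truncated exponential action -/
def tExp {V : Type} [AddCommGroup V] [Module ℂ V] (A : V →ₗ[ℂ] V) (m : ℕ) (s : ℂ) (v : V) : V :=
  ∑ k ∈ Finset.range (m + 2), (k.factorial : ℂ)⁻¹ • s ^ k • (A ^ k) v

/-- product of exponentials -/
def tF {V Φ : Type} [AddCommGroup V] [Module ℂ V] (A : Φ → V →ₗ[ℂ] V) (m : ℕ) (H : Submodule ℂ V) :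
    List Φ → (Φ → ℂ) × H → V
  | [], p => p.2
  | a :: l, p => tExp (A a) m (p.1 a) (tF A m H l p)

lemma tExp_zero {V : Type} [AddCommGroup V] [Module ℂ V] (A : V →ₗ[ℂ] V) (m : ℕ) (v : V) :
    tExp A m 0 v = v := by
  unfold tExp
  rw [Finset.sum_range_succ']
  simp

lemma tF_zero {V Φ : Type} [AddCommGroup V] [Module ℂ V] (A : Φ → V →ₗ[ℂ] V) (m : ℕ) (H : Submodule ℂ V)
    (l : List Φ) (h : H) : tF A m H l (0, h) = h := by
  induction l with
  | nil => rfl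
  | cons a l ih => simp only [tF, ih, Pi.zero_apply, tExp_zero]

variable {V : Type} [NormedAddCommGroup V] [NormedSpace ℂ V] [FiniteDimensional ℂ V]

lemma tExp_deriv {E : Type} [NormedAddCommGroup E] [NormedSpace ℂ E] (A : V →ₗ[ℂ] V) (m : ℕ)
    (c : E →L[ℂ] ℂ) (F : E → V) (F' : E →L[ℂ] V) (p : E) (hF : HasStrictFDerivAt F F' p) (hc : c p = 0) :
    HasStrictFDerivAt (fun q => tExp A m (c q) (F q)) (F' + c.smulRight (A (F p))) p := by
  let B : ℕ → V →L[ℂ] V := fun k => (A ^ k).toContinuousLinearMap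
  have key : ∀ k : ℕ, HasStrictFDerivAt (fun q => (k.factorial : ℂ)⁻¹ • c q ^ k • (B k) (F q))
      ((k.factorial : ℂ)⁻¹ • (c p ^ k • ((B k).comp F') + (((k : ℂ) * c p ^ (k - 1)) • c).smulRight (B k (F p)))) p := by
    intro k
    have h1 := ((c.hasStrictFDerivAt (x := p)).pow k).smul ((B k).hasStrictFDerivAt.comp p hF)
    have h2 := h1.const_smul ((k.factorial : ℂ)⁻¹)
    refine h2.congr_fderiv ?_
    ext v
    simp [mul_smul]
  have h3 := HasStrictFDerivAt.fun_sum (u := Finset.range (m + 2)) (fun k _ => key k)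
  refine h3.congr_fderiv ?_
  rw [Finset.sum_range_succ', Finset.sum_range_succ', Finset.sum_eq_zero]
  · ext v
    simp [hc, B]
    abel
  · intro k _
    ext v
    simp [hc]

lemma tF_deriv {Φ : Type} [Fintype Φ] (A : Φ → V →ₗ[ℂ] V) (m : ℕ) (H : Submodule ℂ V) (h0 : H) (l : List Φ) :
    ∃ D : (Φ → ℂ) × H →L[ℂ] V, HasStrictFDerivAt (tF A m H l) D (0, h0) ∧
      ∀ q, D q = q.2 + (l.map fun a => q.1 a • A a h0).sum := by
  induction l with
  | nil =>
    refine ⟨H.subtypeL.comp (ContinuousLinearMap.snd ℂ _ _), ?_, fun q => by simp⟩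
    exact (H.subtypeL.comp (ContinuousLinearMap.snd ℂ (Φ → ℂ) H)).hasStrictFDerivAt
  | cons a l ih =>
    obtain ⟨D, hD, hD'⟩ := ih
    let c : (Φ → ℂ) × H →L[ℂ] ℂ := (ContinuousLinearMap.proj a).comp (ContinuousLinearMap.fst ℂ _ _)
    refine ⟨_, tExp_deriv (A a) m c _ D (0, h0) hD (by simp [c]), fun q => ?_⟩
    rw [tF_zero]
    simp [c, hD']
    abel

lemma open_core {Φ : Type} [Fintype Φ] (A : Φ → V →ₗ[ℂ] V) (m : ℕ) (H : Submodule ℂ V) (h0 : H)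
    (hspan : ∀ P : Submodule ℂ V, H ≤ P → (∀ a, A a h0 ∈ P) → P = ⊤) (R : Set H) (hR : IsOpen R) (hR0 : h0 ∈ R)
    (S : Set V) (hS : ∀ h ∈ R, (h : V) ∈ S) (hS' : ∀ a s, ∀ v ∈ S, tExp (A a) m s v ∈ S) : S ∈ 𝓝 (h0 : V) := by
  classical
  obtain ⟨D, hD, hD'⟩ := tF_deriv A m H h0 Finset.univ.toList
  have hD2 : ∀ q, D q = q.2 + ∑ a, q.1 a • A a h0 := by
    intro q; rw [hD', Finset.sum_map_toList]
  have hr : D.range = ⊤ := by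
    apply hspan
    · intro h hh
      exact ⟨(0, ⟨h, hh⟩), by rw [ContinuousLinearMap.coe_coe, hD2]; simp⟩
    · intro a
      refine ⟨(Pi.single a 1, 0), ?_⟩
      rw [ContinuousLinearMap.coe_coe, hD2]
      simp [Pi.single_apply, ite_smul]
  have h1 := hD.map_nhds_eq_of_surj hr
  rw [tF_zero] at h1
  rw [← h1, Filter.mem_map]
  have h2 : (Set.univ ×ˢ R : Set ((Φ → ℂ) × H)) ∈ 𝓝 ((0 : Φ → ℂ), h0) :=
    (isOpen_univ.prod hR).mem_nhds ⟨trivial, hR0⟩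
  refine Filter.mem_of_superset h2 ?_
  rintro ⟨s, h⟩ ⟨-, hh⟩
  have : ∀ l : List Φ, tF A m H l (s, h) ∈ S := by
    intro l
    induction l with
    | nil => exact hS h hh
    | cons a l ih => exact hS' a _ _ ih
  exact this _

end Core
end S5

namespace S5
open LieAlgebra LieModule LieAlgebra.IsKilling

section Conj
open Topology
variable {g : Type} [LieRing g] [LieAlgebra ℂ g] [FiniteDimensional ℂ g]

/-- regular elements conjugate into `H` -/
def UH (H : LieSubalgebra ℂ g) : Set g :=
  {y | ∃ γ ∈ adjointGroup g, ∃ h ∈ H, LieSubalgebra.engel ℂ h = H ∧ y = γ h}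

lemma engel_G {γ : g ≃ₗ[ℂ] g} (hγ : γ ∈ adjointGroup g) (x y : g) :
    γ y ∈ LieSubalgebra.engel ℂ (γ x) ↔ y ∈ LieSubalgebra.engel ℂ x := by
  have key : ∀ n : ℕ, ((ad ℂ g (γ x)) ^ n) (γ y) = γ (((ad ℂ g x) ^ n) y) := by
    intro n
    induction n with
    | zero => simp
    | succ n ih => rw [pow_succ', Module.End.mul_apply, ih, pow_succ', Module.End.mul_apply, ad_apply, ad_apply, G_lie hγ]
  simp only [LieSubalgebra.mem_engel_iff, key, LinearEquiv.map_eq_zero_iff]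

lemma UH_conj {H H' : LieSubalgebra ℂ g} {y : g} (h1 : y ∈ UH H) (h2 : y ∈ UH H') :
    ∃ γ ∈ adjointGroup g, ∀ x, x ∈ H ↔ γ x ∈ H' := by
  obtain ⟨γ, hγ, h, hh, he, rfl⟩ := h1
  obtain ⟨γ', hγ', h', hh', he', heq⟩ := h2
  refine ⟨γ'⁻¹ * γ, mul_mem (inv_mem hγ') hγ, fun x => ?_⟩
  have hi : ∀ z, γ' (γ'⁻¹ z) = z := γ'.apply_symm_apply
  rw [← he, ← he', ← engel_G hγ, heq, ← engel_G hγ' h', LinearEquiv.mul_apply, hi]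

lemma UH_smul {H : LieSubalgebra ℂ g} {γ : g ≃ₗ[ℂ] g} (hγ : γ ∈ adjointGroup g) {y : g} (h1 : y ∈ UH H) :
    γ y ∈ UH H := by
  obtain ⟨γ', hγ', h, hh, he, rfl⟩ := h1
  exact ⟨γ * γ', mul_mem hγ hγ', h, hh, he, rfl⟩

variable [IsKilling ℂ g] (H : LieSubalgebra ℂ g) [H.IsCartanSubalgebra]

lemma engel_eq (h : H) (hh : ∀ α : Weight ℂ H g, α.IsNonZero → α h ≠ 0) :
    LieSubalgebra.engel ℂ (h : g) = H := by
  let A := ad ℂ g (h : g)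
  let R : Submodule ℂ g := ⨆ α : {α : Weight ℂ H g // α.IsNonZero}, (rootSpace H α.1).toSubmodule
  have h1 : H.toSubmodule ⊔ R = ⊤ := by
    have := iSup_genWeightSpace_eq_top' ℂ H g
    rw [_root_.eq_top_iff]
    rw [← LieSubmodule.toSubmodule_inj, LieSubmodule.iSup_toSubmodule, LieSubmodule.top_toSubmodule] at this
    rw [← this]
    refine iSup_le fun α => ?_
    by_cases hα : α.IsZero
    · refine le_trans ?_ le_sup_left
      rw [hα, ← LieSubalgebra.coe_toLieSubmodule, ← rootSpace_zero_eq ℂ g H]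
    · exact le_trans (le_iSup (fun α : {α : Weight ℂ H g // α.IsNonZero} => (rootSpace H α.1).toSubmodule) ⟨α, hα⟩) le_sup_right
  have h2 : H.toSubmodule ≤ A.maxGenEigenspace 0 := by
    intro x hx
    rw [Module.End.mem_maxGenEigenspace]
    refine ⟨1, ?_⟩
    have h3 : ⁅h, (⟨x, hx⟩ : H)⁆ = 0 := trivial_lie_zero _ _ _ _
    have := congrArg Subtype.val h3
    simpa [A] using this
  have h3 : R ≤ ⨆ (μ : ℂ) (_ : μ ≠ 0), A.maxGenEigenspace μ := by
    refine iSup_le ?_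
    rintro ⟨α, hα⟩ x hx
    refine Submodule.mem_iSup_of_mem (α h) (Submodule.mem_iSup_of_mem (hh α hα) ?_)
    rw [Module.End.mem_maxGenEigenspace]
    refine ⟨1, ?_⟩
    have : ⁅(h : g), x⁆ = α h • x := lie_eq_smul_of_mem_rootSpace hx h
    simp [A, this]
  have h4 := Module.End.independent_genEigenspace A ⊤ 0
  apply LieSubalgebra.toSubmodule_injective
  change A.maxGenEigenspace 0 = _
  refine le_antisymm (fun x hx => ?_) h2
  obtain ⟨y, hy, z, hz, rfl⟩ := Submodule.mem_sup.1 (show x ∈ H.toSubmodule ⊔ R by rw [h1]; trivial)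
  have hz' : z ∈ A.maxGenEigenspace 0 := by
    have := sub_mem hx (h2 hy)
    simpa using this
  have : z = 0 := Submodule.disjoint_def.1 h4 z hz' (h3 hz)
  rw [this, add_zero]
  exact hy

lemma exists_reg : ∃ h : H, ∀ α : Weight ℂ H g, α.IsNonZero → α h ≠ 0 := by
  obtain ⟨h, hh⟩ := Module.Dual.exists_forall_ne_zero_of_forall_exists (K := ℂ) (M := H)
    (fun α : {α : Weight ℂ H g // α.IsNonZero} => Weight.toLinear ℂ H g α.1) (by
      rintro ⟨α, hα⟩
      by_contra! hc
      exact hα (funext hc))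
  exact ⟨h, fun α hα => hh ⟨α, hα⟩⟩

lemma reg_of_engel (h : H) (he : LieSubalgebra.engel ℂ (h : g) = H) :
    ∀ α : Weight ℂ H g, α.IsNonZero → α h ≠ 0 := by
  intro α hα h0
  obtain ⟨x, hx, hx0⟩ := α.exists_ne_zero
  have h1 : ⁅(h : g), x⁆ = α h • x := lie_eq_smul_of_mem_rootSpace hx h
  have h2 : x ∈ H := by
    rw [← he, LieSubalgebra.mem_engel_iff]
    exact ⟨1, by simp [h1, h0]⟩
  apply hα
  funext k
  have h3 : ⁅(k : g), x⁆ = α k • x := lie_eq_smul_of_mem_rootSpace hx k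
  have h4 : ⁅k, (⟨x, h2⟩ : H)⁆ = 0 := trivial_lie_zero _ _ _ _
  have h5 := congrArg Subtype.val h4
  have h6 : ⁅(k : g), x⁆ = 0 := h5
  rw [h6] at h3
  exact (smul_eq_zero.1 h3.symm).resolve_right hx0

end Conj
end S5

namespace S5
open LieAlgebra LieModule LieAlgebra.IsKilling

section Conj
open Topology
variable {g : Type} [LieRing g] [LieAlgebra ℂ g] [FiniteDimensional ℂ g]

lemma tExp_mem {x : g} (hx : IsNilpotent (ad ℂ g x)) (s : ℂ) {m : ℕ} (hm : (ad ℂ g x) ^ m = 0) :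
    ∃ γ ∈ adjointGroup g, ∀ v, γ v = tExp (ad ℂ g x) m s v := by
  have e : ad ℂ g (s • x) = s • ad ℂ g x := by rw [map_smul]
  have hn : IsNilpotent (ad ℂ g (s • x)) := by
    rw [e]; exact ⟨m, by rw [smul_pow, hm, smul_zero]⟩
  obtain ⟨u, hu, hu'⟩ := exists_exp hn
  refine ⟨_, hu, fun v => ?_⟩
  have : (ad ℂ g (s • x) ^ (m + 2)) v = 0 := by
    rw [pow_add, e, smul_pow, hm]; simp
  change u v = _
  rw [hu', endExp_apply hn this, tExp]
  refine Finset.sum_congr rfl fun k _ => ?_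
  rw [e, smul_pow]
  rfl

lemma cartan_of_regular {x : g} (hx : IsRegular ℂ x) : (LieSubalgebra.engel ℂ x).IsCartanSubalgebra := by
  have h : (Module.finrank ℂ g : Cardinal) ≤ Cardinal.mk ℂ :=
    (Cardinal.natCast_lt_aleph0 (n := Module.finrank ℂ g)).le.trans <| Cardinal.infinite_iff.mp inferInstance
  refine ⟨?_, LieSubalgebra.normalizer_engel _ _⟩
  apply LieSubalgebra.isNilpotent_of_forall_le_engel
  intro y hy
  set Ex : {LieSubalgebra.engel ℂ z | z ∈ LieSubalgebra.engel ℂ x} :=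
    ⟨LieSubalgebra.engel ℂ x, x, LieSubalgebra.self_mem_engel _ _, rfl⟩
  suffices IsBot Ex from @this ⟨LieSubalgebra.engel ℂ y, y, hy, rfl⟩
  apply engel_isBot_of_isMin h (LieSubalgebra.engel ℂ x) Ex le_rfl
  rintro ⟨_, y, hy, rfl⟩ hyx
  suffices Module.finrank ℂ (LieSubalgebra.engel ℂ x) ≤ Module.finrank ℂ (LieSubalgebra.engel ℂ y) by
    suffices LieSubalgebra.engel ℂ y = LieSubalgebra.engel ℂ x from this.ge
    apply LieSubalgebra.toSubmodule_injective
    exact Submodule.eq_of_le_of_finrank_le hyx this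
  rw [(isRegular_iff_finrank_engel_eq_rank ℂ x).mp hx]
  apply rank_le_finrank_engel

lemma regular_finite (a d : g) (z0 : ℂ) (h : IsRegular ℂ (a + z0 • d)) :
    {z : ℂ | ¬ IsRegular ℂ (a + z • d)}.Finite := by
  classical
  let B := Module.finBasis ℂ g
  obtain ⟨q, hq⟩ : ∃ q : MvPolynomial (Fin (Module.finrank ℂ g)) ℂ, ∀ x : g, IsRegular ℂ x ↔
      MvPolynomial.eval (B.repr x) q ≠ 0 := ⟨_, fun x => isRegular_iff_coeff_polyCharpoly_rank_ne_zero ℂ B x⟩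
  let p : Polynomial ℂ := MvPolynomial.aeval (fun i => Polynomial.C (B.repr a i) + Polynomial.X * Polynomial.C (B.repr d i)) q
  have hp : ∀ z, p.eval z = MvPolynomial.eval (B.repr (a + z • d)) q := by
    intro z
    have : p.eval z = (Polynomial.aeval z) p := by simp
    rw [this, ← AlgHom.comp_apply, ← MvPolynomial.aeval_eq_eval, MvPolynomial.comp_aeval]
    congr 2
    funext i
    simp
    exact mul_comm _ _
  have hp0 : p ≠ 0 := by
    intro h0
    have := hp z0
    rw [h0] at this
    exact (hq _).1 h (by rw [← this]; simp)
  refine (Polynomial.finite_setOf_isRoot hp0).subset fun z hz => ?_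
  by_contra hc
  exact hz ((hq _).2 (by rw [← hp]; exact hc))

variable [IsKilling ℂ g] (H : LieSubalgebra ℂ g) [H.IsCartanSubalgebra]

lemma UH_nhds (a d : g) (z0 : ℂ) (hz : a + z0 • d ∈ UH H) : ∀ᶠ z in 𝓝 z0, a + z • d ∈ UH H := by
  classical
  let B := Module.finBasis ℂ g
  letI : NormedAddCommGroup g := NormedAddCommGroup.induced g (Fin (Module.finrank ℂ g) → ℂ) B.equivFun
    B.equivFun.injective
  letI : NormedSpace ℂ g := NormedSpace.induced ℂ g (Fin (Module.finrank ℂ g) → ℂ) B.equivFun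
  obtain ⟨γ, hγ, h, hh, he, heq⟩ := hz
  let Φ := {α : Weight ℂ H g // α.IsNonZero}
  haveI : Fintype Φ := Fintype.ofFinite _
  have hx : ∀ α : Φ, ∃ x ∈ rootSpace H α.1, x ≠ 0 := fun α => α.1.exists_ne_zero
  choose x hx hx0 using hx
  have hnil : ∀ α : Φ, IsNilpotent (ad ℂ g (x α)) := by
    intro α
    exact isNilpotent_toEnd_of_mem_rootSpace (M := g) H α.2 (hx α)
  choose m hm using hnil
  let M := Finset.univ.sup m
  have hM : ∀ α, (ad ℂ g (x α)) ^ M = 0 := fun α => pow_eq_zero_of_le (Finset.le_sup (Finset.mem_univ α)) (hm α)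
  have hreg := reg_of_engel H ⟨h, hh⟩ he
  have key : UH H ∈ 𝓝 h := by
    refine open_core (fun α : Φ => ad ℂ g (x α)) M H.toSubmodule ⟨h, hh⟩ ?_
      {k | ∀ α : Φ, α.1 k ≠ 0} ?_ ?_ (UH H) ?_ ?_
    · intro P hP hA
      have := iSup_genWeightSpace_eq_top' ℂ H g
      rw [← LieSubmodule.toSubmodule_inj, LieSubmodule.iSup_toSubmodule, LieSubmodule.top_toSubmodule] at this
      rw [_root_.eq_top_iff, ← this]
      refine iSup_le fun α => ?_
      by_cases hα : α.IsZero
      · refine le_trans ?_ hP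
        rw [hα, ← LieSubalgebra.coe_toLieSubmodule, ← rootSpace_zero_eq ℂ g H]
      · intro y hy
        obtain ⟨c, rfl⟩ := rootSpace_eq_smul α hα (hx ⟨α, hα⟩) (hx0 ⟨α, hα⟩) hy
        refine P.smul_mem _ ?_
        have h1 := hA ⟨α, hα⟩
        have h2 : ⁅h, x ⟨α, hα⟩⁆ = α ⟨h, hh⟩ • x ⟨α, hα⟩ := lie_eq_smul_of_mem_rootSpace (hx ⟨α, hα⟩) ⟨h, hh⟩
        have h3 : ⁅x ⟨α, hα⟩, h⁆ = -(α ⟨h, hh⟩ • x ⟨α, hα⟩) := by rw [← lie_skew, h2]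
        have h4 : -(α ⟨h, hh⟩ • x ⟨α, hα⟩) ∈ P := by rw [← h3]; exact h1
        exact (P.smul_mem_iff (hreg α hα)).1 (neg_mem_iff.1 h4)
    · rw [Set.setOf_forall]
      refine isOpen_iInter_of_finite fun α => ?_
      have hc : Continuous (Weight.toLinear ℂ H g α.1) := LinearMap.continuous_of_finiteDimensional _
      exact isOpen_ne.preimage hc
    · exact fun α => hreg α.1 α.2
    · intro k hk
      exact ⟨1, one_mem _, k, k.2, engel_eq H k (fun α hα => hk ⟨α, hα⟩), rfl⟩
    · intro α s v hv
      obtain ⟨u, hu, hu'⟩ := tExp_mem ⟨_, hM α⟩ s (hM α)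
      rw [← hu']
      exact UH_smul hu hv
  have hcont : Continuous (fun z : ℂ => γ⁻¹ (a + z • d)) := by
    have h1 : Continuous (γ⁻¹ : g ≃ₗ[ℂ] g) := LinearMap.continuous_of_finiteDimensional ((γ⁻¹ : g ≃ₗ[ℂ] g) : g →ₗ[ℂ] g)
    exact h1.comp (continuous_const.add (continuous_id.smul continuous_const))
  have h0 : γ⁻¹ (a + z0 • d) = h := by rw [heq]; exact γ.symm_apply_apply h
  have := hcont.tendsto z0
  simp only [h0] at this
  filter_upwards [this key] with z hz
  have h5 := UH_smul hγ hz
  rwa [show γ (γ⁻¹ (a + z • d)) = a + z • d from γ.apply_symm_apply _] at h5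

lemma UH_ne : ∃ a, a ∈ UH H := by
  obtain ⟨h, hh⟩ := exists_reg H
  exact ⟨h, 1, one_mem _, h, h.2, engel_eq H h hh, rfl⟩

lemma exists_regular_UH : ∃ a, a ∈ UH H ∧ IsRegular ℂ a := by
  obtain ⟨a, ha⟩ := UH_ne H
  obtain ⟨x, hx⟩ := LieAlgebra.exists_isRegular ℂ g
  have h1 := regular_finite a (x - a) 1 (by simpa using hx)
  have h2 := UH_nhds H a (x - a) 0 (by simpa using ha)
  have h3 : ∀ᶠ z in 𝓝[≠] (0 : ℂ), z ∉ {z : ℂ | ¬ IsRegular ℂ (a + z • (x - a))} := by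
    have := (h1.subset (Set.diff_subset (t := {0}))).isClosed.isOpen_compl.mem_nhds (x := (0 : ℂ)) (by simp)
    filter_upwards [nhdsWithin_le_nhds this, self_mem_nhdsWithin] with z hz hz0 hc
    exact hz ⟨hc, hz0⟩
  obtain ⟨z, hz1, hz2⟩ := ((Filter.Eventually.filter_mono (nhdsWithin_le_nhds (s := {0}ᶜ)) h2).and h3).exists
  exact ⟨_, hz1, not_not.1 hz2⟩

theorem cartan_conj (H' : LieSubalgebra ℂ g) [H'.IsCartanSubalgebra] :
    ∃ γ ∈ adjointGroup g, ∀ x, x ∈ H ↔ γ x ∈ H' := by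
  obtain ⟨a, ha, har⟩ := exists_regular_UH H
  obtain ⟨b, hb, hbr⟩ := exists_regular_UH H'
  let Z := {z : ℂ | ¬ IsRegular ℂ (a + z • (b - a))}
  have hZ : Z.Finite := regular_finite a (b - a) 0 (by simpa using har)
  have hconn : IsConnected Zᶜ := hZ.countable.isConnected_compl_of_one_lt_rank (by
    rw [Complex.rank_real_complex]; exact_mod_cast one_lt_two)
  by_contra hne
  let S1 : Set ℂ := {z | a + z • (b - a) ∈ UH H}
  let S2 : Set ℂ := {z | ∃ K : LieSubalgebra ℂ g, K.IsCartanSubalgebra ∧ (¬ ∃ γ ∈ adjointGroup g, ∀ x, x ∈ H ↔ γ x ∈ K) ∧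
    a + z • (b - a) ∈ UH K}
  have o1 : IsOpen S1 := isOpen_iff_mem_nhds.2 fun z hz => UH_nhds H _ _ _ hz
  have o2 : IsOpen S2 := isOpen_iff_mem_nhds.2 fun z ⟨K, hK, hK', hz⟩ => by
    filter_upwards [UH_nhds K _ _ _ hz] with w hw
    exact ⟨K, hK, hK', hw⟩
  have hcov : Zᶜ ⊆ S1 ∪ S2 := by
    intro z hz
    have hz : IsRegular ℂ (a + z • (b - a)) := not_not.1 hz
    have hc := cartan_of_regular hz
    have hm : a + z • (b - a) ∈ UH (LieSubalgebra.engel ℂ (a + z • (b - a))) :=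
      ⟨1, one_mem _, _, LieSubalgebra.self_mem_engel _ _, rfl, rfl⟩
    by_cases h : ∃ γ ∈ adjointGroup g, ∀ x, x ∈ H ↔ γ x ∈ LieSubalgebra.engel ℂ (a + z • (b - a))
    · left
      obtain ⟨γ, hγ, hγ'⟩ := h
      have hi : γ (γ⁻¹ (a + z • (b - a))) = a + z • (b - a) := γ.apply_symm_apply _
      refine ⟨γ, hγ, γ⁻¹ (a + z • (b - a)), (hγ' _).2 ?_, ?_, hi.symm⟩
      · rw [hi]; exact LieSubalgebra.self_mem_engel _ _
      · ext x
        rw [hγ', ← engel_G hγ, hi]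
    · right
      exact ⟨_, hc, h, hm⟩
  obtain ⟨z, -, h1, K, -, hK, h2⟩ := hconn.isPreconnected S1 S2 o1 o2 hcov
    ⟨0, by simpa [Z] using har, by simpa [S1] using ha⟩
    ⟨1, by simpa [Z] using hbr, H', inferInstance, hne, by simpa using hb⟩
  exact hK (UH_conj h1 h2)

end Conj
end S5

namespace S5
open LieAlgebra LieModule

section Back
variable {g : Type} [LieRing g] [LieAlgebra ℂ g] [FiniteDimensional ℂ g]

lemma cartan_of_abelian (K : LieSubalgebra ℂ g) (hab : ∀ x ∈ K, ∀ y ∈ K, ⁅x, y⁆ = 0)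
    (hn : ∀ x, (∀ y ∈ K, ⁅x, y⁆ ∈ K) → x ∈ K) : K.IsCartanSubalgebra where
  nilpotent := by
    have : IsLieAbelian K := ⟨fun x y => Subtype.ext (hab x x.2 y y.2)⟩
    infer_instance
  self_normalizing := by
    refine le_antisymm (fun x hx => hn x fun y hy => ?_) K.le_normalizer
    have := (LieSubalgebra.mem_normalizer_iff' K x).1 hx y hy
    rw [← lie_skew]
    exact neg_mem this

/-- transfer from a model -/
theorem back [IsSimple ℂ g] (t : LieSubalgebra ℂ g) [t.IsCartanSubalgebra] (ψ : g ≃ₗ⁅ℂ⁆ g)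
    (hψt : ∀ x ∈ t, ψ x = -x) {L : Type} [LieRing L] [LieAlgebra ℂ L] [FiniteDimensional ℂ L]
    (φ : g ≃ₗ⁅ℂ⁆ L) (H : LieSubalgebra ℂ L) (hab : ∀ x ∈ H, ∀ y ∈ H, ⁅x, y⁆ = 0)
    (hn : ∀ x, (∀ y ∈ H, ⁅x, y⁆ ∈ H) → x ∈ H) (w : L ≃ₗ[ℂ] L) (hw : w ∈ adjointGroup L)
    (hwH : ∀ x ∈ H, w x = -x) : ψ.toLinearEquiv ∈ adjointGroup g := by
  let K : LieSubalgebra ℂ g := H.comap φ.toLieHom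
  have hK : ∀ x, x ∈ K ↔ φ x ∈ H := fun x => Iff.rfl
  have hs : ∀ z, φ (φ.symm z) = z := fun z => φ.apply_symm_apply z
  have : K.IsCartanSubalgebra := cartan_of_abelian K
    (fun x hx y hy => by
      apply φ.toLinearEquiv.injective
      change φ _ = φ _
      rw [LieEquiv.map_lie, hab (φ x) hx (φ y) hy]
      exact (map_zero φ.toLinearEquiv).symm)
    (fun x hx => by
      rw [hK]
      refine hn _ fun y hy => ?_
      have := hx (φ.symm y) (by rw [hK, hs]; exact hy)
      rw [hK, LieEquiv.map_lie, hs] at this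
      exact this)
  obtain ⟨γ, hγ, hγ'⟩ := cartan_conj t K
  have hw' := G_conj φ.symm hw
  set w' := φ.symm.toLinearEquiv.symm.trans (w.trans φ.symm.toLinearEquiv) with hwd
  have hwK : ∀ x ∈ K, w' x = -x := by
    intro x hx
    change φ.symm (w (φ x)) = -x
    rw [hwH (φ x) hx]
    have : φ.symm.toLinearEquiv (-(φ x)) = -φ.symm.toLinearEquiv (φ x) := map_neg _ _
    refine this.trans ?_
    congr 1
    exact φ.symm_apply_apply x
  have hv : γ⁻¹ * w' * γ ∈ adjointGroup g := mul_mem (mul_mem (inv_mem hγ) hw') hγ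
  have hvt : ∀ x ∈ t, (γ⁻¹ * w' * γ) x = -x := by
    intro x hx
    change γ⁻¹ (w' (γ x)) = -x
    rw [hwK _ ((hγ' x).1 hx), map_neg]
    congr 1
    exact γ.symm_apply_apply x
  have hT := fix_mem (t := t) (ψ.toLinearEquiv * (γ⁻¹ * w' * γ))
    (fun x y => by
      change ψ ((γ⁻¹ * w' * γ) _) = ⁅ψ ((γ⁻¹ * w' * γ) _), ψ ((γ⁻¹ * w' * γ) _)⁆
      rw [G_lie hv, LieEquiv.map_lie])
    (fun x hx => by
      change ψ ((γ⁻¹ * w' * γ) _) = _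
      rw [hvt x hx, hψt _ (neg_mem hx), neg_neg])
  have := mul_mem hT (inv_mem hv)
  rwa [mul_inv_cancel_right] at this

end Back

section Rho
open Matrix NormedSpace
open scoped Matrix.Norms.Operator
variable {N : Type} [Fintype N] [DecidableEq N]

lemma exp_conj_of (X : Matrix N N ℂ) (Y : ℕ → Matrix N N ℂ) (hY : ∀ k, X * Y k - Y k * X = Y (k + 1)) (m : ℕ)
    (hm : Y m = 0) :
    ∑ k ∈ Finset.range m, ((k.factorial : ℂ)⁻¹) • Y k = exp X * Y 0 * exp (-X) := by
  let y : ℂ → Matrix N N ℂ := fun s => ∑ k ∈ Finset.range m, ((k.factorial : ℂ)⁻¹ * s ^ k) • Y k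
  have hy : ∀ s, HasDerivAt y (X * y s - y s * X) s := by
    intro s
    have h1 : HasDerivAt y (∑ k ∈ Finset.range m, ((k.factorial : ℂ)⁻¹ * (k * s ^ (k - 1))) • Y k) s := by
      refine HasDerivAt.fun_sum fun k _ => ?_
      exact ((hasDerivAt_pow k s).const_mul _).smul_const _
    convert h1 using 1
    simp only [y, Finset.mul_sum, Finset.sum_mul, ← Finset.sum_sub_distrib, mul_smul_comm, smul_mul_assoc, ← smul_sub, hY]
    cases m with
    | zero => simp
    | succ m =>
      rw [Finset.sum_range_succ, hm, Finset.sum_range_succ' (n := m)]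
      simp only [smul_zero, add_zero, Nat.cast_zero, zero_mul, mul_zero, zero_smul]
      refine Finset.sum_congr rfl fun k _ => ?_
      congr 1
      rw [Nat.factorial_succ]
      have : ((k : ℂ) + 1) ≠ 0 := by exact_mod_cast Nat.succ_ne_zero k
      push_cast
      field_simp
  let F : ℂ → Matrix N N ℂ := fun s => exp (s • (-X)) * y s * exp (s • X)
  have hF : ∀ s, HasDerivAt F 0 s := by
    intro s
    have h1 := hasDerivAt_exp_smul_const (𝕂 := ℂ) (-X) s
    have h2 := hasDerivAt_exp_smul_const' (𝕂 := ℂ) X s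
    have h3 := (h1.mul (hy s)).mul h2
    have e : (exp (s • -X) * -X * y s + exp (s • -X) * (X * y s - y s * X)) * exp (s • X) +
      exp (s • -X) * y s * (X * exp (s • X)) = 0 := by noncomm_ring
    exact e ▸ h3
  have hc := is_const_of_deriv_eq_zero (fun s => (hF s).differentiableAt) (fun s => (hF s).deriv) 1 0
  have y0 : y 0 = if 0 < m then Y 0 else 0 := by
    cases m with
    | zero => simp [y]
    | succ m => simp [y, Finset.sum_range_succ']
  have y0' : y 0 = Y 0 := by
    rw [y0]; split_ifs with h
    · rfl
    · rw [← hm]; congr 1; omega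
  have y1 : y 1 = ∑ k ∈ Finset.range m, ((k.factorial : ℂ)⁻¹) • Y k := by simp [y]
  simp only [F, one_smul, zero_smul, exp_zero, one_mul, mul_one, y0', y1] at hc
  have e1 : exp X * exp (-X) = 1 := by
    rw [← Matrix.exp_add_of_commute _ _ (Commute.neg_right (Commute.refl X))]; simp
  rw [← hc]
  calc _ = (exp X * exp (-X)) * (∑ k ∈ Finset.range m, ((k.factorial : ℂ)⁻¹) • Y k) * (exp X * exp (-X)) := by
        rw [e1, one_mul, mul_one]
    _ = _ := by noncomm_ring

end Rho
end S5

namespace S5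
open LieAlgebra LieModule

attribute [local instance] LieRing.ofAssociativeRing

section Rho
open Matrix NormedSpace
variable {g : Type} [LieRing g] [LieAlgebra ℂ g] [FiniteDimensional ℂ g]
variable {N : Type} [Fintype N] [DecidableEq N]

lemma exp_mul_exp_neg (X : Matrix N N ℂ) : exp X * exp (-X) = 1 := by
  rw [← Matrix.exp_add_of_commute _ _ (Commute.neg_right (Commute.refl X))]; simp

lemma exp_neg_mul_exp (X : Matrix N N ℂ) : exp (-X) * exp X = 1 := by
  rw [← Matrix.exp_add_of_commute _ _ (Commute.neg_left (Commute.refl X))]; simp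

/-- exponential as a unit -/
def uexp (X : Matrix N N ℂ) : (Matrix N N ℂ)ˣ := ⟨exp X, exp (-X), exp_mul_exp_neg X, exp_neg_mul_exp X⟩

theorem rho_conj (ρ : g →ₗ⁅ℂ⁆ Matrix N N ℂ) {γ : g ≃ₗ[ℂ] g} (hγ : γ ∈ adjointGroup g) :
    ∃ P ∈ Subgroup.closure (Set.range fun x => uexp (ρ x)), ∀ y,
      ρ (γ y) = (P : Matrix N N ℂ) * ρ y * (P⁻¹ : (Matrix N N ℂ)ˣ) := by
  induction hγ using Subgroup.closure_induction with
  | mem u hu =>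
    obtain ⟨x, hx, hu⟩ := hu
    refine ⟨uexp (ρ x), Subgroup.subset_closure ⟨x, rfl⟩, fun y => ?_⟩
    have h1 : u y = endExp (ad ℂ g x) y := by rw [← hu]; rfl
    rw [h1]
    obtain ⟨m, hm⟩ := hx
    have hm' : (ad ℂ g x ^ m) y = 0 := by rw [hm]; rfl
    rw [endExp_apply ⟨m, hm⟩ hm', map_sum]
    have := exp_conj_of (ρ x) (fun k => ρ ((ad ℂ g x ^ k) y)) (fun k => by
      rw [pow_succ', Module.End.mul_apply, ad_apply, LieHom.map_lie]; rfl) m (by rw [hm', map_zero])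
    simp only [map_smul]
    exact this
  | one => exact ⟨1, one_mem _, fun y => by simp⟩
  | mul a b _ _ ha hb =>
    obtain ⟨P, hP, h1⟩ := ha
    obtain ⟨Q, hQ, h2⟩ := hb
    refine ⟨P * Q, mul_mem hP hQ, fun y => ?_⟩
    rw [LinearEquiv.mul_apply, h1, h2]
    simp only [_root_.mul_inv_rev, Units.val_mul, mul_assoc]
  | inv a _ ha =>
    obtain ⟨P, hP, h1⟩ := ha
    refine ⟨P⁻¹, inv_mem hP, fun y => ?_⟩
    have h2 : a (a⁻¹ y) = y := a.apply_symm_apply y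
    have h3 := h1 (a⁻¹ y)
    rw [h2] at h3
    rw [h3]
    simp [mul_assoc]

theorem trace_excl (ρ : g →ₗ⁅ℂ⁆ Matrix N N ℂ) {γ : g ≃ₗ[ℂ] g} (hγ : γ ∈ adjointGroup g) {y : g}
    (hy : γ y = -y) {k : ℕ} (hk : Odd k) : (ρ y ^ k).trace = 0 := by
  obtain ⟨P, -, hP⟩ := rho_conj ρ hγ
  have h1 := hP y
  rw [hy, map_neg] at h1
  have h2 : (-(ρ y)) ^ k = (P : Matrix N N ℂ) * (ρ y) ^ k * (P⁻¹ : (Matrix N N ℂ)ˣ) := by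
    rw [h1, ← Units.conj_pow]
  rw [hk.neg_pow] at h2
  have h3 := congrArg Matrix.trace h2
  rw [Matrix.trace_neg, Matrix.trace_mul_comm, ← mul_assoc, Units.inv_mul, one_mul] at h3
  linear_combination (-1/2) * h3

end Rho

section Minu
variable {ι N : Type} [Fintype ι] [DecidableEq ι] [Fintype N] [DecidableEq N]

/-- weight of a vertex -/
def mwt (u : ι → (N ≃. N)) (v : N) (i : ι) : ℤ :=
  (if (u i v).isSome then 1 else 0) - (if ((u i).symm v).isSome then 1 else 0)

structure Minu (CM : Matrix ι ι ℤ) (u : ι → (N ≃. N)) : Prop where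
  wt : ∀ i j v w, u j v = some w → mwt u v i - mwt u w i = CM i j
  ef : ∀ i j, i ≠ j → (u i).trans (u j).symm = (u j).symm.trans (u i)
  comm : ∀ i j, CM i j = 0 → (u i).trans (u j) = (u j).trans (u i)
  sq : ∀ i, (u i).trans (u i) = ⊥
  tri : ∀ i j, i ≠ j → ((u i).trans (u j)).trans (u i) = ⊥
  cm : ∀ i j, i ≠ j → CM i j = 0 ∨ CM i j = -1
  cd : ∀ i, CM i i = 2

/-- matrix of a partial equivalence -/
def mE (u : N ≃. N) : Matrix N N ℂ := u.toMatrix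

lemma mE_mul (u v : N ≃. N) : mE u * mE v = mE (u.trans v) := (PEquiv.toMatrix_trans u v).symm

def mH (u : ι → (N ≃. N)) (i : ι) : Matrix N N ℂ := Matrix.diagonal fun v => (mwt u v i : ℂ)

lemma mE_trans_symm (u : N ≃. N) : mE (u.trans u.symm) = Matrix.diagonal fun v => if (u v).isSome then 1 else 0 := by
  ext v w
  rw [PEquiv.self_trans_symm]
  simp only [mE, PEquiv.toMatrix_apply, Matrix.diagonal_apply, Option.mem_def, PEquiv.ofSet_eq_some_iff, Set.mem_setOf_eq]
  by_cases h : v = w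
  · subst h; simp
  · simp [h, Ne.symm h]

lemma Minu.half {CM : Matrix ι ι ℤ} (u : ι → (N ≃. N))
    (comm : ∀ i j, CM i j = 0 → (u i).trans (u j) = (u j).trans (u i))
    (sq : ∀ i, (u i).trans (u i) = ⊥)
    (tri : ∀ i j, i ≠ j → ((u i).trans (u j)).trans (u i) = ⊥)
    (cm : ∀ i j, i ≠ j → CM i j = 0 ∨ CM i j = -1) (i j) :
    (LieAlgebra.ad ℂ (Matrix N N ℂ) (mE (u i)) ^ (-CM i j).toNat) ⁅mE (u i), mE (u j)⁆ = 0 := by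
  have hbot : mE (⊥ : N ≃. N) = 0 := PEquiv.toMatrix_bot
  by_cases hij : i = j
  · subst hij; simp
  · rcases cm i j hij with h | h
    · rw [h]
      simp only [neg_zero, Int.toNat_zero, pow_zero, Module.End.one_apply, LieRing.of_associative_ring_bracket,
        mE_mul, comm i j h, sub_self]
    · rw [h]
      have h1 : mE (u i) * mE (u i) = 0 := by rw [mE_mul, sq, hbot]
      have h2 : mE (u i) * mE (u j) * mE (u i) = 0 := by rw [mE_mul, mE_mul, tri i j hij, hbot]
      simp only [neg_neg, Int.toNat_one, pow_one, LieAlgebra.ad_apply, LieRing.of_associative_ring_bracket]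
      calc _ = (mE (u i) * mE (u i)) * mE (u j) - 2 • (mE (u i) * mE (u j) * mE (u i)) + mE (u j) * (mE (u i) * mE (u i)) := by
            noncomm_ring
        _ = 0 := by rw [h1, h2]; simp

lemma Minu.srel {CM : Matrix ι ι ℤ} {u : ι → (N ≃. N)} (hu : Minu CM u) :
    SRel CM (mH u) (fun i => mE (u i)) (fun i => mE (u i).symm) where
  hh i j := by
    rw [LieRing.of_associative_ring_bracket, mH, mH, Matrix.diagonal_mul_diagonal, Matrix.diagonal_mul_diagonal, sub_eq_zero]
    congr 1; ext v; ring
  ef i := by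
    have h2 := mE_trans_symm (u i).symm
    rw [PEquiv.symm_symm] at h2
    rw [LieRing.of_associative_ring_bracket, mE_mul, mE_mul, mE_trans_symm, h2, mH, Matrix.diagonal_sub]
    congr 1; ext v
    simp [mwt]
  ef_ne i j hij := by
    rw [LieRing.of_associative_ring_bracket, mE_mul, mE_mul, hu.ef i j hij, sub_self]
  he i j := by
    rw [LieRing.of_associative_ring_bracket, mH]
    ext v w
    simp only [Matrix.sub_apply, Matrix.diagonal_mul, Matrix.mul_diagonal, Matrix.smul_apply, mE, PEquiv.toMatrix_apply,
      Option.mem_def]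
    split_ifs with h
    · rw [← hu.wt i j v w h]; simp
    · simp
  hf i j := by
    rw [LieRing.of_associative_ring_bracket, mH]
    ext w v
    simp only [Matrix.sub_apply, Matrix.diagonal_mul, Matrix.mul_diagonal, Matrix.neg_apply, Matrix.smul_apply, mE, PEquiv.toMatrix_apply,
      Option.mem_def]
    split_ifs with h
    · rw [← hu.wt i j v w ((PEquiv.eq_some_iff _).1 h)]; simp
    · simp
  ade i j := Minu.half u hu.comm hu.sq hu.tri hu.cm i j
  adf i j := Minu.half (fun i => (u i).symm)
    (fun i j h => by
      have := congrArg PEquiv.symm (hu.comm i j h)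
      rw [PEquiv.symm_trans_rev, PEquiv.symm_trans_rev] at this
      exact this.symm)
    (fun i => by
      have := congrArg PEquiv.symm (hu.sq i)
      rw [PEquiv.symm_trans_rev] at this
      simpa using this)
    (fun i j h => by
      have := congrArg PEquiv.symm (hu.tri i j h)
      rw [PEquiv.symm_trans_rev, PEquiv.symm_trans_rev, ← PEquiv.trans_assoc] at this
      simpa using this) hu.cm i j

theorem minu_excl {g : Type} [LieRing g] [LieAlgebra ℂ g] [FiniteDimensional ℂ g] {t : LieSubalgebra ℂ g}
    (b : LieAlgebra.Basis ι t) (hP : PosM b.A) {γ : g ≃ₗ[ℂ] g} (hγ : γ ∈ adjointGroup g) (hγt : ∀ x ∈ t, γ x = -x)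
    {u : ι → (N ≃. N)} (hu : Minu b.A.transpose u) {k : ℕ} (hk : Odd k) (c : ι → ℤ) :
    ∑ v, (∑ i, c i * mwt u v i) ^ k = 0 := by
  obtain ⟨φ, hH, -, -⟩ := serre_equiv b hP
  obtain ⟨ρ, rH, -, -⟩ := exists_sLift hu.srel
  let ρ' : g →ₗ⁅ℂ⁆ Matrix N N ℂ := ρ.comp φ.symm.toLieHom
  have hr : ∀ i, ρ' (b.h i) = mH u i := by
    intro i
    change ρ (φ.symm (b.h i)) = _
    rw [← hH, φ.symm_apply_apply, rH]
  have hht : ∀ i, b.h i ∈ t := fun i => b.cartan_eq_lieSpan.ge (LieSubalgebra.subset_lieSpan ⟨i, rfl⟩)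
  let y := ∑ i, (c i : ℂ) • b.h i
  have hy : y ∈ t := sum_mem fun i _ => t.smul_mem _ (hht i)
  have := trace_excl ρ' hγ (hγt y hy) hk
  have e : ρ' y = Matrix.diagonal fun v => ((∑ i, c i * mwt u v i : ℤ) : ℂ) := by
    simp only [y, map_sum, map_smul, hr, mH]
    ext v w
    simp only [Matrix.sum_apply, Matrix.smul_apply, Matrix.diagonal_apply]
    split_ifs with h
    · simp
    · simp
  rw [e, Matrix.diagonal_pow, Matrix.trace_diagonal] at this
  simp only [Pi.pow_apply] at this
  exact_mod_cast this

end Minu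
end S5

namespace S5
open LieAlgebra LieModule

section AE

/-- the natural representation of type A -/
def uA (n : ℕ) (i : Fin n) : Fin (n + 1) ≃. Fin (n + 1) := PEquiv.single i.castSucc i.succ

lemma uA_apply (n : ℕ) (i : Fin n) (v : Fin (n + 1)) : uA n i v = if v = i.castSucc then some i.succ else none := by
  unfold uA
  split_ifs with h
  · rw [h, PEquiv.single_apply]
  · rw [PEquiv.single_apply_of_ne (Ne.symm h)]

lemma uA_symm_apply (n : ℕ) (i : Fin n) (v : Fin (n + 1)) :
    (uA n i).symm v = if v = i.succ then some i.castSucc else none := by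
  unfold uA
  rw [PEquiv.symm_single]
  split_ifs with h
  · rw [h, PEquiv.single_apply]
  · rw [PEquiv.single_apply_of_ne (Ne.symm h)]

lemma mwt_uA (n : ℕ) (i : Fin n) (v : Fin (n + 1)) :
    mwt (uA n) v i = (if v.val = i.val then 1 else 0) - (if v.val = i.val + 1 then 1 else 0) := by
  unfold mwt
  rw [uA_apply, uA_symm_apply]
  simp only [Fin.ext_iff, Fin.val_castSucc, Fin.val_succ]
  split_ifs <;> simp_all

lemma minu_A (n : ℕ) : Minu (CartanMatrix.A n).transpose (uA n) where
  wt i j v w h := by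
    rw [uA_apply] at h
    split_ifs at h with h1
    · simp only [Option.some.injEq] at h
      subst h h1
      rw [mwt_uA, mwt_uA]
      simp only [CartanMatrix.A, Matrix.transpose_apply, Matrix.of_apply, Fin.ext_iff, Fin.val_castSucc, Fin.val_succ]
      split_ifs <;> omega
  ef i j hij := by
    ext v w
    simp only [PEquiv.trans_eq_some, uA_apply, uA_symm_apply]
    constructor
    · rintro ⟨c, h1, h2⟩
      split_ifs at h1 h2 with h3 h4
      simp only [Option.some.injEq] at h1 h2
      exact absurd (Fin.succ_injective _ (h1.trans h4)) hij
    · rintro ⟨c, h1, h2⟩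
      split_ifs at h1 h2 with h3 h4
      simp only [Option.some.injEq] at h1 h2
      exact absurd (Fin.castSucc_injective _ (h1.trans h4)).symm hij
  comm i j h := by
    simp only [CartanMatrix.A, Matrix.transpose_apply, Matrix.of_apply, Fin.ext_iff] at h
    ext v w
    simp only [PEquiv.trans_eq_some, uA_apply]
    constructor
    · rintro ⟨c, h1, h2⟩
      split_ifs at h1 h2 with h3 h4
      simp only [Option.some.injEq, Fin.ext_iff, Fin.val_castSucc, Fin.val_succ] at *
      split_ifs at h <;> omega
    · rintro ⟨c, h1, h2⟩
      split_ifs at h1 h2 with h3 h4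
      simp only [Option.some.injEq, Fin.ext_iff, Fin.val_castSucc, Fin.val_succ] at *
      split_ifs at h <;> omega
  sq i := by
    ext v w
    simp only [PEquiv.trans_eq_some, uA_apply, PEquiv.bot_apply]
    constructor
    · rintro ⟨c, h1, h2⟩
      split_ifs at h1 h2 with h3 h4
      simp only [Option.some.injEq, Fin.ext_iff, Fin.val_castSucc, Fin.val_succ] at *
      omega
    · intro h; simp at h
  tri i j hij := by
    ext v w
    simp only [PEquiv.trans_eq_some, uA_apply, PEquiv.bot_apply]
    constructor
    · rintro ⟨c, ⟨d, h0, h1⟩, h2⟩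
      split_ifs at h0 h1 h2 with h3 h4 h5
      simp only [Option.some.injEq, Fin.ext_iff, Fin.val_castSucc, Fin.val_succ] at *
      omega
    · intro h; simp at h
  cm i j hij := by
    simp only [CartanMatrix.A, Matrix.transpose_apply, Matrix.of_apply]
    rw [if_neg (Ne.symm hij)]
    split_ifs <;> simp
  cd i := by simp [CartanMatrix.A]

lemma A_excl (n : ℕ) {g : Type} [LieRing g] [LieAlgebra ℂ g] [FiniteDimensional ℂ g] {t : LieSubalgebra ℂ g}
    (b : LieAlgebra.Basis (Fin n) t) (hP : PosM b.A) (hA : b.A = CartanMatrix.A n) {γ : g ≃ₗ[ℂ] g}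
    (hγ : γ ∈ adjointGroup g) (hγt : ∀ x ∈ t, γ x = -x) : n ≤ 1 := by
  by_contra hn
  obtain ⟨m, rfl⟩ : ∃ m, n = m + 2 := ⟨n - 2, by omega⟩
  have hu := minu_A (m + 2)
  rw [← hA] at hu
  have h3 : Odd 3 := by decide
  have := minu_excl b hP hγ hγt hu h3 (fun i => if i.val = 0 then 1 else if i.val = 1 then 2 else 0)
  rw [Fin.sum_univ_succ, Fin.sum_univ_succ, Fin.sum_univ_succ] at this
  simp only [mwt_uA, Fin.sum_univ_succ (n := m + 1), Fin.sum_univ_succ (n := m)] at this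
  simp [Nat.mod_eq_of_lt (show 2 < m + 2 + 1 by omega)] at this

/-- tables of the 27-dimensional representation -/
def upT : List (List ℕ) := [
  [1, 27, 27, 27, 27, 27, 27, 27, 27, 27, 12, 27, 27, 15, 27, 27, 17, 27, 19, 27, 21, 27, 27, 27, 27, 27, 27],
  [27, 27, 27, 4, 27, 6, 27, 9, 27, 27, 27, 27, 27, 27, 27, 27, 27, 27, 20, 21, 27, 27, 23, 27, 27, 27, 27],
  [27, 2, 27, 27, 27, 27, 27, 27, 10, 27, 27, 13, 27, 27, 16, 27, 27, 27, 27, 22, 27, 23, 27, 27, 27, 27, 27],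
  [27, 27, 3, 27, 27, 27, 8, 27, 27, 11, 27, 27, 27, 27, 27, 27, 18, 19, 27, 27, 27, 27, 27, 24, 27, 27, 27],
  [27, 27, 27, 5, 6, 27, 27, 27, 27, 27, 27, 14, 27, 16, 27, 17, 27, 27, 27, 27, 27, 27, 27, 27, 25, 27, 27],
  [27, 27, 27, 27, 27, 7, 9, 27, 11, 27, 13, 27, 15, 27, 27, 27, 27, 27, 27, 27, 27, 27, 27, 27, 27, 26, 27]]
def dnT : List (List ℕ) := [
  [27, 0, 27, 27, 27, 27, 27, 27, 27, 27, 27, 27, 10, 27, 27, 13, 27, 16, 27, 18, 27, 20, 27, 27, 27, 27, 27],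
  [27, 27, 27, 27, 3, 27, 5, 27, 27, 7, 27, 27, 27, 27, 27, 27, 27, 27, 27, 27, 18, 19, 27, 22, 27, 27, 27],
  [27, 27, 1, 27, 27, 27, 27, 27, 27, 27, 8, 27, 27, 11, 27, 27, 14, 27, 27, 27, 27, 27, 19, 21, 27, 27, 27],
  [27, 27, 27, 2, 27, 27, 27, 27, 6, 27, 27, 9, 27, 27, 27, 27, 27, 27, 16, 17, 27, 27, 27, 27, 23, 27, 27],
  [27, 27, 27, 27, 27, 3, 4, 27, 27, 27, 27, 27, 27, 27, 11, 27, 13, 15, 27, 27, 27, 27, 27, 27, 27, 24, 27],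
  [27, 27, 27, 27, 27, 27, 27, 5, 27, 6, 27, 8, 27, 10, 27, 12, 27, 27, 27, 27, 27, 27, 27, 27, 27, 27, 25]]

def lk (T : List (List ℕ)) (i : Fin 6) (v : Fin 27) : Option (Fin 27) :=
  let k := (T.getD i.val []).getD v.val 27
  if h : k < 27 then some ⟨k, h⟩ else none

def uE (i : Fin 6) : Fin 27 ≃. Fin 27 where
  toFun := lk upT i
  invFun := lk dnT i
  inv := by revert i; decide +kernel

lemma uE_apply (i v) : uE i v = lk upT i v := rfl
lemma uE_symm_apply (i v) : (uE i).symm v = lk dnT i v := rfl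

lemma minu_E : Minu (CartanMatrix.E₆).transpose uE where
  wt := by simp only [mwt, uE_apply, uE_symm_apply]; decide +kernel
  ef := by
    intro i j hij; ext1 v; revert i j v
    change ∀ i j, i ≠ j → ∀ v, (lk upT i v).bind (lk dnT j) = (lk dnT j v).bind (lk upT i)
    decide +kernel
  comm := by
    intro i j hij; ext1 v; revert i j v
    change ∀ i j, CartanMatrix.E₆ j i = 0 → ∀ v, (lk upT i v).bind (lk upT j) = (lk upT j v).bind (lk upT i)
    decide +kernel
  sq := by
    intro i; ext1 v; revert i v
    change ∀ i v, (lk upT i v).bind (lk upT i) = none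
    decide +kernel
  tri := by
    intro i j hij; ext1 v; revert i j v
    change ∀ i j, i ≠ j → ∀ v, ((lk upT i v).bind (lk upT j)).bind (lk upT i) = none
    decide +kernel
  cm := by
    change ∀ i j, i ≠ j → CartanMatrix.E₆ j i = 0 ∨ CartanMatrix.E₆ j i = -1
    decide +kernel
  cd := by decide +kernel

lemma E_excl {g : Type} [LieRing g] [LieAlgebra ℂ g] [FiniteDimensional ℂ g] {t : LieSubalgebra ℂ g}
    (b : LieAlgebra.Basis (Fin 6) t) (hP : PosM b.A) (hA : b.A = CartanMatrix.E₆) {γ : g ≃ₗ[ℂ] g}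
    (hγ : γ ∈ adjointGroup g) (hγt : ∀ x ∈ t, γ x = -x) : False := by
  have hu := minu_E
  rw [← hA] at hu
  have h5 : Odd 5 := by decide
  have := minu_excl b hP hγ hγt hu h5 (![0, 0, 1, 0, 1, 2])
  simp only [mwt, uE_apply, uE_symm_apply] at this
  revert this
  decide +kernel

end AE
end S5

namespace S5
open LieAlgebra LieModule

attribute [local instance] LieRing.ofAssociativeRing

/-- data of a split form -/
structure Frm (n : ℕ) (N : Type) [Fintype N] [DecidableEq N] where
  σ : N → N
  s : N → ℂ
  η : ℂ
  hσ : ∀ a, σ (σ a) = a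
  hs : ∀ a, s a ≠ 0
  hη : ∀ a, s (σ a) = η * s a
  ext : (Fin n → ℂ) →ₗ[ℂ] (N → ℂ)
  hext : ∀ x a, ext x (σ a) = -ext x a
  ι : Fin n → N
  hι : ∀ x i, ext x (ι i) = x i
  cov : ∀ a, (∃ i, a = ι i) ∨ (∃ i, a = σ (ι i)) ∨ σ a = a
  fix1 : ∀ a b, σ a = a → σ b = b → a = b

namespace Frm
variable {n : ℕ} {N : Type} [Fintype N] [DecidableEq N] (S : Frm n N)

def J : Matrix N N ℂ := Matrix.of fun a b => if a = S.σ b then S.s b else 0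

def M : LieSubalgebra ℂ (Matrix N N ℂ) := skewAdjointMatricesLieSubalgebra S.J

lemma mem_M (A : Matrix N N ℂ) : A ∈ S.M ↔ ∀ a b, A (S.σ b) (S.σ a) * S.s b = -(S.s a * A a b) := by
  have hi : Function.Injective S.σ := Function.LeftInverse.injective S.hσ
  have : A ∈ S.M ↔ A.transpose * S.J = S.J * (-A) := by
    rw [M, mem_skewAdjointMatricesLieSubalgebra, mem_skewAdjointMatricesSubmodule]; rfl
  rw [this, ← Matrix.ext_iff]
  have e1 : ∀ a b, (A.transpose * S.J) a b = A (S.σ b) a * S.s b := by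
    intro a b
    rw [Matrix.mul_apply, Finset.sum_eq_single (S.σ b)]
    · simp [J]
    · intro c _ hc; simp [J, hc]
    · simp
  have e2 : ∀ a b, (S.J * (-A)) a b = -(S.s (S.σ a) * A (S.σ a) b) := by
    intro a b
    rw [Matrix.mul_apply, Finset.sum_eq_single (S.σ a)]
    · simp [J, S.hσ]
    · intro c _ hc
      have : a ≠ S.σ c := fun h => hc (by rw [h, S.hσ])
      simp [J, this]
    · simp
  simp only [e1, e2]
  constructor
  · intro h a b
    have := h (S.σ a) b
    rwa [S.hσ] at this
  · intro h a b
    have := h (S.σ a) b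
    rwa [S.hσ] at this

lemma ηsq [Nonempty N] : S.η * S.η = 1 := by
  obtain ⟨a⟩ := ‹Nonempty N›
  have h := S.hη (S.σ a)
  rw [S.hσ, S.hη, ← mul_assoc] at h
  exact mul_right_cancel₀ (S.hs a) (by rw [← h, one_mul])

lemma η_ne (a : N) : S.η ≠ 0 := fun h => S.hs (S.σ a) (by rw [S.hη, h, zero_mul])

def Fm (a b : N) : Matrix N N ℂ := Matrix.single a b 1 - Matrix.single (S.σ b) (S.σ a) (S.s a / S.s b)

lemma Fm_apply (a b c d : N) : S.Fm a b c d = (if a = c ∧ b = d then 1 else 0) -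
    (if S.σ b = c ∧ S.σ a = d then S.s a / S.s b else 0) := by
  simp [Fm, Matrix.single_apply]

lemma σ_eq {a b : N} : S.σ a = b ↔ a = S.σ b :=
  ⟨fun h => by rw [← h, S.hσ], fun h => by rw [h, S.hσ]⟩

lemma Fm_mem (a b : N) : S.Fm a b ∈ S.M := by
  rw [mem_M]
  intro c d
  rw [Fm_apply, Fm_apply]
  have e1 : (a = S.σ d ∧ b = S.σ c) ↔ (S.σ b = c ∧ S.σ a = d) := by
    rw [S.σ_eq, S.σ_eq]; tauto
  have e2 : (S.σ b = S.σ d ∧ S.σ a = S.σ c) ↔ (a = c ∧ b = d) := by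
    rw [S.σ_eq, S.σ_eq, S.hσ, S.hσ]; tauto
  rw [if_congr e1 rfl rfl, if_congr e2 rfl rfl]
  have hb := S.hs b
  have ha := S.hs a
  have hN := S.η_ne a
  split_ifs with h1 h2 h2
  · obtain ⟨h1, h1'⟩ := h1
    obtain ⟨rfl, rfl⟩ := h2
    have h3 : S.s a = S.η * S.s b := by rw [← h1, S.hη]
    haveI : Nonempty N := ⟨a⟩
    have h2 : S.s a ^ 2 = S.s b ^ 2 := by rw [h3]; linear_combination (S.s b) ^ 2 * S.ηsq
    field_simp; linear_combination -h2
  · obtain ⟨rfl, rfl⟩ := h1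
    rw [S.hη, S.hη]; field_simp; ring
  · obtain ⟨rfl, rfl⟩ := h2
    field_simp; ring
  · simp

def F (a b : N) : S.M := ⟨S.Fm a b, S.Fm_mem a b⟩

lemma coe_lie (x y : S.M) : ((⁅x, y⁆ : S.M) : Matrix N N ℂ) = (x : Matrix N N ℂ) * y - y * x := rfl

lemma lie_F (a b c d : N) : ⁅S.F a b, S.F c d⁆ = (if b = c then S.F a d else 0) - (if a = d then S.F c b else 0)
    - (if b = S.σ d then (S.s c / S.s d) • S.F a (S.σ c) else 0)
    - (if c = S.σ a then (S.s a / S.s b) • S.F (S.σ b) d else 0) := by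
  apply Subtype.ext
  have hc : ∀ (p : Prop) [Decidable p] (x : S.M), ((if p then x else 0 : S.M) : Matrix N N ℂ) = if p then (x : Matrix N N ℂ) else 0 := by
    intro p _ x; split_ifs <;> rfl
  rw [coe_lie]
  simp only [AddSubgroupClass.coe_sub, hc, SetLike.val_smul]
  change S.Fm a b * S.Fm c d - S.Fm c d * S.Fm a b = (if b = c then S.Fm a d else 0) - (if a = d then S.Fm c b else 0)
    - (if b = S.σ d then (S.s c / S.s d) • S.Fm a (S.σ c) else 0)
    - (if c = S.σ a then (S.s a / S.s b) • S.Fm (S.σ b) d else 0)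
  have hi : ∀ {a b}, S.σ a = S.σ b ↔ a = b := fun {a b} => (Function.LeftInverse.injective S.hσ).eq_iff
  have key : ∀ (i j k l : N) (x y : ℂ), Matrix.single i j x * Matrix.single k l y = if j = k then Matrix.single i l (x * y) else 0 := by
    intro i j k l x y
    split_ifs with h
    · subst h; exact Matrix.single_mul_single_same ..
    · exact Matrix.single_mul_single_of_ne _ _ _ _ h _
  have h1 := S.hs a
  have h2 := S.hs b
  have h3 := S.hs c
  have h4 := S.hs d
  have h5 := S.η_ne a
  simp only [Fm, mul_sub, sub_mul, key, hi, S.hσ, S.σ_eq, smul_sub, Matrix.smul_single, S.hη, smul_eq_mul, one_mul, mul_one]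
  have A1 : (if b = c then Matrix.single a d (1 : ℂ) else 0) -
      (if c = b then Matrix.single (S.σ d) (S.σ a) (S.s c / S.s d * (S.s a / S.s b)) else 0) =
      if b = c then Matrix.single a d 1 - Matrix.single (S.σ d) (S.σ a) (S.s a / S.s d) else 0 := by
    by_cases h : b = c
    · subst h
      simp only [if_true]
      congr 2; field_simp
    · simp [h, Ne.symm h]
  have A2 : (if d = a then Matrix.single c b (1 : ℂ) else 0) -
      (if a = d then Matrix.single (S.σ b) (S.σ c) (S.s a / S.s b * (S.s c / S.s d)) else 0) =
      if a = d then Matrix.single c b 1 - Matrix.single (S.σ b) (S.σ c) (S.s c / S.s b) else 0 := by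
    by_cases h : a = d
    · subst h
      simp only [if_true]
      congr 2; field_simp
    · simp [h, Ne.symm h]
  have A3 : (if b = S.σ d then Matrix.single a (S.σ c) (S.s c / S.s d) else 0) -
      (if d = S.σ b then Matrix.single c (S.σ a) (S.s a / S.s b) else 0) =
      if b = S.σ d then
          Matrix.single a (S.σ c) (S.s c / S.s d) - Matrix.single c (S.σ a) (S.s c / S.s d * (S.s a / (S.η * S.s c)))
        else 0 := by
    by_cases h : b = S.σ d
    · subst h
      simp only [if_true, S.hσ, S.hη]
      congr 2; field_simp
    · have h' : d ≠ S.σ b := fun e => h (by rw [e, S.hσ])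
      simp [h, h']
  have A4 : (if a = S.σ c then Matrix.single (S.σ b) d (S.s a / S.s b) else 0) -
      (if c = S.σ a then Matrix.single (S.σ d) b (S.s c / S.s d) else 0) =
      if c = S.σ a then
        Matrix.single (S.σ b) d (S.s a / S.s b) - Matrix.single (S.σ d) b (S.s a / S.s b * (S.η * S.s b / S.s d))
      else 0 := by
    by_cases h : c = S.σ a
    · subst h
      simp only [if_true, S.hσ, S.hη]
      congr 2; field_simp
    · have h' : a ≠ S.σ c := fun e => h (by rw [e, S.hσ])
      simp [h, h']
  rw [← A1, ← A2, ← A3, ← A4]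
  abel

end Frm
end S5

namespace S5
open LieAlgebra LieModule

attribute [local instance] LieRing.ofAssociativeRing

namespace Frm
variable {n : ℕ} {N : Type} [Fintype N] [DecidableEq N] (S : Frm n N)

lemma F_swap (a b : N) : S.F (S.σ b) (S.σ a) = -(S.s b / S.s a) • S.F a b := by
  apply Subtype.ext
  change S.Fm _ _ = -(S.s b / S.s a) • S.Fm a b
  have h1 := S.hs a
  have h2 := S.hs b
  have h3 := S.η_ne a
  simp only [Fm, S.hσ, S.hη, smul_sub, Matrix.smul_single, neg_smul, smul_eq_mul, mul_one]
  have e1 : S.s b / S.s a * (S.s a / S.s b) = 1 := by field_simp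
  have e2 : S.η * S.s b / (S.η * S.s a) = S.s b / S.s a := by field_simp
  rw [e1, e2]; abel

lemma F_self_zero (a : N) (hη : S.η = 1) : S.F a (S.σ a) = 0 := by
  apply Subtype.ext
  change S.Fm _ _ = 0
  have h1 := S.hs a
  simp [Fm, S.hσ, S.hη, hη, div_self h1]

lemma F_fix_zero (a : N) (ha : S.σ a = a) : S.F a a = 0 := by
  apply Subtype.ext
  change S.Fm _ _ = 0
  have h1 := S.hs a
  simp [Fm, ha, div_self h1]

def dg : (Fin n → ℂ) →ₗ[ℂ] S.M where
  toFun x := ⟨Matrix.diagonal (S.ext x), by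
    rw [mem_M]; intro a b
    by_cases h : a = b
    · subst h; simp [S.hext]; ring
    · have h' : S.σ b ≠ S.σ a := fun e => h ((Function.LeftInverse.injective S.hσ) e).symm
      simp [Matrix.diagonal_apply_ne _ h, Matrix.diagonal_apply_ne _ h']⟩
  map_add' x y := by
    apply Subtype.ext
    change Matrix.diagonal (S.ext (x + y)) = Matrix.diagonal (S.ext x) + Matrix.diagonal (S.ext y)
    rw [map_add, Matrix.diagonal_add]; rfl
  map_smul' c x := by
    apply Subtype.ext
    change Matrix.diagonal (S.ext (c • x)) = c • Matrix.diagonal (S.ext x)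
    rw [map_smul, ← Matrix.diagonal_smul]

lemma coe_dg (x) : (S.dg x : Matrix N N ℂ) = Matrix.diagonal (S.ext x) := rfl

lemma dg_inj {x : Fin n → ℂ} (h : S.dg x = 0) : x = 0 := by
  ext i
  have : Matrix.diagonal (S.ext x) = 0 := congrArg Subtype.val h
  have := congrFun (congrFun this (S.ι i)) (S.ι i)
  rwa [Matrix.diagonal_apply_eq, S.hι] at this

lemma lie_dg_dg (x y) : ⁅S.dg x, S.dg y⁆ = 0 := by
  apply Subtype.ext
  rw [coe_lie, coe_dg, coe_dg, Matrix.diagonal_mul_diagonal, Matrix.diagonal_mul_diagonal]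
  simp only [mul_comm, sub_self]; rfl

lemma lie_dg_apply (x) (y : S.M) (a b : N) : (⁅S.dg x, y⁆ : S.M).1 a b = (S.ext x a - S.ext x b) * y.1 a b := by
  rw [coe_lie, coe_dg, Matrix.sub_apply, Matrix.diagonal_mul, Matrix.mul_diagonal]; ring

lemma lie_dg_F (x) (a b : N) : ⁅S.dg x, S.F a b⁆ = (S.ext x a - S.ext x b) • S.F a b := by
  apply Subtype.ext
  ext c d
  rw [lie_dg_apply]
  change _ = (S.ext x a - S.ext x b) * S.Fm a b c d
  change _ * S.Fm a b c d = _
  rw [Fm_apply]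
  split_ifs with h1 h2 h2
  · obtain ⟨rfl, rfl⟩ := h1; rfl
  · obtain ⟨rfl, rfl⟩ := h1; rfl
  · obtain ⟨rfl, rfl⟩ := h2; rw [S.hext, S.hext]; ring
  · simp

lemma ι_inj : Function.Injective S.ι := by
  intro i j h
  by_contra hij
  have h1 := S.hι (Pi.single i 1) i
  rw [h, S.hι] at h1
  simp [Pi.single_apply, Ne.symm hij] at h1

lemma ι_ne (i j) : S.ι i ≠ S.σ (S.ι j) := by
  intro h
  have h1 := S.hι (fun _ => 1) i
  rw [h, S.hext, S.hι] at h1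
  norm_num at h1

lemma ι_ne_fix (i) (a) (ha : S.σ a = a) : S.ι i ≠ a := by
  intro h
  have h1 := S.hext (fun _ => 1) a
  rw [ha, ← h, S.hι] at h1
  norm_num at h1

lemma ext_fix (x) (a) (ha : S.σ a = a) : S.ext x a = 0 := by
  have h1 := S.hext x a
  rw [ha] at h1
  exact self_eq_neg.mp h1

lemma reg : ∃ x, Function.Injective (S.ext x) := by
  refine ⟨fun i => (i.1 : ℂ) + 1, ?_⟩
  have hp : ∀ i j : Fin n, (i.1 : ℂ) + 1 ≠ -((j.1 : ℂ) + 1) := by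
    intro i j h
    have : ((i.1 + j.1 + 2 : ℕ) : ℂ) = 0 := by push_cast; linear_combination h
    norm_cast at this
  have h0 : ∀ i : Fin n, (i.1 : ℂ) + 1 ≠ 0 := by
    intro i h; norm_cast at h
  intro a b h
  rcases S.cov a with ⟨i, rfl⟩ | ⟨i, rfl⟩ | ha <;> rcases S.cov b with ⟨j, rfl⟩ | ⟨j, rfl⟩ | hb
  · rw [S.hι, S.hι] at h
    congr 1; ext; exact_mod_cast add_right_cancel h
  · rw [S.hι, S.hext, S.hι] at h; exact absurd h (hp _ _)
  · rw [S.hι, S.ext_fix _ _ hb] at h; exact absurd h (h0 _)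
  · rw [S.hι, S.hext, S.hι] at h; exact absurd h.symm (hp _ _)
  · rw [S.hext, S.hι, S.hext, S.hι, neg_inj] at h
    congr 2; ext; exact_mod_cast add_right_cancel h
  · rw [S.hext, S.hι, S.ext_fix _ _ hb, neg_eq_zero] at h; exact absurd h (h0 _)
  · rw [S.hι, S.ext_fix _ _ ha] at h; exact absurd h.symm (h0 _)
  · rw [S.hext, S.hι, S.ext_fix _ _ ha, eq_comm, neg_eq_zero] at h; exact absurd h (h0 _)
  · exact S.fix1 _ _ ha hb

lemma surj (d : N → ℂ) (hd : ∀ a, d (S.σ a) = -d a) : S.ext (fun i => d (S.ι i)) = d := by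
  ext a
  rcases S.cov a with ⟨i, rfl⟩ | ⟨i, rfl⟩ | ha
  · rw [S.hι]
  · rw [S.hext, S.hι, hd]
  · rw [S.ext_fix _ _ ha]
    have := hd a
    rw [ha] at this
    exact (self_eq_neg.mp this).symm

lemma F_diag (i) : S.F (S.ι i) (S.ι i) = S.dg (Pi.single i 1) := by
  apply Subtype.ext
  ext c d
  rw [coe_dg]
  change S.Fm _ _ _ _ = _
  rw [Fm_apply]
  by_cases hcd : c = d
  swap
  · rw [Matrix.diagonal_apply_ne _ hcd, if_neg (fun h => hcd (h.1.symm.trans h.2)),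
      if_neg (fun h => hcd (h.1.symm.trans h.2)), sub_zero]
  subst hcd
  rw [Matrix.diagonal_apply_eq, div_self (S.hs _)]
  simp only [and_self]
  rcases S.cov c with ⟨j, rfl⟩ | ⟨j, rfl⟩ | ha
  · rw [S.hι, if_neg (S.ι_ne j i).symm]
    simp [S.ι_inj.eq_iff, Pi.single_apply, eq_comm]
  · rw [S.hext, S.hι, if_neg (S.ι_ne i j)]
    simp [S.ι_inj.eq_iff, (Function.LeftInverse.injective S.hσ).eq_iff, Pi.single_apply, eq_comm]
  · rw [S.ext_fix _ _ ha, if_neg (S.ι_ne_fix i c ha), if_neg, sub_zero]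
    rw [S.σ_eq, ha]; exact S.ι_ne_fix i c ha

lemma mem_of_F (Λ : LieSubalgebra ℂ S.M) (h : ∀ a b, S.F a b ∈ Λ) : Λ = ⊤ := by
  rw [_root_.eq_top_iff]
  intro x _
  have hx : x = (1 / 2 : ℂ) • ∑ a, ∑ b, x.1 a b • S.F a b := by
    apply Subtype.ext
    ext c d
    have h1 : ((((1 / 2 : ℂ) • ∑ a, ∑ b, x.1 a b • S.F a b : S.M)) : Matrix N N ℂ) =
        (1 / 2 : ℂ) • ∑ a, ∑ b, x.1 a b • S.Fm a b := by
      simp only [SetLike.val_smul, AddSubmonoidClass.coe_finset_sum]; rfl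
    rw [h1]
    have h2 := (S.mem_M x.1).1 x.2 c d
    have h3 := S.hs d
    have h4 := S.hs c
    have h5 := S.η_ne c
    simp only [Matrix.smul_apply, Matrix.sum_apply, Fm_apply, smul_eq_mul, mul_sub, mul_ite, mul_one, mul_zero,
      Finset.sum_sub_distrib]
    have s1 : ∑ a, ∑ b, (if a = c ∧ b = d then x.1 a b else 0) = x.1 c d := by
      rw [Finset.sum_eq_single c, Finset.sum_eq_single d] <;> simp +contextual
    have s2 : ∑ a, ∑ b, (if S.σ b = c ∧ S.σ a = d then x.1 a b * (S.s a / S.s b) else 0) =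
        x.1 (S.σ d) (S.σ c) * (S.s (S.σ d) / S.s (S.σ c)) := by
      simp only [S.σ_eq]
      rw [Finset.sum_eq_single (S.σ d), Finset.sum_eq_single (S.σ c)] <;> simp +contextual
    rw [s1, s2, S.hη, S.hη]
    field_simp
    linear_combination h2
  rw [hx]
  exact Λ.smul_mem _ (sum_mem fun a _ => sum_mem fun b _ => Λ.smul_mem _ (h a b))

/-- the diagonal subalgebra -/
def H : LieSubalgebra ℂ S.M where
  __ := LinearMap.range S.dg
  lie_mem' := by
    rintro - - ⟨x, rfl⟩ ⟨y, rfl⟩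
    rw [lie_dg_dg]; exact Submodule.zero_mem _

lemma H_ab : ∀ x ∈ S.H, ∀ y ∈ S.H, ⁅x, y⁆ = 0 := by
  rintro - ⟨x, rfl⟩ - ⟨y, rfl⟩
  exact S.lie_dg_dg x y

lemma dg_mem (x) : S.dg x ∈ S.H := ⟨x, rfl⟩

lemma mem_H_of (x : S.M) (hx : ∀ a b, a ≠ b → x.1 a b = 0) : x ∈ S.H := by
  refine ⟨fun i => x.1 (S.ι i) (S.ι i), ?_⟩
  apply Subtype.ext
  rw [coe_dg, S.surj (fun a => x.1 a a)]
  · ext a b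
    by_cases h : a = b
    · subst h; simp
    · rw [Matrix.diagonal_apply_ne _ h, hx a b h]
  · intro a
    have := (S.mem_M x.1).1 x.2 a a
    exact mul_right_cancel₀ (S.hs a) (by rw [this]; ring)

lemma H_norm : ∀ x, (∀ y ∈ S.H, ⁅x, y⁆ ∈ S.H) → x ∈ S.H := by
  intro x hx
  obtain ⟨x0, h0⟩ := S.reg
  apply S.mem_H_of
  intro a b hab
  obtain ⟨y, hy⟩ := hx _ (S.dg_mem x0)
  have h1 : S.dg (-y) = ⁅S.dg x0, x⁆ := by rw [← lie_skew, ← hy, map_neg]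
  have h2 := S.lie_dg_apply x0 x a b
  rw [← h1, coe_dg, Matrix.diagonal_apply_ne _ hab] at h2
  rcases mul_eq_zero.1 h2.symm with h | h
  · exact absurd (h0 (sub_eq_zero.1 h)) hab
  · exact h

end Frm
end S5

namespace S5
open LieAlgebra LieModule

attribute [local instance] LieRing.ofAssociativeRing

namespace Frm
variable {n : ℕ} {N : Type} [Fintype N] [DecidableEq N] (S : Frm n N)

lemma σι (i) : S.F (S.σ (S.ι i)) (S.σ (S.ι i)) = -S.dg (Pi.single i 1) := by
  rw [F_swap, F_diag, div_self (S.hs _)]; simp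

lemma tri1 (i j) (hij : i ≠ j) : ⁅S.F (S.ι i) (S.ι j), S.F (S.ι j) (S.ι i)⁆ =
    S.dg (Pi.single i 1 - Pi.single j 1) := by
  rw [lie_F, if_pos rfl, if_pos rfl, if_neg (S.ι_ne _ _), if_neg (S.ι_ne _ _), F_diag, F_diag, map_sub]
  simp

lemma tri2 (i j) (hij : i ≠ j) : ⁅S.F (S.ι i) (S.σ (S.ι j)), S.F (S.σ (S.ι j)) (S.ι i)⁆ =
    S.dg (Pi.single i 1 + Pi.single j 1) := by
  have h1 : S.σ (S.ι j) ≠ S.σ (S.ι i) := fun h =>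
    hij (S.ι_inj ((Function.LeftInverse.injective S.hσ) h)).symm
  rw [lie_F, if_pos rfl, if_pos rfl, if_neg h1, if_neg h1, F_diag, σι, map_add]
  simp

lemma triC (hη : S.η = -1) (i) : (1 / 4 : ℂ) • ⁅S.F (S.ι i) (S.σ (S.ι i)), S.F (S.σ (S.ι i)) (S.ι i)⁆ =
    S.dg (Pi.single i 1) := by
  have h1 := S.hs (S.ι i)
  rw [lie_F, if_pos rfl, if_pos rfl, if_pos rfl, if_pos rfl, S.hσ, F_diag, σι, S.hη, hη,
    neg_one_mul, neg_div, div_self h1, div_neg, div_self h1]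
  module

lemma triB (z : N) (hz : S.σ z = z) (i) : (2 : ℂ) • ⁅S.F (S.ι i) z, S.F z (S.ι i)⁆ =
    S.dg (2 • Pi.single i 1) := by
  have h2 : z ≠ S.σ (S.ι i) := fun h => S.ι_ne_fix i z hz (by rw [← hz, h, S.hσ])
  rw [lie_F, if_pos rfl, if_pos rfl, if_neg h2, if_neg h2, F_diag, F_fix_zero _ _ hz, map_nsmul]
  module

lemma triple (p q : N) (E : ℂ) (c : Fin n → ℂ) (h1 : E • ⁅S.F p q, S.F q p⁆ = S.dg c)
    (h2 : S.ext c p - S.ext c q = 2) : IsSl2Triple (S.dg c) (E • S.F p q) (S.F q p) where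
  h_ne_zero h := by
    rw [S.dg_inj h] at h2; simp at h2
  lie_e_f := by rw [smul_lie, h1]
  lie_h_e_nsmul := by
    rw [lie_smul, lie_dg_F, h2]; module
  lie_h_f_nsmul := by
    rw [lie_dg_F, ← neg_sub, h2]; module

lemma refl_dg (p q : N) (E : ℂ) (c : Fin n → ℂ) (h1 : E • ⁅S.F p q, S.F q p⁆ = S.dg c)
    (h2 : S.ext c p - S.ext c q = 2) : ∃ w ∈ adjointGroup S.M, ∀ x,
      w (S.dg x) = S.dg (x - (S.ext x p - S.ext x q) • c) := by
  obtain ⟨w, hw, h⟩ := exists_refl (S.triple p q E c h1 h2)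
  refine ⟨w, hw, fun x => ?_⟩
  rw [h (S.dg x) (S.ext x p - S.ext x q), map_sub, map_smul]
  · rw [lie_smul, lie_dg_F, smul_comm]
  · rw [lie_dg_F, ← neg_sub, neg_smul]

lemma flip_all {κ : Type} [Fintype κ] [DecidableEq κ] (p : Fin n → κ)
    (h : ∀ k, ∃ w ∈ adjointGroup S.M, ∀ x, w (S.dg x) = S.dg (fun i => if p i = k then -x i else x i)) :
    ∃ w ∈ adjointGroup S.M, ∀ y ∈ S.H, w y = -y := by
  have : ∀ T : Finset κ, ∃ w ∈ adjointGroup S.M, ∀ x, w (S.dg x) = S.dg (fun i => if p i ∈ T then -x i else x i) := by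
    intro T
    induction T using Finset.induction_on with
    | empty => exact ⟨1, one_mem _, fun x => by simp⟩
    | insert k T hk ih =>
      obtain ⟨w, hw, h1⟩ := ih
      obtain ⟨v, hv, h2⟩ := h k
      refine ⟨v * w, mul_mem hv hw, fun x => ?_⟩
      rw [LinearEquiv.mul_apply, h1, h2]
      congr 1; ext i
      by_cases h3 : p i = k
      · simp [h3, hk]
      · simp [h3]
  obtain ⟨w, hw, h1⟩ := this Finset.univ
  refine ⟨w, hw, ?_⟩
  rintro - ⟨x, rfl⟩
  change w (S.dg x) = -S.dg x
  rw [h1, ← map_neg]; congr 1; ext i; simp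

lemma flipC (hη : S.η = -1) : ∃ w ∈ adjointGroup S.M, ∀ y ∈ S.H, w y = -y := by
  apply S.flip_all (p := id)
  intro k
  obtain ⟨w, hw, h⟩ := S.refl_dg (S.ι k) (S.σ (S.ι k)) _ _ (S.triC hη k) (by
    rw [S.hext, S.hι]; simp; norm_num)
  refine ⟨w, hw, fun x => ?_⟩
  rw [h]; congr 1; ext i
  rw [S.hext, S.hι]
  by_cases hi : i = k
  · subst hi; simp
  · simp [hi]

lemma flipB (z : N) (hz : S.σ z = z) : ∃ w ∈ adjointGroup S.M, ∀ y ∈ S.H, w y = -y := by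
  apply S.flip_all (p := id)
  intro k
  obtain ⟨w, hw, h⟩ := S.refl_dg (S.ι k) z _ _ (S.triB z hz k) (by
    rw [S.ext_fix _ _ hz, S.hι]; simp)
  refine ⟨w, hw, fun x => ?_⟩
  rw [h]; congr 1; ext i
  rw [S.ext_fix _ _ hz, S.hι]
  by_cases hi : i = k
  · subst hi; simp; ring
  · simp [hi]

lemma flip_pair (i j) (hij : i ≠ j) : ∃ w ∈ adjointGroup S.M, ∀ x,
    w (S.dg x) = S.dg (fun l => if l = i ∨ l = j then -x l else x l) := by
  obtain ⟨w, hw, h⟩ := S.refl_dg (S.ι i) (S.ι j) 1 _ (by rw [one_smul]; exact S.tri1 i j hij) (by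
    rw [S.hι, S.hι]; simp [hij, hij.symm]; norm_num)
  obtain ⟨v, hv, h'⟩ := S.refl_dg (S.ι i) (S.σ (S.ι j)) 1 _ (by rw [one_smul]; exact S.tri2 i j hij) (by
    rw [S.hext, S.hι, S.hι]; simp [hij, hij.symm]; norm_num)
  refine ⟨v * w, mul_mem hv hw, fun x => ?_⟩
  rw [LinearEquiv.mul_apply, h, h']; congr 1; ext l
  rw [S.hext, S.hι, S.hι, S.hι, S.hι]
  by_cases h1 : l = i
  · subst h1; simp [hij, hij.symm]
  by_cases h2 : l = j
  · subst h2; simp [hij, hij.symm]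
  simp [h1, h2]
end Frm

lemma flipD {n : ℕ} {N : Type} [Fintype N] [DecidableEq N] (S : Frm (2 * n) N) :
    ∃ w ∈ adjointGroup S.M, ∀ y ∈ S.H, w y = -y := by
  apply S.flip_all (p := fun i => (⟨i.1 / 2, by omega⟩ : Fin n))
  intro k
  obtain ⟨w, hw, h⟩ := S.flip_pair ⟨2 * k.1, by omega⟩ ⟨2 * k.1 + 1, by omega⟩ (by simp)
  refine ⟨w, hw, fun x => ?_⟩
  rw [h]; congr 1; ext i
  refine if_congr ?_ rfl rfl
  simp only [Fin.ext_iff]; omega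

/-- type D -/
def frmD (n : ℕ) : Frm n (Fin n ⊕ Fin n) where
  σ := Sum.swap
  s := fun _ => 1
  η := 1
  hσ := by simp
  hs := by simp
  hη := by simp
  ext := { toFun := fun x => Sum.elim x (fun i => -x i)
           map_add' := by intro x y; ext (i | i) <;> simp; ring
           map_smul' := by intro x y; ext (i | i) <;> simp }
  hext := by rintro x (i | i) <;> simp
  ι := Sum.inl
  hι := by simp
  cov := by rintro (i | i) <;> simp
  fix1 := by rintro (i | i) b <;> simp

def frmC (n : ℕ) : Frm n (Fin n ⊕ Fin n) where
  σ := Sum.swap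
  s := Sum.elim (fun _ => 1) (fun _ => -1)
  η := -1
  hσ := by simp
  hs := by rintro (i | i) <;> simp
  hη := by rintro (i | i) <;> simp
  ext := { toFun := fun x => Sum.elim x (fun i => -x i)
           map_add' := by intro x y; ext (i | i) <;> simp; ring
           map_smul' := by intro x y; ext (i | i) <;> simp }
  hext := by rintro x (i | i) <;> simp
  ι := Sum.inl
  hι := by simp
  cov := by rintro (i | i) <;> simp
  fix1 := by rintro (i | i) b <;> simp

def frmB (n : ℕ) : Frm n (Unit ⊕ (Fin n ⊕ Fin n)) where
  σ := Sum.map id Sum.swap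
  s := Sum.elim (fun _ => 2) (fun _ => 1)
  η := 1
  hσ := by rintro (i | i) <;> simp
  hs := by rintro (i | i) <;> simp
  hη := by rintro (i | i) <;> simp
  ext := { toFun := fun x => Sum.elim (fun _ => 0) (Sum.elim x (fun i => -x i))
           map_add' := by intro x y; ext (i | i | i) <;> simp; ring
           map_smul' := by intro x y; ext (i | i | i) <;> simp }
  hext := by rintro x (i | i | i) <;> simp
  ι := fun i => Sum.inr (Sum.inl i)
  hι := by simp
  cov := by rintro (i | i | i) <;> simp
  fix1 := by rintro (i | i | i) (b | b | b) <;> simp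

lemma frmD_M (n : ℕ) : LieAlgebra.Orthogonal.typeD (Fin n) ℂ = (frmD n).M := by
  have : LieAlgebra.Orthogonal.JD (Fin n) ℂ = (frmD n).J := by
    ext (i | i) (j | j) <;> simp [Orthogonal.JD, Frm.J, frmD, Matrix.one_apply]
  unfold Orthogonal.typeD Frm.M; rw [this]

lemma frmC_M (n : ℕ) : LieAlgebra.Symplectic.sp (Fin n) ℂ = (frmC n).M := by
  have : Matrix.J (Fin n) ℂ = (frmC n).J := by
    ext (i | i) (j | j) <;> simp [Matrix.J, Frm.J, frmC, Matrix.one_apply, neg_ite]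
  unfold Symplectic.sp Frm.M; rw [this]

lemma frmB_M (n : ℕ) : LieAlgebra.Orthogonal.typeB (Fin n) ℂ = (frmB n).M := by
  have : LieAlgebra.Orthogonal.JB (Fin n) ℂ = (frmB n).J := by
    ext (i | i | i) (j | j | j) <;> simp [Orthogonal.JB, Orthogonal.JD, Frm.J, frmB, Matrix.one_apply]
  unfold Orthogonal.typeB Frm.M; rw [this]

variable {g : Type} [LieRing g] [LieAlgebra ℂ g] [FiniteDimensional ℂ g] [IsSimple ℂ g]
    (t : LieSubalgebra ℂ g) [t.IsCartanSubalgebra] (ψ : g ≃ₗ⁅ℂ⁆ g)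

theorem back_B (hψt : ∀ x ∈ t, ψ x = -x) (n : ℕ) (h : Nonempty (g ≃ₗ⁅ℂ⁆ LieAlgebra.Orthogonal.typeB (Fin n) ℂ)) :
    ψ.toLinearEquiv ∈ adjointGroup g := by
  rw [frmB_M] at h
  obtain ⟨φ⟩ := h
  obtain ⟨w, hw, hw'⟩ := (frmB n).flipB (Sum.inl ()) rfl
  exact back t ψ hψt φ _ (frmB n).H_ab (frmB n).H_norm w hw hw'

theorem back_C (hψt : ∀ x ∈ t, ψ x = -x) (n : ℕ) (h : Nonempty (g ≃ₗ⁅ℂ⁆ LieAlgebra.Symplectic.sp (Fin n) ℂ)) :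
    ψ.toLinearEquiv ∈ adjointGroup g := by
  rw [frmC_M] at h
  obtain ⟨φ⟩ := h
  obtain ⟨w, hw, hw'⟩ := (frmC n).flipC rfl
  exact back t ψ hψt φ _ (frmC n).H_ab (frmC n).H_norm w hw hw'

theorem back_D (hψt : ∀ x ∈ t, ψ x = -x) (n : ℕ) (h : Nonempty (g ≃ₗ⁅ℂ⁆ LieAlgebra.Orthogonal.typeD (Fin (2 * n)) ℂ)) :
    ψ.toLinearEquiv ∈ adjointGroup g := by
  rw [frmD_M] at h
  obtain ⟨φ⟩ := h
  obtain ⟨w, hw, hw'⟩ := flipD (frmD (2 * n))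
  exact back t ψ hψt φ _ (frmD (2 * n)).H_ab (frmD (2 * n)).H_norm w hw hw'

end S5

namespace S5
open LieAlgebra LieModule

/-- reflection matrix -/
def RR {ι : Type} [DecidableEq ι] (A : Matrix ι ι ℤ) (i : ι) : Matrix ι ι ℤ :=
  Matrix.of fun m k => (if m = k then 1 else 0) - if m = i then A i k else 0

section
variable {ι : Type} [Fintype ι] [DecidableEq ι] {A : Matrix ι ι ℤ}

lemma RR_fix (i : ι) (v : ι → ℤ) (hv : A.mulVec v = 0) : (RR A i).mulVec v = v := by
  ext m
  have h := congrFun hv i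
  simp only [Matrix.mulVec, dotProduct, RR, Matrix.of_apply, sub_mul, Finset.sum_sub_distrib, ite_mul, one_mul, zero_mul,
    Finset.sum_ite_eq, Finset.mem_univ, if_true] at h ⊢
  by_cases hm : m = i
  · simp only [hm, if_true, h]; simp
  · simp [hm]

lemma prod_fix (l : List ι) (v : ι → ℤ) (hv : A.mulVec v = 0) : ((l.map (RR A)).prod).mulVec v = v := by
  induction l with
  | nil => simp
  | cons i l ih => rw [List.map_cons, List.prod_cons, ← Matrix.mulVec_mulVec, ih, RR_fix i v hv]

lemma det_ne_of_word (l : List ι) (m : ℕ) (h : ((l.map (RR A)).prod) ^ m = -1) : A.det ≠ 0 := by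
  intro h0
  obtain ⟨v, hv, hv'⟩ := Matrix.exists_mulVec_eq_zero_iff.2 h0
  have : ∀ m, ((l.map (RR A)).prod ^ m).mulVec v = v := by
    intro m
    induction m with
    | zero => simp
    | succ m ih => rw [pow_succ', ← Matrix.mulVec_mulVec, ih, prod_fix l v hv']
  have := this m
  rw [h, Matrix.neg_mulVec, Matrix.one_mulVec] at this
  exact hv (neg_eq_self.1 this)

lemma conn_of_path (CM : Matrix ι ι ℤ) (p : ι → ι) (r : ι) (k : ℕ) (hp : ∀ i, CM i (p i) ≠ 0 ∧ CM (p i) i ≠ 0)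
    (hr : ∀ i, p^[k] i = r) (S : Set ι) (hne : S.Nonempty) (hS : ∀ i ∈ S, ∀ j, CM i j ≠ 0 → j ∈ S) : S = Set.univ := by
  have h1 : ∀ k i, i ∈ S ↔ p^[k] i ∈ S := by
    intro k
    induction k with
    | zero => simp
    | succ k ih =>
      intro i
      rw [Function.iterate_succ_apply, ← ih]
      exact ⟨fun h => hS _ h _ (hp i).1, fun h => hS _ h _ (hp i).2⟩
  obtain ⟨x, hx⟩ := hne
  rw [h1 k, hr] at hx
  ext y
  rw [h1 k, hr]; simp [hx]

variable {L : Type} [LieRing L] [LieAlgebra ℂ L] [FiniteDimensional ℂ L] {H : LieSubalgebra ℂ L}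
  (b : LieAlgebra.Basis ι H)

/-- `w` acts on the coroots through the matrix `P` -/
def ActsBy (w : L ≃ₗ[ℂ] L) (P : Matrix ι ι ℤ) : Prop := ∀ j, w (b.h j) = ∑ k, (P k j : ℂ) • b.h k

lemma actsBy_mul {w v : L ≃ₗ[ℂ] L} {P Q : Matrix ι ι ℤ} (hw : ActsBy b w P) (hv : ActsBy b v Q) :
    ActsBy b (w * v) (P * Q) := by
  intro j
  rw [LinearEquiv.mul_apply, hv, map_sum]
  simp only [map_smul, hw _, Finset.smul_sum, Matrix.mul_apply, Int.cast_sum, Int.cast_mul, Finset.sum_smul]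
  rw [Finset.sum_comm]
  refine Finset.sum_congr rfl fun k _ => Finset.sum_congr rfl fun l _ => ?_
  rw [smul_smul, mul_comm]

lemma actsBy_one : ActsBy b 1 1 := by
  intro j
  simp [Matrix.one_apply]

lemma actsBy_RR (i : ι) : ∃ w ∈ adjointGroup L, ActsBy b w (RR b.A i) := by
  obtain ⟨w, hw, h⟩ := exists_refl (b.sl2 i)
  refine ⟨w, hw, fun j => ?_⟩
  rw [h (b.h j) (b.A i j)]
  · simp [RR, sub_smul, Finset.sum_sub_distrib]
  · rw [b.lie_h_e, Int.cast_smul_eq_zsmul]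
  · rw [b.lie_h_f, Int.cast_smul_eq_zsmul, neg_smul]

lemma actsBy_word (l : List ι) : ∃ w ∈ adjointGroup L, ActsBy b w (l.map (RR b.A)).prod := by
  induction l with
  | nil => exact ⟨1, one_mem _, actsBy_one b⟩
  | cons i l ih =>
    obtain ⟨w, hw, h⟩ := ih
    obtain ⟨v, hv, h'⟩ := actsBy_RR b i
    exact ⟨v * w, mul_mem hv hw, by rw [List.map_cons, List.prod_cons]; exact actsBy_mul b h' h⟩

lemma actsBy_pow {w : L ≃ₗ[ℂ] L} {P : Matrix ι ι ℤ} (hw : ActsBy b w P) (m : ℕ) : ActsBy b (w ^ m) (P ^ m) := by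
  induction m with
  | zero => exact actsBy_one b
  | succ m ih => rw [pow_succ, pow_succ]; exact actsBy_mul b ih hw

variable {g : Type} [LieRing g] [LieAlgebra ℂ g] [FiniteDimensional ℂ g] [IsSimple ℂ g]
    (t : LieSubalgebra ℂ g) [t.IsCartanSubalgebra] (ψ : g ≃ₗ⁅ℂ⁆ g)

theorem back_serre (hψt : ∀ x ∈ t, ψ x = -x) (CM : Matrix ι ι ℤ) (h2 : ∀ i, CM i i = 2) (l : List ι) (m : ℕ)
    (hm : ((l.map (RR CM.transpose)).prod) ^ m = -1) (p : ι → ι) (r : ι) (k : ℕ)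
    (hp : ∀ i, CM i (p i) ≠ 0 ∧ CM (p i) i ≠ 0) (hr : ∀ i, p^[k] i = r)
    (φ : g ≃ₗ⁅ℂ⁆ Matrix.ToLieAlgebra ℂ CM) : ψ.toLinearEquiv ∈ adjointGroup g := by
  have hdet : CM.det ≠ 0 := by
    rw [← Matrix.det_transpose]; exact det_ne_of_word l m hm
  haveI : Nontrivial g := by
    by_contra hn
    rw [not_nontrivial_iff_subsingleton] at hn
    exact IsSimple.non_abelian (R := ℂ) (L := g) ⟨fun x y => Subsingleton.elim _ _⟩
  obtain ⟨H, b, hb⟩ := basis_of_serre CM h2 hdet (conn_of_path CM p r k hp hr) φ.symm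
  obtain ⟨w, hw, h⟩ := actsBy_word b l
  have h' := actsBy_pow b h m
  rw [hb, hm] at h'
  have hC := b.isCartanSubalgebra
  have hab := b.isLieAbelian_cartan
  refine back t ψ hψt LieEquiv.refl H ?_ ?_ (w ^ m) (pow_mem hw m) ?_
  · intro x hx y hy
    exact congrArg Subtype.val (hab.trivial ⟨x, hx⟩ ⟨y, hy⟩)
  · intro x hx
    rw [← hC.self_normalizing, LieSubalgebra.mem_normalizer_iff]
    exact hx
  · intro x hx
    have hx' : x ∈ Submodule.span ℂ (Set.range b.h) := by rw [← b.coe_cartan_eq_span]; exact hx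
    clear hx
    induction hx' using Submodule.span_induction with
    | mem x h =>
      obtain ⟨j, rfl⟩ := h
      rw [h' j]; simp [Matrix.one_apply]
    | zero => simp
    | add x y hx hy h1 h2 => rw [map_add, h1, h2]; abel
    | smul a x hx h1 => rw [map_smul, h1, smul_neg]

theorem back_G (hψt : ∀ x ∈ t, ψ x = -x) (h : Nonempty (g ≃ₗ⁅ℂ⁆ LieAlgebra.g₂ ℂ)) : ψ.toLinearEquiv ∈ adjointGroup g := by
  obtain ⟨φ⟩ := h
  exact back_serre t ψ hψt CartanMatrix.G₂ CartanMatrix.G₂_diag (List.finRange 2) 3 (by decide +kernel)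
    ![0, 0] 0 1 (by decide +kernel) (by decide +kernel) φ

theorem back_F (hψt : ∀ x ∈ t, ψ x = -x) (h : Nonempty (g ≃ₗ⁅ℂ⁆ LieAlgebra.f₄ ℂ)) : ψ.toLinearEquiv ∈ adjointGroup g := by
  obtain ⟨φ⟩ := h
  exact back_serre t ψ hψt CartanMatrix.F₄ CartanMatrix.F₄_diag (List.finRange 4) 6 (by decide +kernel)
    ![0, 0, 1, 2] 0 3 (by decide +kernel) (by decide +kernel) φ

theorem back_E7 (hψt : ∀ x ∈ t, ψ x = -x) (h : Nonempty (g ≃ₗ⁅ℂ⁆ LieAlgebra.e₇ ℂ)) : ψ.toLinearEquiv ∈ adjointGroup g := by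
  obtain ⟨φ⟩ := h
  exact back_serre t ψ hψt CartanMatrix.E₇ CartanMatrix.E₇_diag (List.finRange 7) 9 (by decide +kernel)
    ![2, 3, 3, 3, 3, 4, 5] 3 3 (by decide +kernel) (by decide +kernel) φ

theorem back_E8 (hψt : ∀ x ∈ t, ψ x = -x) (h : Nonempty (g ≃ₗ⁅ℂ⁆ LieAlgebra.e₈ ℂ)) : ψ.toLinearEquiv ∈ adjointGroup g := by
  obtain ⟨φ⟩ := h
  exact back_serre t ψ hψt CartanMatrix.E₈ CartanMatrix.E₈_diag (List.finRange 8) 15 (by decide +kernel)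
    ![2, 3, 3, 3, 3, 4, 5, 6] 3 4 (by decide +kernel) (by decide +kernel) φ

end

section fwd
variable {ι : Type} [Fintype ι] [DecidableEq ι]
variable {g : Type} [LieRing g] [LieAlgebra ℂ g] [FiniteDimensional ℂ g] {t : LieSubalgebra ℂ g}
  (b : LieAlgebra.Basis ι t)

lemma exists_re (hP : PosM b.A) {κ : Type} [Fintype κ] [DecidableEq κ] (s : κ ≃ ι) (X : Matrix κ κ ℤ) (h : b.A.submatrix s s = X) :
    ∃ b' : LieAlgebra.Basis κ t, b'.A = X ∧ PosM b'.A := by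
  refine ⟨bReindex b s.symm, ?_, ?_⟩
  · rw [← h]; rfl
  · exact posM_reindex s.symm hP

lemma fwd_serre (hP : PosM b.A) {κ : Type} [Fintype κ] [DecidableEq κ] (s : κ ≃ ι) (X : Matrix κ κ ℤ) (h : b.A.submatrix s s = X)
    (r : κ ≃ κ) (hr : (X.submatrix r r).transpose = X) : Nonempty (g ≃ₗ⁅ℂ⁆ Matrix.ToLieAlgebra ℂ X) := by
  obtain ⟨b', h1, h2⟩ := exists_re b hP (r.trans s) (X.submatrix r r) (by rw [← h]; rfl)
  obtain ⟨φ, -⟩ := serre_equiv b' h2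
  rw [h1, hr] at φ
  exact ⟨φ.symm⟩
end fwd

end S5

namespace S5
open LieAlgebra LieModule

attribute [local instance] LieRing.ofAssociativeRing

namespace Frm
variable {n : ℕ} {N : Type} [Fintype N] [DecidableEq N] (S : Frm n N)

theorem mkBasis (p q : Fin n → N) (E : Fin n → ℂ) (c : Fin n → Fin n → ℂ) (A : Matrix (Fin n) (Fin n) ℤ)
    (hE : ∀ i, E i ≠ 0) (h1 : ∀ i, E i • ⁅S.F (p i) (q i), S.F (q i) (p i)⁆ = S.dg (c i))
    (hA : ∀ i j, (A i j : ℂ) = S.ext (c j) (p i) - S.ext (c j) (q i)) (h2 : ∀ i, A i i = 2)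
    (hdet : A.det ≠ 0) (hcomm : ∀ i j, i ≠ j → ⁅S.F (p i) (q i), S.F (q j) (p j)⁆ = 0)
    (hgen : ∀ Λ : LieSubalgebra ℂ S.M, (∀ i, S.F (p i) (q i) ∈ Λ) → (∀ i, S.F (q i) (p i) ∈ Λ) →
      (∀ x, S.dg x ∈ Λ) → ∀ a b, S.F a b ∈ Λ) :
    ∃ b : LieAlgebra.Basis (Fin n) S.H, b.A = A ∧ ∀ i, b.h i = S.dg (c i) := by
  have hli : LinearIndependent ℂ c := by
    rw [Fintype.linearIndependent_iff]
    intro y hy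
    have hd : (A.map (Int.cast : ℤ → ℂ)).det ≠ 0 := by
      have := (Int.castRingHom ℂ).map_det A
      intro h
      apply hdet
      have h' : ((A.det : ℤ) : ℂ) = 0 := by
        have e : ((A.det : ℤ) : ℂ) = ((Int.castRingHom ℂ).mapMatrix A).det := this
        rw [e]; exact h
      exact_mod_cast h'
    have h0 : (A.map (Int.cast : ℤ → ℂ)).mulVec y = 0 := by
      ext i
      have h3 : S.ext (∑ j, y j • c j) (p i) - S.ext (∑ j, y j • c j) (q i) = 0 := by rw [hy]; simp
      rw [map_sum] at h3
      simp only [map_smul, Finset.sum_apply, Pi.smul_apply, smul_eq_mul] at h3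
      rw [← Finset.sum_sub_distrib] at h3
      rw [Pi.zero_apply, ← h3, Matrix.mulVec, dotProduct]
      refine Finset.sum_congr rfl fun j _ => ?_
      rw [Matrix.map_apply, hA]; ring
    have := Matrix.eq_zero_of_mulVec_eq_zero hd h0
    intro i; rw [this]; rfl
  have htop : Submodule.span ℂ (Set.range c) = ⊤ :=
    hli.span_eq_top_of_card_eq_finrank' (by simp)
  have hmem : ∀ Λ : LieSubalgebra ℂ S.M, (∀ i, S.dg (c i) ∈ Λ) → ∀ x, S.dg x ∈ Λ := by
    intro Λ hΛ x
    have hx : x ∈ Submodule.span ℂ (Set.range c) := by rw [htop]; trivial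
    induction hx using Submodule.span_induction with
    | mem x h => obtain ⟨i, rfl⟩ := h; exact hΛ i
    | zero => rw [map_zero]; exact Λ.zero_mem
    | add x y _ _ h1 h2 => rw [map_add]; exact Λ.add_mem h1 h2
    | smul a x _ h1 => rw [map_smul]; exact Λ.smul_mem _ h1
  have htr : ∀ i, IsSl2Triple (S.dg (c i)) (E i • S.F (p i) (q i)) (S.F (q i) (p i)) := fun i =>
    S.triple _ _ _ _ (h1 i) (by rw [← hA, h2]; norm_num)
  have hdi : Function.Injective S.dg := by
    intro x y h
    exact sub_eq_zero.1 (S.dg_inj (by rw [map_sub, h, sub_self]))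
  refine ⟨{
    A := A
    h := fun i => S.dg (c i)
    e := fun i => E i • S.F (p i) (q i)
    f := fun i => S.F (q i) (p i)
    cartan_eq_lieSpan := ?_
    span_ef := ?_
    linInd := ?_
    nondegen := Matrix.nondegenerate_of_det_ne_zero hdet
    sl2 := htr
    lie_h_h := fun i j => S.lie_dg_dg _ _
    lie_h_e := ?_
    lie_h_f := ?_
    lie_e_f_ne := ?_ }, rfl, fun i => rfl⟩
  · apply le_antisymm
    · rintro - ⟨x, rfl⟩
      refine hmem _ (fun i => ?_) x
      exact LieSubalgebra.subset_lieSpan ⟨i, rfl⟩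
    · rw [LieSubalgebra.lieSpan_le]
      rintro - ⟨i, rfl⟩
      exact S.dg_mem _
  · apply S.mem_of_F
    set Λ := LieSubalgebra.lieSpan ℂ S.M (Set.range (fun i => E i • S.F (p i) (q i)) ∪ Set.range (fun i => S.F (q i) (p i)))
    have he : ∀ i, S.F (p i) (q i) ∈ Λ := fun i => by
      have : E i • S.F (p i) (q i) ∈ Λ := LieSubalgebra.subset_lieSpan (Or.inl ⟨i, rfl⟩)
      have h3 := Λ.smul_mem (E i)⁻¹ this
      rwa [smul_smul, inv_mul_cancel₀ (hE i), one_smul] at h3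
    have hf : ∀ i, S.F (q i) (p i) ∈ Λ := fun i => LieSubalgebra.subset_lieSpan (Or.inr ⟨i, rfl⟩)
    refine hgen Λ he hf (hmem Λ fun i => ?_)
    rw [← h1]
    exact Λ.smul_mem _ (Λ.lie_mem (he i) (hf i))
  · exact hli.map' S.dg (LinearMap.ker_eq_bot.2 hdi)
  · intro i j
    rw [lie_smul, lie_dg_F, ← hA, smul_comm, Int.cast_smul_eq_zsmul]
  · intro i j
    rw [lie_dg_F, ← neg_sub, ← hA, neg_smul, Int.cast_smul_eq_zsmul, neg_smul]
  · intro i j hij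
    rw [smul_lie, hcomm i j hij, smul_zero]

lemma F_swap_mem {Λ : LieSubalgebra ℂ S.M} {a b : N} (h : S.F a b ∈ Λ) : S.F (S.σ b) (S.σ a) ∈ Λ := by
  rw [F_swap]; exact Λ.smul_mem _ h

lemma F_mul_mem {Λ : LieSubalgebra ℂ S.M} {a b c : N} (h1 : S.F a b ∈ Λ) (h2 : S.F b c ∈ Λ) (hac : a ≠ c)
    (hbc : b ≠ S.σ c) (hba : b ≠ S.σ a) : S.F a c ∈ Λ := by
  have := Λ.lie_mem h1 h2
  rwa [lie_F, if_pos rfl, if_neg hac, if_neg hbc, if_neg hba, sub_zero, sub_zero, sub_zero] at this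

structure Gd (Λ : LieSubalgebra ℂ S.M) (u : Fin n → N) : Prop where
  inj : Function.Injective u
  ne : ∀ i j, u i ≠ S.σ (u j)
  up : ∀ i j : Fin n, i.1 + 1 = j.1 → S.F (u i) (u j) ∈ Λ
  dn : ∀ i j : Fin n, i.1 + 1 = j.1 → S.F (u j) (u i) ∈ Λ

variable {S}
lemma Gd.all {Λ : LieSubalgebra ℂ S.M} {u : Fin n → N} (h : S.Gd Λ u) (i j : Fin n) (hij : i ≠ j) : S.F (u i) (u j) ∈ Λ := by
  have key : ∀ k : ℕ, ∀ i j : Fin n, i.1 + k + 1 = j.1 → S.F (u i) (u j) ∈ Λ ∧ S.F (u j) (u i) ∈ Λ := by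
    intro k
    induction k with
    | zero => intro i j hij; exact ⟨h.up i j hij, h.dn i j hij⟩
    | succ k ih =>
      intro i j hij
      have hl : i.1 + k + 1 < n := by omega
      obtain ⟨h1, h2⟩ := ih i ⟨i.1 + k + 1, hl⟩ rfl
      have h3 := h.up ⟨i.1 + k + 1, hl⟩ j (by simp; omega)
      have h4 := h.dn ⟨i.1 + k + 1, hl⟩ j (by simp; omega)
      have hne : u i ≠ u j := fun e => by have := h.inj e; rw [this] at hij; omega
      exact ⟨S.F_mul_mem h1 h3 hne (h.ne _ _) (h.ne _ _), S.F_mul_mem h4 h2 hne.symm (h.ne _ _) (h.ne _ _)⟩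
  rcases lt_trichotomy i.1 j.1 with h1 | h1 | h1
  · exact (key (j.1 - i.1 - 1) i j (by omega)).1
  · exact absurd (Fin.ext h1) hij
  · exact (key (i.1 - j.1 - 1) j i (by omega)).2

lemma Gd.neg {Λ : LieSubalgebra ℂ S.M} {u : Fin n → N} (h : S.Gd Λ u) : S.Gd Λ (fun i => S.σ (u i)) where
  inj i j e := h.inj ((Function.LeftInverse.injective S.hσ) e)
  ne i j e := h.ne j i (by rw [S.hσ] at e; exact e.symm)
  up i j hij := S.F_swap_mem (h.dn i j hij)
  dn i j hij := S.F_swap_mem (h.up i j hij)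

lemma Gd.D {Λ : LieSubalgebra ℂ S.M} {u : Fin n → N} (h : S.Gd Λ u) (hη : S.η = 1) {k l : Fin n} (hkl : k ≠ l)
    (hm : S.F (u k) (S.σ (u l)) ∈ Λ) (i j : Fin n) : S.F (u i) (S.σ (u j)) ∈ Λ := by
  have hi := (Function.LeftInverse.injective S.hσ)
  have h1 : ∀ i, i ≠ l → S.F (u i) (S.σ (u l)) ∈ Λ := by
    intro i hil
    by_cases hik : i = k
    · rw [hik]; exact hm
    · refine S.F_mul_mem (h.all i k hik) hm (h.ne _ _) ?_ (h.ne _ _)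
      rw [S.hσ]; exact fun e => hkl (h.inj e)
  have h2 : ∀ i j, i ≠ l → i ≠ j → S.F (u i) (S.σ (u j)) ∈ Λ := by
    intro i j hil hij
    by_cases hjl : j = l
    · rw [hjl]; exact h1 i hil
    · refine S.F_mul_mem (h1 i hil) (h.neg.all l j (Ne.symm hjl)) (h.ne _ _) ?_ ?_
      · rw [S.hσ]; exact (h.ne _ _).symm
      · exact fun e => hil (h.inj (hi e)).symm
  by_cases hij : i = j
  · rw [hij, S.F_self_zero _ hη]; exact Λ.zero_mem
  by_cases hil : i = l
  · have := S.F_swap_mem (h1 j (fun e => hij (hil.trans e.symm)))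
    rw [S.hσ] at this
    rw [hil]; exact this
  · exact h2 i j hil hij

lemma Gd.C {Λ : LieSubalgebra ℂ S.M} {u : Fin n → N} (h : S.Gd Λ u) (hη : S.η = -1) {k : Fin n}
    (hm : S.F (u k) (S.σ (u k)) ∈ Λ) (i j : Fin n) : S.F (u i) (S.σ (u j)) ∈ Λ := by
  have hi := (Function.LeftInverse.injective S.hσ)
  have h1 : ∀ i, S.F (u i) (S.σ (u k)) ∈ Λ := by
    intro i
    by_cases hik : i = k
    · rw [hik]; exact hm
    · have := Λ.lie_mem (h.all i k hik) hm
      rw [lie_F, if_pos rfl, if_neg (h.ne _ _), if_pos (S.hσ _).symm, if_neg (h.ne _ _), S.hη, hη,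
        div_eq_mul_inv, mul_inv, mul_comm, mul_assoc, inv_mul_cancel₀ (S.hs _)] at this
      have h3 := Λ.smul_mem (1 / 2 : ℂ) this
      convert h3 using 1
      norm_num
      module
  by_cases hjk : j = k
  · rw [hjk]; exact h1 i
  by_cases hik : i = k
  · have := S.F_swap_mem (h1 j)
    rw [S.hσ] at this
    rw [hik]; exact this
  refine S.F_mul_mem (h1 i) (h.neg.all k j (Ne.symm hjk)) (h.ne _ _) ?_ ?_
  · rw [S.hσ]; exact (h.ne _ _).symm
  · exact fun e => hik (h.inj (hi e)).symm

lemma Gd.B {Λ : LieSubalgebra ℂ S.M} {u : Fin n → N} (h : S.Gd Λ u) (hη : S.η = 1) {k : Fin n} {z : N}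
    (hz : S.σ z = z) (huz : ∀ i, u i ≠ z) (hm : S.F (u k) z ∈ Λ) :
    (∀ i, S.F (u i) z ∈ Λ) ∧ ∀ i j : Fin n, S.F (u i) (S.σ (u j)) ∈ Λ := by
  have huz' : ∀ i, z ≠ S.σ (u i) := fun i e => huz i (by rw [← hz, e, S.hσ])
  have h1 : ∀ i, S.F (u i) z ∈ Λ := by
    intro i
    by_cases hik : i = k
    · rw [hik]; exact hm
    · refine S.F_mul_mem (h.all i k hik) hm (huz i) ?_ (h.ne _ _)
      rw [hz]; exact huz k
  refine ⟨h1, fun i j => ?_⟩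
  by_cases hij : i = j
  · rw [hij, S.F_self_zero _ hη]; exact Λ.zero_mem
  have h2 := S.F_swap_mem (h1 j)
  rw [hz] at h2
  refine S.F_mul_mem (h1 i) h2 (h.ne _ _) ?_ (huz' i)
  rw [S.hσ]; exact (huz j).symm

lemma all_of {Λ : LieSubalgebra ℂ S.M} (hd : ∀ x, S.dg x ∈ Λ) (h : S.Gd Λ S.ι) (h1 : ∀ i j, S.F (S.ι i) (S.σ (S.ι j)) ∈ Λ)
    (h2 : ∀ i j, S.F (S.σ (S.ι i)) (S.ι j) ∈ Λ)
    (h3 : ∀ z, S.σ z = z → ∀ i, S.F (S.ι i) z ∈ Λ ∧ S.F (S.σ (S.ι i)) z ∈ Λ) (a b : N) : S.F a b ∈ Λ := by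
  have h4 : ∀ i j, S.F (S.ι i) (S.ι j) ∈ Λ := by
    intro i j
    by_cases hij : i = j
    · rw [hij, F_diag]; exact hd _
    · exact h.all i j hij
  have h5 : ∀ z, S.σ z = z → ∀ i, S.F z (S.ι i) ∈ Λ ∧ S.F z (S.σ (S.ι i)) ∈ Λ := by
    intro z hz i
    have ha := S.F_swap_mem (h3 z hz i).1
    have hb := S.F_swap_mem (h3 z hz i).2
    rw [hz] at ha hb
    rw [S.hσ] at hb
    exact ⟨hb, ha⟩
  rcases S.cov a with ⟨i, rfl⟩ | ⟨i, rfl⟩ | ha <;> rcases S.cov b with ⟨j, rfl⟩ | ⟨j, rfl⟩ | hb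
  · exact h4 i j
  · exact h1 i j
  · exact (h3 _ hb i).1
  · exact h2 i j
  · exact S.F_swap_mem (h4 j i)
  · exact (h3 _ hb i).2
  · exact (h5 _ ha j).1
  · exact (h5 _ ha j).2
  · rw [S.fix1 _ _ ha hb, S.F_fix_zero _ hb]; exact Λ.zero_mem

end Frm
end S5

namespace S5
open LieAlgebra LieModule

attribute [local instance] LieRing.ofAssociativeRing

namespace Frm
variable {n : ℕ} {N : Type} [Fintype N] [DecidableEq N] (S : Frm n N)

/-- next index -/
def nx (n : ℕ) (z : Fin n → N) (ι : Fin n → N) (i : Fin n) : N := if h : i.1 + 1 < n then ι ⟨i.1 + 1, h⟩ else z i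

lemma nx_pos {z ι : Fin n → N} {i : Fin n} (h : i.1 + 1 < n) : nx n z ι i = ι ⟨i.1 + 1, h⟩ := by
  simp [nx, h]
lemma nx_neg {z ι : Fin n → N} {i : Fin n} (h : ¬ i.1 + 1 < n) : nx n z ι i = z i := by
  simp [nx, h]

lemma gd_of {Λ : LieSubalgebra ℂ S.M} {z : Fin n → N} {p : Fin n → N} (hp : ∀ i : Fin n, i.1 + 1 < n → p i = S.ι i)
    (he : ∀ i, S.F (p i) (nx n z S.ι i) ∈ Λ)
    (hf : ∀ i, S.F (nx n z S.ι i) (p i) ∈ Λ) : S.Gd Λ S.ι where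
  inj := S.ι_inj
  ne := S.ι_ne
  up i j h := by
    have h1 := he i
    have hi : i.1 + 1 < n := by omega
    rw [nx_pos hi, hp i hi] at h1
    convert h1
    exact h.symm
  dn i j h := by
    have h1 := hf i
    have hi : i.1 + 1 < n := by omega
    rw [nx_pos hi, hp i hi] at h1
    convert h1
    exact h.symm

lemma comm_ι {i j k l} (h1 : j ≠ k) (h2 : i ≠ l) : ⁅S.F (S.ι i) (S.ι j), S.F (S.ι k) (S.ι l)⁆ = 0 := by
  rw [lie_F, if_neg (fun e => h1 (S.ι_inj e)), if_neg (fun e => h2 (S.ι_inj e)), if_neg (S.ι_ne _ _),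
    if_neg (S.ι_ne _ _)]; simp

lemma comm0 {a b c d : N} (h1 : b ≠ c) (h2 : a ≠ d) (h3 : b ≠ S.σ d) (h4 : c ≠ S.σ a) : ⁅S.F a b, S.F c d⁆ = 0 := by
  rw [lie_F, if_neg h1, if_neg h2, if_neg h3, if_neg h4]; simp

theorem basisB (z : N) (hz : S.σ z = z) (hη : S.η = 1) (hn : 1 ≤ n) (hdet : (CartanMatrix.B n).det ≠ 0) :
    ∃ b : LieAlgebra.Basis (Fin n) S.H, b.A = CartanMatrix.B n := by
  let cz : ℕ → ℕ → ℤ := fun j i => if i = j then (if j + 1 < n then 1 else 2) else if i = j + 1 then -1 else 0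
  have hιz : ∀ i, S.ι i ≠ z := fun i => S.ι_ne_fix i z hz
  have hzι : ∀ i, z ≠ S.σ (S.ι i) := fun i h => hιz i (by rw [← hz, h, S.hσ])
  refine Exists.imp (fun b h => h.1) (S.mkBasis S.ι (nx n (fun _ => z) S.ι) (fun i => if i.1 + 1 < n then 1 else 2)
    (fun j i => (cz j.1 i.1 : ℂ)) (CartanMatrix.B n) (by intro i; split_ifs <;> norm_num) ?_ ?_
    (CartanMatrix.B_diag n) hdet ?_ ?_)
  · intro i
    by_cases hi : i.1 + 1 < n
    · rw [nx_pos hi, if_pos hi, one_smul, S.tri1 _ _ (by simp [Fin.ext_iff])]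
      congr 1; ext k
      simp only [cz, Pi.sub_apply, Pi.single_apply, Fin.ext_iff, hi, if_true]
      split_ifs <;> first | omega | norm_num
    · rw [nx_neg hi, if_neg hi, S.triB z hz]
      congr 1; ext k
      have := k.2
      simp only [cz, Pi.smul_apply, Pi.single_apply, Fin.ext_iff, hi, if_false]
      split_ifs <;> first | omega | norm_num
  · intro i j
    have h1 : CartanMatrix.B n i j = cz j.1 i.1 - (if i.1 + 1 < n then cz j.1 (i.1 + 1) else 0) := by
      simp only [CartanMatrix.B, Matrix.of_apply, cz, Fin.ext_iff]
      have := i.2; have := j.2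
      split_ifs <;> omega
    rw [h1, S.hι]
    by_cases hi : i.1 + 1 < n
    · rw [nx_pos hi, S.hι, if_pos hi]; push_cast; rfl
    · rw [nx_neg hi, S.ext_fix _ _ hz, if_neg hi]; simp
  · intro i j hij
    have hv : i.1 ≠ j.1 := fun h => hij (Fin.ext h)
    by_cases hi : i.1 + 1 < n <;> by_cases hj : j.1 + 1 < n
    · rw [nx_pos hi, nx_pos hj]
      exact S.comm_ι (by simp [Fin.ext_iff, hv]) hij
    · rw [nx_pos hi, nx_neg hj]
      exact S.comm0 (hιz _) (fun e => hij (S.ι_inj e)) (S.ι_ne _ _) (hzι _)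
    · rw [nx_neg hi, nx_pos hj]
      exact S.comm0 (hιz _).symm (fun e => hij (S.ι_inj e)) (hzι _) (S.ι_ne _ _)
    · omega
  · intro Λ he hf hd
    have G := S.gd_of (p := S.ι) (fun _ _ => rfl) he hf
    let k : Fin n := ⟨n - 1, by omega⟩
    have hk : ¬ k.1 + 1 < n := by simp [k]; omega
    have h1 := he k
    have h2 := hf k
    rw [nx_neg hk] at h1 h2
    have h3 := S.F_swap_mem h2
    rw [hz] at h3
    have hh := G.B hη hz hιz h1
    have hh' := G.neg.B (k := k) hη hz (fun i => (hzι i).symm) h3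
    refine all_of hd G hh.2 (fun i j => ?_) (fun z' hz' i => ?_)
    · have := hh'.2 i j
      rwa [S.hσ] at this
    · rw [S.fix1 z' z hz' hz]; exact ⟨hh.1 i, hh'.1 i⟩

theorem basisC (hη : S.η = -1) (hfix : ∀ a, S.σ a ≠ a) (hn : 1 ≤ n) (hdet : (CartanMatrix.C n).det ≠ 0) :
    ∃ b : LieAlgebra.Basis (Fin n) S.H, b.A = CartanMatrix.C n := by
  let cz : ℕ → ℕ → ℤ := fun j i => if i = j then 1 else if i = j + 1 then -1 else 0
  have hi' := (Function.LeftInverse.injective S.hσ)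
  refine Exists.imp (fun b h => h.1) (S.mkBasis S.ι (nx n (fun i => S.σ (S.ι i)) S.ι) (fun i => if i.1 + 1 < n then 1 else 1 / 4)
    (fun j i => (cz j.1 i.1 : ℂ)) (CartanMatrix.C n) (by intro i; split_ifs <;> norm_num) ?_ ?_
    (CartanMatrix.C_diag n) hdet ?_ ?_)
  · intro i
    by_cases hi : i.1 + 1 < n
    · rw [nx_pos hi, if_pos hi, one_smul, S.tri1 _ _ (by simp [Fin.ext_iff])]
      congr 1; ext k
      simp only [cz, Pi.sub_apply, Pi.single_apply, Fin.ext_iff]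
      split_ifs <;> first | omega | norm_num
    · rw [nx_neg hi, if_neg hi, S.triC hη]
      congr 1; ext k
      have := k.2
      simp only [cz, Pi.single_apply, Fin.ext_iff]
      split_ifs <;> first | omega | norm_num
  · intro i j
    have h1 : CartanMatrix.C n i j = cz j.1 i.1 - (if i.1 + 1 < n then cz j.1 (i.1 + 1) else -cz j.1 i.1) := by
      simp only [CartanMatrix.C, Matrix.of_apply, cz, Fin.ext_iff]
      have := i.2; have := j.2
      split_ifs <;> omega
    rw [h1, S.hι]
    by_cases hi : i.1 + 1 < n
    · rw [nx_pos hi, S.hι, if_pos hi]; push_cast; rfl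
    · rw [nx_neg hi, S.hext, S.hι, if_neg hi]; push_cast; rfl
  · intro i j hij
    have hv : i.1 ≠ j.1 := fun h => hij (Fin.ext h)
    by_cases hi : i.1 + 1 < n <;> by_cases hj : j.1 + 1 < n
    · rw [nx_pos hi, nx_pos hj]
      exact S.comm_ι (by simp [Fin.ext_iff, hv]) hij
    · rw [nx_pos hi, nx_neg hj]
      exact S.comm0 (S.ι_ne _ _) (fun e => hij (S.ι_inj e)) (S.ι_ne _ _) (fun e => hij (S.ι_inj (hi' e)).symm)
    · rw [nx_neg hi, nx_pos hj]
      exact S.comm0 (S.ι_ne _ _).symm (fun e => hij (S.ι_inj e)) (fun e => hij (S.ι_inj (hi' e))) (S.ι_ne _ _)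
    · omega
  · intro Λ he hf hd
    have G := S.gd_of (p := S.ι) (fun _ _ => rfl) he hf
    let k : Fin n := ⟨n - 1, by omega⟩
    have hk : ¬ k.1 + 1 < n := by simp [k]; omega
    have h1 := he k
    have h2 := hf k
    rw [nx_neg hk] at h1 h2
    have hh := G.C hη h1
    have hh' := G.neg.C (k := k) hη (by rw [S.hσ]; exact h2)
    refine all_of hd G hh (fun i j => ?_) (fun z' hz' i => absurd hz' (hfix z'))
    have := hh' i j
    rwa [S.hσ] at this

theorem basisD (hη : S.η = 1) (hfix : ∀ a, S.σ a ≠ a) (hn : 3 ≤ n) (hdet : (CartanMatrix.D n).det ≠ 0) :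
    ∃ b : LieAlgebra.Basis (Fin n) S.H, b.A = CartanMatrix.D n := by
  let cz : ℕ → ℕ → ℤ := fun j i => if j + 1 < n then (if i = j then 1 else if i = j + 1 then -1 else 0) else
    (if i = j then 1 else if i + 1 = j then 1 else 0)
  have hi' := (Function.LeftInverse.injective S.hσ)
  let p : Fin n → N := fun i => if i.1 + 1 < n then S.ι i else S.ι ⟨i.1 - 1, by omega⟩
  have hp1 : ∀ i : Fin n, i.1 + 1 < n → p i = S.ι i := fun i h => by simp [p, h]
  have hp2 : ∀ i : Fin n, ¬ i.1 + 1 < n → p i = S.ι ⟨i.1 - 1, by omega⟩ := fun i h => by simp [p, h]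
  refine Exists.imp (fun b h => h.1) (S.mkBasis p (nx n (fun i => S.σ (S.ι i)) S.ι) (fun i => 1)
    (fun j i => (cz j.1 i.1 : ℂ)) (CartanMatrix.D n) (by intro i; norm_num) ?_ ?_
    (CartanMatrix.D_diag n) hdet ?_ ?_)
  · intro i
    by_cases hi : i.1 + 1 < n
    · rw [nx_pos hi, hp1 i hi, one_smul, S.tri1 _ _ (by simp [Fin.ext_iff])]
      congr 1; ext k
      simp only [cz, Pi.sub_apply, Pi.single_apply, Fin.ext_iff, hi, if_true]
      split_ifs <;> first | omega | norm_num
    · rw [nx_neg hi, hp2 i hi, one_smul, S.tri2 _ _ (by simp [Fin.ext_iff]; omega)]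
      congr 1; ext k
      have := k.2
      simp only [cz, Pi.add_apply, Pi.single_apply, Fin.ext_iff, hi, if_false]
      split_ifs <;> first | omega | norm_num
  · intro i j
    have h1 : CartanMatrix.D n i j = (if i.1 + 1 < n then cz j.1 i.1 - cz j.1 (i.1 + 1) else cz j.1 (i.1 - 1) + cz j.1 i.1) := by
      simp only [CartanMatrix.D, Matrix.of_apply, cz, Fin.ext_iff]
      have := i.2; have := j.2
      split_ifs <;> omega
    rw [h1]
    by_cases hi : i.1 + 1 < n
    · rw [nx_pos hi, hp1 i hi, S.hι, S.hι, if_pos hi]; push_cast; rfl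
    · rw [nx_neg hi, hp2 i hi, S.hext, S.hι, S.hι, if_neg hi]; push_cast; ring
  · intro i j hij
    have hv : i.1 ≠ j.1 := fun h => hij (Fin.ext h)
    by_cases hi : i.1 + 1 < n <;> by_cases hj : j.1 + 1 < n
    · rw [nx_pos hi, nx_pos hj, hp1 i hi, hp1 j hj]
      exact S.comm_ι (by simp [Fin.ext_iff, hv]) hij
    · rw [nx_pos hi, nx_neg hj, hp1 i hi, hp2 j hj]
      by_cases hc : i.1 + 1 = j.1
      · have e1 : i = ⟨j.1 - 1, by omega⟩ := Fin.ext (by simp; omega)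
        have e2 : (⟨i.1 + 1, hi⟩ : Fin n) = j := Fin.ext hc
        rw [← e1, e2, lie_F, if_neg (S.ι_ne _ _), if_pos rfl, if_neg (S.ι_ne _ _), if_neg (fun e => hij (S.ι_inj (hi' e)).symm)]
        have := S.F_self_zero (S.σ (S.ι j)) hη
        rw [S.hσ] at this
        rw [this]; simp
      · exact S.comm0 (S.ι_ne _ _) (fun e => by have := congrArg Fin.val (S.ι_inj e); simp at this; omega)
          (S.ι_ne _ _) (fun e => hij (S.ι_inj (hi' e)).symm)
    · rw [nx_neg hi, nx_pos hj, hp2 i hi, hp1 j hj]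
      by_cases hc : j.1 + 1 = i.1
      · have e1 : j = ⟨i.1 - 1, by omega⟩ := Fin.ext (by simp; omega)
        have e2 : (⟨j.1 + 1, hj⟩ : Fin n) = i := Fin.ext hc
        rw [← e1, e2, lie_F, if_neg (S.ι_ne _ _).symm, if_pos rfl, if_neg (fun e => hij (S.ι_inj (hi' e))), if_neg (S.ι_ne _ _)]
        have := S.F_self_zero (S.ι i) hη
        rw [this]; simp
      · exact S.comm0 (S.ι_ne _ _).symm (fun e => by have := congrArg Fin.val (S.ι_inj e); simp at this; omega)
          (fun e => hij (S.ι_inj (hi' e))) (S.ι_ne _ _)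
    · omega
  · intro Λ he hf hd
    have G := S.gd_of hp1 he hf
    let k : Fin n := ⟨n - 1, by omega⟩
    have hk : ¬ k.1 + 1 < n := by simp [k]; omega
    have h1 := he k
    have h2 := hf k
    rw [nx_neg hk, hp2 k hk] at h1 h2
    have hne : (⟨k.1 - 1, by omega⟩ : Fin n) ≠ k := by simp [Fin.ext_iff, k]; omega
    have hh := G.D hη hne h1
    have hh' := G.neg.D (k := k) hη hne.symm (by rw [S.hσ]; exact h2)
    refine all_of hd G hh (fun i j => ?_) (fun z' hz' i => absurd hz' (hfix z'))
    have := hh' i j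
    rwa [S.hσ] at this

end Frm

section
variable {g : Type} [LieRing g] [LieAlgebra ℂ g] [FiniteDimensional ℂ g] {t : LieSubalgebra ℂ g}

theorem fwd_B (n : ℕ) (hn : 1 ≤ n) (b : LieAlgebra.Basis (Fin n) t) (hP : PosM b.A) (hA : b.A = CartanMatrix.B n) :
    Nonempty (g ≃ₗ⁅ℂ⁆ LieAlgebra.Orthogonal.typeB (Fin n) ℂ) := by
  rw [frmB_M]
  obtain ⟨b', h⟩ := (frmB n).basisB (Sum.inl ()) rfl rfl hn (by rw [← hA]; exact b.nondegen.det_ne_zero)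
  exact basis_equiv b hP b' (by rw [h, hA])

theorem fwd_C (n : ℕ) (hn : 1 ≤ n) (b : LieAlgebra.Basis (Fin n) t) (hP : PosM b.A) (hA : b.A = CartanMatrix.C n) :
    Nonempty (g ≃ₗ⁅ℂ⁆ LieAlgebra.Symplectic.sp (Fin n) ℂ) := by
  rw [frmC_M]
  obtain ⟨b', h⟩ := (frmC n).basisC rfl (by rintro (i | i) <;> simp [frmC]) hn (by rw [← hA]; exact b.nondegen.det_ne_zero)
  exact basis_equiv b hP b' (by rw [h, hA])

theorem fwd_D (n : ℕ) (hn : 3 ≤ n) (b : LieAlgebra.Basis (Fin n) t) (hP : PosM b.A) (hA : b.A = CartanMatrix.D n) :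
    Nonempty (g ≃ₗ⁅ℂ⁆ LieAlgebra.Orthogonal.typeD (Fin n) ℂ) := by
  rw [frmD_M]
  obtain ⟨b', h⟩ := (frmD n).basisD rfl (by rintro (i | i) <;> simp [frmD]) hn (by rw [← hA]; exact b.nondegen.det_ne_zero)
  exact basis_equiv b hP b' (by rw [h, hA])

/-- an isomorphism matching the Cartan subalgebras -/
theorem basis_equiv' {ι : Type} [Fintype ι] [DecidableEq ι] (b : LieAlgebra.Basis ι t) (hP : PosM b.A) {L' : Type} [LieRing L']
    [LieAlgebra ℂ L'] [FiniteDimensional ℂ L'] {H' : LieSubalgebra ℂ L'}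
    (b' : LieAlgebra.Basis ι H') (hA : b'.A = b.A) : ∃ φ : g ≃ₗ⁅ℂ⁆ L', ∀ y ∈ H', φ.symm y ∈ t := by
  obtain ⟨φ, hφ, -⟩ := serre_equiv b hP
  have h2 := serre_equiv b' (hA ▸ hP)
  rw [hA] at h2
  obtain ⟨φ', hφ', -⟩ := h2
  refine ⟨φ.symm.trans φ', fun y hy => ?_⟩
  have hx' : y ∈ Submodule.span ℂ (Set.range b'.h) := by rw [← b'.coe_cartan_eq_span]; exact hy
  clear hy
  have hs : ∀ y, (φ.symm.trans φ').symm y = φ (φ'.symm y) := fun y => rfl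
  have hs' : ∀ y, φ'.symm (φ' y) = y := fun y => φ'.symm_apply_apply y
  rw [hs]
  induction hx' using Submodule.span_induction with
  | mem x h =>
    obtain ⟨j, rfl⟩ := h
    rw [← hφ' j, hs', hφ]
    exact b.cartan_eq_lieSpan.ge (LieSubalgebra.subset_lieSpan ⟨j, rfl⟩)
  | zero => rw [map_zero, map_zero]; exact t.zero_mem
  | add x y _ _ h1 h2 => rw [map_add, map_add]; exact t.add_mem h1 h2
  | smul a x _ h1 => rw [map_smul, map_smul]; exact t.smul_mem _ h1
end
end S5

namespace S5
open LieAlgebra LieModule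

attribute [local instance] LieRing.ofAssociativeRing

section
open Matrix NormedSpace
variable {n : ℕ}

lemma JD_sq : (frmD n).J * (frmD n).J = 1 := by
  ext (i | i) (j | j) <;> simp [Frm.J, frmD, Matrix.mul_apply, Matrix.one_apply]

lemma JD_det : (frmD n).J.det = (-1) ^ n := by
  have h : (frmD n).J = Matrix.fromBlocks 0 1 1 0 := by
    ext (i | i) (j | j) <;> simp [Frm.J, frmD, Matrix.one_apply]
  have h1 : (Matrix.fromBlocks 1 1 0 1 : Matrix (Fin n ⊕ Fin n) (Fin n ⊕ Fin n) ℂ) * (frmD n).J = Matrix.fromBlocks 1 1 1 0 := by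
    rw [h, Matrix.fromBlocks_multiply]; simp
  have h2 := congrArg Matrix.det h1
  rw [Matrix.det_mul, Matrix.det_fromBlocks_zero₂₁, Matrix.det_fromBlocks_one₁₁] at h2
  simpa [Matrix.det_neg] using h2

lemma exp_JD (X : Matrix (Fin n ⊕ Fin n) (Fin n ⊕ Fin n) ℂ) (hX : X ∈ (frmD n).M) :
    (exp X)ᵀ * (frmD n).J * exp X = (frmD n).J := by
  have h0 : Xᵀ * (frmD n).J = (frmD n).J * (-X) := by
    rw [Frm.M, mem_skewAdjointMatricesLieSubalgebra, mem_skewAdjointMatricesSubmodule] at hX; exact hX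
  let U : (Matrix (Fin n ⊕ Fin n) (Fin n ⊕ Fin n) ℂ)ˣ := ⟨(frmD n).J, (frmD n).J, JD_sq, JD_sq⟩
  have h1 : Xᵀ = (U : Matrix _ _ ℂ) * (-X) * ((U⁻¹ : (Matrix _ _ ℂ)ˣ) : Matrix _ _ ℂ) := by
    change Xᵀ = (frmD n).J * (-X) * (frmD n).J
    rw [← h0, mul_assoc, JD_sq, mul_one]
  rw [← Matrix.exp_transpose, h1, Matrix.exp_units_conj]
  change (frmD n).J * exp (-X) * (frmD n).J * (frmD n).J * exp X = _
  rw [mul_assoc ((frmD n).J * exp (-X)), JD_sq, mul_one, mul_assoc, exp_neg_mul_exp, mul_one]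

lemma det_sq_of {P : Matrix (Fin n ⊕ Fin n) (Fin n ⊕ Fin n) ℂ} (h : Pᵀ * (frmD n).J * P = (frmD n).J) : P.det * P.det = 1 := by
  have h1 := congrArg Matrix.det h
  rw [Matrix.det_mul, Matrix.det_mul, Matrix.det_transpose] at h1
  have h2 : (frmD n).J.det ≠ 0 := by rw [JD_det]; exact pow_ne_zero _ (by norm_num)
  exact mul_right_cancel₀ h2 (by rw [one_mul]; linear_combination h1)

lemma exp_det (X : Matrix (Fin n ⊕ Fin n) (Fin n ⊕ Fin n) ℂ) (hX : X ∈ (frmD n).M) : (exp X).det = 1 := by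
  have h1 : exp X = exp ((1 / 2 : ℂ) • X) * exp ((1 / 2 : ℂ) • X) := by
    rw [← Matrix.exp_add_of_commute _ _ (Commute.refl _)]
    congr 1; module
  rw [h1, Matrix.det_mul]
  exact det_sq_of (exp_JD _ ((frmD n).M.smul_mem _ hX))

variable {g : Type} [LieRing g] [LieAlgebra ℂ g] [FiniteDimensional ℂ g] {t : LieSubalgebra ℂ g}

theorem D_excl (hn : 3 ≤ n) (b : LieAlgebra.Basis (Fin n) t) (hP : PosM b.A) (hA : b.A = CartanMatrix.D n)
    {γ : g ≃ₗ[ℂ] g} (hγ : γ ∈ adjointGroup g) (hγt : ∀ x ∈ t, γ x = -x) : Even n := by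
  set S := frmD n with hS
  obtain ⟨b', h⟩ := S.basisD rfl (by rintro (i | i) <;> simp [S, frmD]) hn (by rw [← hA]; exact b.nondegen.det_ne_zero)
  obtain ⟨φ, hφ⟩ := basis_equiv' b hP b' (by rw [h, hA])
  let ρ : g →ₗ⁅ℂ⁆ Matrix (Fin n ⊕ Fin n) (Fin n ⊕ Fin n) ℂ := S.M.incl.comp φ.toLieHom
  have hρ : ∀ x, ρ x = (φ x : Matrix _ _ ℂ) := fun x => rfl
  obtain ⟨P, hPc, hPρ⟩ := rho_conj ρ hγ
  have hprop : ((P : Matrix (Fin n ⊕ Fin n) (Fin n ⊕ Fin n) ℂ))ᵀ * S.J * P = S.J ∧ (P : Matrix (Fin n ⊕ Fin n) (Fin n ⊕ Fin n) ℂ).det = 1 := by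
    clear hPρ
    induction hPc using Subgroup.closure_induction with
    | mem u hu =>
      obtain ⟨x, rfl⟩ := hu
      exact ⟨exp_JD _ (φ x).2, exp_det _ (φ x).2⟩
    | one => simp
    | mul u v _ _ h1 h2 =>
      refine ⟨?_, ?_⟩
      · rw [Units.val_mul, Matrix.transpose_mul]
        calc _ = (v : Matrix _ _ ℂ)ᵀ * ((u : Matrix _ _ ℂ)ᵀ * S.J * (u : Matrix _ _ ℂ)) * (v : Matrix _ _ ℂ) := by
              simp only [mul_assoc]
          _ = _ := by rw [h1.1, h2.1]
      · rw [Units.val_mul, Matrix.det_mul, h1.2, h2.2, mul_one]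
    | inv u _ h1 =>
      have e1 : (u : Matrix (Fin n ⊕ Fin n) (Fin n ⊕ Fin n) ℂ) * ((u⁻¹ : (Matrix (Fin n ⊕ Fin n) (Fin n ⊕ Fin n) ℂ)ˣ) : Matrix (Fin n ⊕ Fin n) (Fin n ⊕ Fin n) ℂ) = 1 := u.mul_inv
      have e2 : ((u⁻¹ : (Matrix (Fin n ⊕ Fin n) (Fin n ⊕ Fin n) ℂ)ˣ) : Matrix (Fin n ⊕ Fin n) (Fin n ⊕ Fin n) ℂ)ᵀ * (u : Matrix (Fin n ⊕ Fin n) (Fin n ⊕ Fin n) ℂ)ᵀ = 1 := by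
        rw [← Matrix.transpose_mul, e1, Matrix.transpose_one]
      refine ⟨?_, ?_⟩
      · conv_lhs => rw [← h1.1]
        calc _ = (((u⁻¹ : (Matrix (Fin n ⊕ Fin n) (Fin n ⊕ Fin n) ℂ)ˣ) : Matrix (Fin n ⊕ Fin n) (Fin n ⊕ Fin n) ℂ)ᵀ * (u : Matrix (Fin n ⊕ Fin n) (Fin n ⊕ Fin n) ℂ)ᵀ) * S.J * ((u : Matrix (Fin n ⊕ Fin n) (Fin n ⊕ Fin n) ℂ) * ((u⁻¹ : (Matrix (Fin n ⊕ Fin n) (Fin n ⊕ Fin n) ℂ)ˣ) : Matrix (Fin n ⊕ Fin n) (Fin n ⊕ Fin n) ℂ)) := by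
              simp only [mul_assoc]
          _ = _ := by rw [e1, e2, one_mul, mul_one]
      · have := congrArg Matrix.det e1
        rwa [Matrix.det_mul, h1.2, one_mul, Matrix.det_one] at this
  obtain ⟨hPJ, hPd⟩ := hprop
  obtain ⟨x0, hx0⟩ := S.reg
  have h1 := hPρ (φ.symm (S.dg x0))
  have hs : φ (φ.symm (S.dg x0)) = S.dg x0 := φ.apply_symm_apply _
  rw [hγt _ (hφ _ (S.dg_mem x0)), map_neg, hρ, hs, S.coe_dg] at h1
  have h2 : (P : Matrix _ _ ℂ) * Matrix.diagonal (S.ext x0) = - Matrix.diagonal (S.ext x0) * (P : Matrix _ _ ℂ) := by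
    rw [h1]
    simp only [mul_assoc]
    rw [P.inv_mul, mul_one]
  have h3 : ∀ a b, b ≠ S.σ a → (P : Matrix (Fin n ⊕ Fin n) (Fin n ⊕ Fin n) ℂ) a b = 0 := by
    intro a b hb
    have h4 := congrFun (congrFun h2 a) b
    rw [Matrix.mul_diagonal, neg_mul, Matrix.neg_apply, Matrix.diagonal_mul] at h4
    have h5 : (S.ext x0 b - S.ext x0 (S.σ a)) * (P : Matrix (Fin n ⊕ Fin n) (Fin n ⊕ Fin n) ℂ) a b = 0 := by
      rw [S.hext]; linear_combination h4
    rcases mul_eq_zero.1 h5 with h6 | h6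
    · exact absurd (hx0 (sub_eq_zero.1 h6)) hb
    · exact h6
  have hJJ : S.J * S.J = 1 := JD_sq
  have hJs : S.J.transpose = S.J := by
    ext (i | i) (j | j) <;> simp [S, Frm.J, frmD, eq_comm]
  have hJa : ∀ a b, S.J a b = if a = S.σ b then 1 else 0 := fun a b => rfl
  let p : Fin n ⊕ Fin n → ℂ := fun a => (P : Matrix (Fin n ⊕ Fin n) (Fin n ⊕ Fin n) ℂ) a (S.σ a)
  have hPp : (P : Matrix (Fin n ⊕ Fin n) (Fin n ⊕ Fin n) ℂ) = Matrix.diagonal p * S.J := by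
    ext a b
    rw [Matrix.diagonal_mul, hJa]
    by_cases hb : b = S.σ a
    · rw [if_pos (by rw [hb, S.hσ]), hb, mul_one]
    · rw [if_neg (fun e => hb (by rw [e, S.hσ])), mul_zero, h3 a b hb]
  have hJp : S.J * Matrix.diagonal p = Matrix.diagonal (fun a => p (S.σ a)) * S.J := by
    ext a b
    rw [Matrix.diagonal_mul, Matrix.mul_diagonal, hJa]
    by_cases hb : a = S.σ b
    · rw [if_pos hb, hb, S.hσ]; ring
    · rw [if_neg hb]; ring
  have h7 : Matrix.diagonal (fun a => p (S.σ a) * p a) = 1 := by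
    rw [hPp, Matrix.transpose_mul, hJs, Matrix.diagonal_transpose, hJp] at hPJ
    have h8 : Matrix.diagonal (fun a => p (S.σ a)) * Matrix.diagonal p * S.J = S.J := by
      calc _ = Matrix.diagonal (fun a => p (S.σ a)) * (S.J * S.J) * Matrix.diagonal p * S.J := by rw [hJJ, mul_one]
        _ = _ := by rw [← mul_assoc] at hPJ ⊢; exact hPJ
    have h9 := congrArg (· * S.J) h8
    simp only [mul_assoc, hJJ, mul_one] at h9
    rw [Matrix.diagonal_mul_diagonal] at h9
    exact h9
  have h8 : ∀ a, p (S.σ a) * p a = 1 := fun a => by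
    have := congrFun (congrFun h7 a) a
    rwa [Matrix.diagonal_apply_eq, Matrix.one_apply_eq] at this
  rw [hPp, Matrix.det_mul, Matrix.det_diagonal, JD_det, Fintype.prod_sum_type, ← Finset.prod_mul_distrib] at hPd
  have hpr : ∏ x, p (Sum.inl x) * p (Sum.inr x) = 1 :=
    Finset.prod_eq_one (fun i _ => h8 (Sum.inr i))
  rw [hpr, one_mul] at hPd
  by_contra hodd
  rw [Nat.not_even_iff_odd] at hodd
  rw [hodd.neg_one_pow] at hPd
  norm_num at hPd
end
end S5

/-- Let `g` be a complex simple Lie algebra.  The Chevalley involution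
`ψ` of `g` is an inner automorphism if and only if `g` has type `B_n (n ≥ 1)`,
`C_n (n ≥ 3)`, `D_{2n} (n ≥ 2)`, `E₇`, `E₈`, `F₄` or `G₂`. -/
theorem stmt5 (g : Type) [LieRing g] [LieAlgebra ℂ g] [FiniteDimensional ℂ g]
    [LieAlgebra.IsSimple ℂ g]
    (t : LieSubalgebra ℂ g) [t.IsCartanSubalgebra]
    -- the Chevalley involution `ψ`: an order-2 automorphism of `g`
    -- acting as `-1` on the Cartan subalgebra `t`
    (ψ : g ≃ₗ⁅ℂ⁆ g) (hψ2 : ∀ x : g, ψ (ψ x) = x) (hψt : ∀ x ∈ t, ψ x = -x) :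
    ψ.toLinearEquiv ∈ adjointGroup g ↔
      ((∃ n : ℕ, 1 ≤ n ∧ Nonempty (g ≃ₗ⁅ℂ⁆ LieAlgebra.Orthogonal.typeB (Fin n) ℂ)) ∨
       (∃ n : ℕ, 3 ≤ n ∧ Nonempty (g ≃ₗ⁅ℂ⁆ LieAlgebra.Symplectic.sp (Fin n) ℂ)) ∨
       (∃ n : ℕ, 2 ≤ n ∧ Nonempty (g ≃ₗ⁅ℂ⁆ LieAlgebra.Orthogonal.typeD (Fin (2 * n)) ℂ)) ∨
       Nonempty (g ≃ₗ⁅ℂ⁆ LieAlgebra.e₇ ℂ) ∨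
       Nonempty (g ≃ₗ⁅ℂ⁆ LieAlgebra.e₈ ℂ) ∨
       Nonempty (g ≃ₗ⁅ℂ⁆ LieAlgebra.f₄ ℂ) ∨
       Nonempty (g ≃ₗ⁅ℂ⁆ LieAlgebra.g₂ ℂ)) := by
  constructor
  · intro hγ
    have hγt : ∀ x ∈ t, ψ.toLinearEquiv x = -x := hψt
    obtain ⟨ι, i1, i2, b, hb⟩ := S5.exists_good_basis t
    rcases hb.cls with ⟨n, hn, s, h⟩ | ⟨n, hn, s, h⟩ | ⟨n, hn, s, h⟩ | ⟨n, hn, s, h⟩ | ⟨s, h⟩ |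
      ⟨s, h⟩ | ⟨s, h⟩ | ⟨s, h⟩ | ⟨s, h⟩
    · obtain ⟨b', hA, hP⟩ := S5.exists_re b hb.pos s _ h
      have h1 := S5.A_excl n b' hP hA hγ hγt
      obtain rfl : n = 1 := le_antisymm h1 hn
      exact Or.inl ⟨1, le_rfl, S5.fwd_B 1 le_rfl b' hP (hA.trans (by decide +kernel))⟩
    · obtain ⟨b', hA, hP⟩ := S5.exists_re b hb.pos s _ h
      exact Or.inl ⟨n, by omega, S5.fwd_B n (by omega) b' hP hA⟩
    · obtain ⟨b', hA, hP⟩ := S5.exists_re b hb.pos s _ h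
      exact Or.inr (Or.inl ⟨n, hn, S5.fwd_C n (by omega) b' hP hA⟩)
    · obtain ⟨b', hA, hP⟩ := S5.exists_re b hb.pos s _ h
      obtain ⟨m, hm⟩ := S5.D_excl (by omega) b' hP hA hγ hγt
      obtain rfl : n = 2 * m := by omega
      exact Or.inr (Or.inr (Or.inl ⟨m, by omega, S5.fwd_D _ (by omega) b' hP hA⟩))
    · obtain ⟨b', hA, hP⟩ := S5.exists_re b hb.pos s _ h
      exact (S5.E_excl b' hP hA hγ hγt).elim
    · exact Or.inr (Or.inr (Or.inr (Or.inl
        (S5.fwd_serre b hb.pos s _ h (Equiv.refl _) (by decide +kernel)))))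
    · exact Or.inr (Or.inr (Or.inr (Or.inr (Or.inl
        (S5.fwd_serre b hb.pos s _ h (Equiv.refl _) (by decide +kernel))))))
    · exact Or.inr (Or.inr (Or.inr (Or.inr (Or.inr (Or.inl
        (S5.fwd_serre b hb.pos s _ h Fin.revPerm (by decide +kernel)))))))
    · exact Or.inr (Or.inr (Or.inr (Or.inr (Or.inr (Or.inr
        (S5.fwd_serre b hb.pos s _ h Fin.revPerm (by decide +kernel)))))))
  · rintro (⟨n, _, h⟩ | ⟨n, _, h⟩ | ⟨n, _, h⟩ | h | h | h | h)
    · exact S5.back_B t ψ hψt n h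
    · exact S5.back_C t ψ hψt n h
    · exact S5.back_D t ψ hψt n h
    · exact S5.back_E7 t ψ hψt h
    · exact S5.back_E8 t ψ hψt h
    · exact S5.back_F t ψ hψt h
    · exact S5.back_G t ψ hψt h
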